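/- Suppose E is a disk centered at the origin, g = χ_E ∏_{i=1}^n |f_i|^{γ_i} is of the standard form, and not every f_i(0,0) is nonzero. Let p₁ ≠ p₂ and let V be any of the four wedges with vertex (0,0) formed by the lines y = p₁x and y = p₂x. Suppose each F_i (the lowest-degree Taylor part of f_i at the origin) has no zeroes on cl(V) ∩ (ℝ∖{0})². Then there is a disk B centered at the origin such that for every function α supported in B with |α| ≤ A and |∇α(x,y)| ≤ A(x²+y²)^{−1/2}, one has |∫_{B∩V} α(x,y) ∏_{i=1}^n |f_i(x,y)|^{γ_i} e^{i(tx+uy)} dx dy| ≤ C ∫_{B∩V} (1+|tx|+|uy|)^{−1/2} ∏_{i=1}^n |f_i(x,y)|^{γ_i} dx dy for all (t,u). Moreover, if each F_i has no zeroes on all of (ℝ∖{0})², then |∫_{B} α ∏|f_i|^{γ_i} e^{i(tx+uy)} dx dy| ≤ C ∫_{B} (1+|tx|+|uy|)^{−1/2} ∏|f_i|^{γ_i} dx dy for all (t,u). -/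

import Mathlib

open MeasureTheory Real Set Filter Metric
open scoped Topology ENNReal

noncomputable section

/-- The Euclidean magnitude `|(x,y)| = √(x²+y²)` of a point of `ℝ²`. -/
def nrm2 (p : ℝ × ℝ) : ℝ := Real.sqrt (p.1 ^ 2 + p.2 ^ 2)

/-- The open Euclidean disk `{(x,y) : x²+y² < r²}` centered at the origin. -/
def disk2 (r : ℝ) : Set (ℝ × ℝ) := {p : ℝ × ℝ | p.1 ^ 2 + p.2 ^ 2 < r ^ 2}

/-- The closed Euclidean disk `{(x,y) : x²+y² ≤ r²}` centered at the origin. -/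
def closedDisk2 (r : ℝ) : Set (ℝ × ℝ) := {p : ℝ × ℝ | p.1 ^ 2 + p.2 ^ 2 ≤ r ^ 2}

/-- The circle `{(x,y) : x²+y² = r²}` centered at the origin. -/
def circle2 (r : ℝ) : Set (ℝ × ℝ) := {p : ℝ × ℝ | p.1 ^ 2 + p.2 ^ 2 = r ^ 2}

/-- Dot product on `ℝ²`. -/
def dot2 (p q : ℝ × ℝ) : ℝ := p.1 * q.1 + p.2 * q.2

/-- The perpendicular vector `v^⊥ = (v₂, −v₁)`. -/
def perp2 (v : ℝ × ℝ) : ℝ × ℝ := (v.2, -v.1)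

/-- The function `g = χ_E · ∏ᵢ |fᵢ|^(γᵢ)`. -/
def stdFun (n : ℕ) (f : Fin n → ℝ × ℝ → ℝ) (γ : Fin n → ℝ) (E : Set (ℝ × ℝ)) :
    ℝ × ℝ → ℝ :=
  E.indicator fun p => ∏ i, |f i p| ^ (γ i)

/-- A boundary curve for the region `E`: one half of a graph `y = h(|x|^{1/N})` or
`x = h(|y|^{1/N})` with `h` real analytic, `h 0 = 0`, joining the origin to the circle
of radius `r₀`. -/
def IsPuiseuxBdryCurve (r₀ : ℝ) (C : Set (ℝ × ℝ)) : Prop :=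
  ∃ (N : ℕ) (h : ℝ → ℝ) (I : Set ℝ) (σ : ℝ),
    0 < N ∧ (σ = 1 ∨ σ = -1) ∧ IsOpen I ∧ Icc (0:ℝ) (r₀ ^ ((N:ℝ)⁻¹)) ⊆ I ∧
    AnalyticOnNhd ℝ h I ∧ h 0 = 0 ∧
    (C = {p : ℝ × ℝ | p ∈ closedDisk2 r₀ ∧ 0 ≤ σ * p.1 ∧
            p.2 = h (|p.1| ^ ((N:ℝ)⁻¹))} ∨
     C = {p : ℝ × ℝ | p ∈ closedDisk2 r₀ ∧ 0 ≤ σ * p.2 ∧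
            p.1 = h (|p.2| ^ ((N:ℝ)⁻¹))}) ∧
    (0:ℝ×ℝ) ∈ C ∧ ∃ p ∈ C, nrm2 p = r₀

/-- The admissible form of the set `E`: either a disk centered at the origin, or a finite
disjoint union of open regions, each bounded by two Puiseux boundary curves joining the
origin to the circle of radius `r₀` together with an arc of that circle, where all the
boundary curves are pairwise disjoint in the closed disk minus the origin. -/
def IsStdDomain (E : Set (ℝ × ℝ)) : Prop :=
  (∃ r₀ > (0:ℝ), E = disk2 r₀) ∨
  (∃ r₀ > (0:ℝ), ∃ m : ℕ, ∃ Es : Fin m → Set (ℝ × ℝ), ∃ Cs : Fin m → Fin 2 → Set (ℝ × ℝ),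
    E = Set.iUnion Es ∧
    (Pairwise fun i j => Disjoint (Es i) (Es j)) ∧
    (∀ i, IsOpen (Es i) ∧ Es i ⊆ disk2 r₀ ∧ (0:ℝ×ℝ) ∈ closure (Es i) ∧
      frontier (Es i) ⊆ Cs i 0 ∪ Cs i 1 ∪ circle2 r₀) ∧
    (∀ i j, IsPuiseuxBdryCurve r₀ (Cs i j)) ∧
    (Pairwise fun (q q' : Fin m × Fin 2) =>
      Disjoint (Cs q.1 q.2 ∩ (closedDisk2 r₀ \ {0}))
               (Cs q'.1 q'.2 ∩ (closedDisk2 r₀ \ {0}))))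

/-- The standard form of the paper: the `fᵢ` are real analytic and not identically zero
near the origin, `g = χ_E ∏ |fᵢ|^(γᵢ)` is integrable near the origin, and `E` is an
admissible domain. -/
structure StandardForm (n : ℕ) (f : Fin n → ℝ × ℝ → ℝ) (γ : Fin n → ℝ)
    (E : Set (ℝ × ℝ)) : Prop where
  analytic : ∃ U ∈ 𝓝 (0 : ℝ × ℝ), ∀ i, AnalyticOnNhd ℝ (f i) U
  nontriv : ∀ i, ¬ (∀ᶠ p in 𝓝 (0 : ℝ × ℝ), f i p = 0)
  integ : ∃ U ∈ 𝓝 (0 : ℝ × ℝ), IntegrableOn (stdFun n f γ E) U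
  domain : IsStdDomain E

/-- The two-sided bound `c₁ rᵉ |log r|^d ≤ ∫_{x²+y²<r²} g ≤ c₂ rᵉ |log r|^d` for all small
`r` ("ball exponents" `ε`, `d` of `g`, as in Lemma 1.1). -/
def BallBound (g : ℝ × ℝ → ℝ) (ε : ℝ) (d : ℕ) : Prop :=
  0 < ε ∧ d ≤ 1 ∧ ∃ c₁ > (0:ℝ), ∃ c₂ > (0:ℝ), ∃ c₃ > (0:ℝ), ∀ r : ℝ, 0 < r → r < c₃ →
    c₁ * r ^ ε * |Real.log r| ^ d ≤ (∫ p in disk2 r, g p) ∧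
    (∫ p in disk2 r, g p) ≤ c₂ * r ^ ε * |Real.log r| ^ d

/-- The strip `{(x,y) : |(x,y)·v| < r, |(x,y)·v^⊥| < c}`. -/
def strip2 (v : ℝ × ℝ) (r c : ℝ) : Set (ℝ × ℝ) :=
  {p : ℝ × ℝ | |dot2 p v| < r ∧ |dot2 p (perp2 v)| < c}

/-- The two-sided bound `a r^δ |log r|^e ≤ ∫_{strip} g ≤ b r^δ |log r|^e` for all small `r`,
for every small `c` ("strip exponents" `δ_v`, `e_v` of `g` in the direction `v`, as in
Lemma 1.2). -/
def StripBound (g : ℝ × ℝ → ℝ) (v : ℝ × ℝ) (δ : ℝ) (e : ℕ) : Prop :=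
  0 < δ ∧ e ≤ 1 ∧ ∃ cv > (0:ℝ), ∀ c : ℝ, 0 < c → c < cv →
    ∃ a > (0:ℝ), ∃ b > (0:ℝ), ∀ r : ℝ, 0 < r → r < c →
      a * r ^ δ * |Real.log r| ^ e ≤ (∫ p in strip2 v r c, g p) ∧
      (∫ p in strip2 v r c, g p) ≤ b * r ^ δ * |Real.log r| ^ e

/-- The order of vanishing of `f` at the origin. -/
def vanishingOrder (f : ℝ × ℝ → ℝ) : ℕ :=
  sInf {k : ℕ | iteratedFDeriv ℝ k f 0 ≠ 0}

/-- (A constant multiple of) the sum of the terms of lowest total degree in the Taylor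
expansion of `f` at the origin, as a homogeneous function on `ℝ²`. -/
def lowestPart (f : ℝ × ℝ → ℝ) (p : ℝ × ℝ) : ℝ :=
  iteratedFDeriv ℝ (vanishingOrder f) f 0 (fun _ => p)

/-- `w` is a tangent direction of the set `C` at the origin. -/
def IsTangentDirAt (C : Set (ℝ × ℝ)) (w : ℝ × ℝ) : Prop :=
  ∃ p : ℕ → ℝ × ℝ, (∀ k, p k ∈ C ∧ p k ≠ 0) ∧
    Tendsto p atTop (𝓝 (0:ℝ×ℝ)) ∧
    (Tendsto (fun k => (nrm2 (p k))⁻¹ • p k) atTop (𝓝 w) ∨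
     Tendsto (fun k => (nrm2 (p k))⁻¹ • p k) atTop (𝓝 (-w)))

/-- `w` is the direction of one of the lines `l₁, …, l_p`: a line through the origin in the
zero set of the lowest-degree Taylor part of some `fᵢ`, or a tangent line at the origin to
one of the boundary curves of `E`. -/
def ExceptionalDir (n : ℕ) (f : Fin n → ℝ × ℝ → ℝ) (E : Set (ℝ × ℝ)) (w : ℝ × ℝ) : Prop :=
  (∃ i, lowestPart (f i) w = 0) ∨ IsTangentDirAt (frontier E) w

/-- Conditions (1.2)-(1.3) on the factor `α`: `C¹` away from the origin, bounded by `A`,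
with gradient bounded by `A (x²+y²)^{-1/2}`. -/
def AlphaBound (α : ℝ × ℝ → ℝ) (A : ℝ) : Prop :=
  ContDiffOn ℝ 1 α {(0:ℝ×ℝ)}ᶜ ∧ (∀ p, |α p| ≤ A) ∧
  ∀ p : ℝ × ℝ, p ≠ 0 → ‖fderiv ℝ α p‖ ≤ A * (nrm2 p)⁻¹

/-- A smooth bump function equal to `1` near `(x₀, y₀)`, supported within (Euclidean)
distance `r` of `(x₀, y₀)`. -/
def IsBump (φ : ℝ × ℝ → ℝ) (x₀ y₀ : ℝ) (r : ℝ) : Prop :=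
  ContDiff ℝ (⊤ : ℕ∞) φ ∧ HasCompactSupport φ ∧ (∀ᶠ p in 𝓝 ((x₀, y₀) : ℝ × ℝ), φ p = 1) ∧
    tsupport φ ⊆ {p : ℝ × ℝ | (p.1 - x₀) ^ 2 + (p.2 - y₀) ^ 2 < r ^ 2}

/-- The oscillatory integral `∫_S h(x,y) e^{i(tx+uy)} dx dy`. -/
def oscInt (h : ℝ × ℝ → ℝ) (S : Set (ℝ × ℝ)) (t u : ℝ) : ℂ :=
  ∫ p in S, (h p : ℂ) * Complex.exp (Complex.I * ((t : ℂ) * (p.1 : ℂ) + (u : ℂ) * (p.2 : ℂ)))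

/-- The convolution kernel `K(t,u) = ∫ m(x,y) e^{i(tx+uy)} dx dy`. -/
def Kfull (m : ℝ × ℝ → ℝ) (t u : ℝ) : ℂ :=
  oscInt m Set.univ t u

/-- The localized kernel `K_φ(t,u) = ∫ φ(x,y) m(x,y) e^{i(tx+uy)} dx dy`. -/
def Kphi (φ m : ℝ × ℝ → ℝ) (t u : ℝ) : ℂ :=
  oscInt (fun p => φ p * m p) Set.univ t u

/-- `k` is a Puiseux function of index `N` on `[0,a]`: `k(x) = k'(x^{1/N})` for a function
`k'` real analytic on an open set containing `[0, a^{1/N}]`; equivalently `x ↦ k(x^N)` is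
real analytic. -/
def PuiseuxOn (N : ℕ) (a : ℝ) (k : ℝ → ℝ) : Prop :=
  ∃ (k' : ℝ → ℝ) (I : Set ℝ), IsOpen I ∧ Icc (0:ℝ) (a ^ ((N:ℝ)⁻¹)) ⊆ I ∧
    AnalyticOnNhd ℝ k' I ∧ ∀ x ∈ Icc (0:ℝ) a, k x = k' (x ^ ((N:ℝ)⁻¹))

/-- `k(x) = l·x^s + higher order terms` as `x → 0⁺`. -/
def LeadingTerm (k : ℝ → ℝ) (l s : ℝ) : Prop :=
  Tendsto (fun x => k x / x ^ s) (𝓝[>] (0:ℝ)) (𝓝 l)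

/-- The mixed partial derivative `∂_x^l ∂_y^m F`. -/
def pderiv2 (l m : ℕ) (F : ℝ × ℝ → ℝ) (p : ℝ × ℝ) : ℝ :=
  iteratedDeriv l (fun x => iteratedDeriv m (fun y => F (x, y)) p.2) p.1

/-- The descending product `α(α−1)⋯(α−l+1)`. -/
def descProd (α : ℝ) (l : ℕ) : ℝ := ∏ j ∈ Finset.range l, (α - (j : ℝ))

/-- The sliver `{(x,y) : 0 < x < a, g(x) < y < G(x)}`. -/
def sliverSet (a : ℝ) (g G : ℝ → ℝ) : Set (ℝ × ℝ) :=
  {q : ℝ × ℝ | 0 < q.1 ∧ q.1 < a ∧ g q.1 < q.2 ∧ q.2 < G q.1}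

/-- A wedge of radius `r₀` at the origin: a region bounded by two lines through the origin
and the circle of radius `r₀`. -/
def IsWedge (r₀ : ℝ) (W : Set (ℝ × ℝ)) : Prop :=
  ∃ θ₁ θ₂ : ℝ, θ₁ < θ₂ ∧ θ₂ ≤ θ₁ + 2 * π ∧
    W = {p : ℝ × ℝ | ∃ ρ θ : ℝ, 0 < ρ ∧ ρ < r₀ ∧ θ₁ < θ ∧ θ < θ₂ ∧
      p = (ρ * Real.cos θ, ρ * Real.sin θ)}

lemma vdc_alg1 {K L X Y P1 P2 l1 D : ℝ} (hK : 1 ≤ K) (hL : 1 ≤ L) (hX : 0 ≤ X) (hY : 0 ≤ Y)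
    (hLXY : L ^ 2 = 1 + X + Y) (hD : 0 ≤ D)
    (h2 : |P2| ≤ K * L ^ 2) (h3 : |l1| ≤ K * L ^ 2)
    (h4 : X ≤ K * (|P1| + Y)) (h5 : Y ≤ K * D) :
    |P1| / (L^2 + P1^2) ≤ 1 / L ∧
    |(P2 * (L^2+P1^2) - P1 * (l1 + 2 * P1 * P2)) / (L^2+P1^2)^2| ≤ 4 * K * (L^2 / (L^2 + P1^2)) ∧
    L^2 / (L^2+P1^2) ≤ 4 * K^2 * (1 / L + D / (L^2+P1^2)) := by
  have hE : 0 < L^2 + P1^2 := by positivity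
  have hLp : 0 < L := by linarith
  have ha : |P1| / (L^2 + P1^2) ≤ 1 / L := by
    rw [div_le_div_iff₀ hE hLp]
    nlinarith [sq_nonneg (|P1| - L), sq_abs P1, abs_nonneg P1]
  refine ⟨ha, ?_, ?_⟩
  · rw [abs_div, abs_of_pos (by positivity : 0 < (L^2+P1^2)^2), ← mul_div_assoc,
      div_le_div_iff₀ (by positivity) hE]
    have e1 : |P2 * (L^2+P1^2) - P1 * (l1 + 2 * P1 * P2)| ≤
        |P2| * (L^2+P1^2) + |P1| * |l1| + 2 * P1^2 * |P2| := by
      calc _ ≤ |P2 * (L^2+P1^2)| + |P1 * (l1 + 2 * P1 * P2)| := abs_sub _ _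
        _ ≤ |P2| * (L^2+P1^2) + |P1| * (|l1| + 2 * |P1| * |P2|) := by
            rw [abs_mul, abs_mul, abs_of_pos hE]
            gcongr
            calc _ ≤ |l1| + |2 * P1 * P2| := abs_add_le _ _
              _ = _ := by rw [abs_mul, abs_mul]; norm_num
        _ = _ := by rw [← sq_abs P1]; ring
    have e2 : |P1| ≤ L^2 + P1^2 := by
      nlinarith [sq_nonneg (|P1| - 1), sq_abs P1, abs_nonneg P1]
    have e3 : P1^2 ≤ L^2+P1^2 := by nlinarith
    have e4 : |P2| * (L^2+P1^2) + |P1| * |l1| + 2 * P1^2 * |P2| ≤ 4 * K * L^2 * (L^2+P1^2) := by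
      have i1 : |P2| * (L^2+P1^2) ≤ K * L^2 * (L^2+P1^2) := by gcongr
      have i2 : |P1| * |l1| ≤ (L^2+P1^2) * (K * L^2) := by gcongr
      have i3 : 2 * P1^2 * |P2| ≤ 2 * (L^2+P1^2) * (K * L^2) := by gcongr
      linarith
    nlinarith
  · have : L^2 ≤ 1 + 2 * K^2 * |P1| + 2 * K^2 * D := by
      have k1 : K ≤ K^2 := by nlinarith
      have : K * |P1| ≤ K^2 * |P1| := by gcongr
      have : K * Y ≤ K * (K * D) := by gcongr
      have : K * D ≤ K^2 * D := by gcongr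
      nlinarith [abs_nonneg P1, sq_nonneg K]
    have h6 : 1 / (L^2 + P1^2) ≤ 1 / L := by
      apply one_div_le_one_div_of_le hLp; nlinarith
    calc L^2 / (L^2+P1^2) ≤ (1 + 2 * K^2 * |P1| + 2 * K^2 * D) / (L^2+P1^2) := by gcongr
      _ = 1 / (L^2 + P1^2) + 2 * K^2 * (|P1| / (L^2 + P1^2)) + 2 * K^2 * (D / (L^2 + P1^2)) := by ring
      _ ≤ 1 / L + 2 * K^2 * (1 / L) + 2 * K^2 * (D / (L^2 + P1^2)) := by gcongr
      _ ≤ _ := by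
        have : 0 ≤ 1 / L := by positivity
        have : 0 ≤ D / (L^2+P1^2) := by positivity
        have k1 : 1 ≤ K^2 := by nlinarith
        nlinarith

lemma vdc_alg2 {K L P1 P2 L1 D κ ν : ℝ} (hK : 1 ≤ K) (hL : 1 ≤ L) 
    (h3 : |L1| ≤ K * L) (hν : |ν| ≤ K) (hκ : κ = 1 ∨ κ = -1) (hP : P2 = ν * P1 + κ * D) :
    D / (L^2+P1^2) ≤ κ * ((P2 * L - P1 * L1) / (L^2+P1^2)) / L + 2 * K / L := by
  have hE : 0 < L^2 + P1^2 := by positivity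
  have hLp : 0 < L := by linarith
  have hk : κ * κ = 1 := by rcases hκ with h | h <;> simp [h]
  have e : D / (L^2+P1^2) = κ * ((P2 * L - P1 * L1) / (L^2+P1^2)) / L 
      - κ * (P1 * (ν * L - L1)) / (L^2+P1^2) / L := by
    field_simp
    rw [hP]; linear_combination (-D * L) * hk
  rw [e, sub_eq_add_neg, ← neg_div]
  gcongr
  have hka : |κ| = 1 := by rcases hκ with h | h <;> simp [h]
  refine (neg_le_abs _).trans ?_
  rw [abs_div, abs_mul, abs_mul, hka, abs_of_pos hE, div_le_iff₀ hE, one_mul]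
  have : |ν * L - L1| ≤ 2 * K * L := by
    calc _ ≤ |ν * L| + |L1| := abs_sub _ _
      _ ≤ K * L + K * L := by rw [abs_mul, abs_of_pos hLp]; gcongr
      _ = _ := by ring
  calc |P1| * |ν * L - L1| ≤ |P1| * (2 * K * L) := by gcongr
    _ ≤ _ := by
      have : |P1| * L ≤ L^2+P1^2 := by
        nlinarith [sq_nonneg (|P1| - L), sq_abs P1, abs_nonneg P1]
      nlinarith

set_option maxHeartbeats 2000000 in
lemma vdc_point {ν C1 c : ℝ} (hν : 0 < ν) (hC1 : 0 < C1) (hc : 0 < c) :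
    ∃ K1 > (0:ℝ), ∃ K2 > (0:ℝ), ∃ K4 > (0:ℝ), ∀ (θ t u κ m A : ℝ) (y y1 b α : ℝ → ℝ) (y2 b1 a1 : ℝ),
    HasDerivAt y (y1 θ) θ → HasDerivAt y1 y2 θ → HasDerivAt b b1 θ → HasDerivAt α a1 θ →
    0 < y θ → |y1 θ| ≤ C1 * y θ → |y2| ≤ C1 * y θ → c * y θ ≤ y2 - ν * y1 θ →
    0 < b θ → |b1| ≤ C1 * b θ → |α θ| ≤ A * m → |a1| ≤ A → 0 < m → m ≤ 1 →
    (κ = 1 ∨ κ = -1) → u = κ * |u| →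
    ∀ (Λ v P1 : ℝ → ℝ) (T : ℝ → ℂ),
    Λ = (fun θ => 1 + |t| * exp (ν * θ) + |u| * y θ) →
    v = (fun θ => b θ / √(Λ θ)) →
    P1 = (fun θ => ν * t * exp (ν * θ) + u * y1 θ) →
    T = (fun θ => -Complex.I * ((α θ * b θ * (P1 θ / (Λ θ + P1 θ ^ 2)) : ℝ) : ℂ) *
        Complex.exp (Complex.I * ((t * exp (ν * θ) + u * y θ : ℝ) : ℂ))) →
    ∃ T' : ℂ, ∃ v' W' : ℝ, HasDerivAt T T' θ ∧ HasDerivAt v v' θ ∧ 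
      HasDerivAt (fun θ => κ * (v θ * arctan (P1 θ / √(Λ θ)))) W' θ ∧
      |v'| ≤ K4 * v θ ∧ ‖T θ‖ ≤ A * m * v θ ∧
      ‖((α θ * b θ : ℝ) : ℂ) * Complex.exp (Complex.I * ((t * exp (ν * θ) + u * y θ : ℝ) : ℂ)) - T'‖ ≤
        K1 * A * v θ + K2 * A * m * W' := by
  have hi1 : 0 < 1/ν := by positivity
  have hi2 : 0 < C1/ν := by positivity
  have hi3 : 0 < 1/c := by positivity
  have hi4 : 0 < ν^2 := by positivity
  obtain ⟨K, hK1, k1, k2, k3, k4, k5, k6⟩ : ∃ K : ℝ, 1 ≤ K ∧ ν^2 ≤ K ∧ C1 ≤ K ∧ ν ≤ K ∧ 1/ν ≤ K ∧ C1/ν ≤ K ∧ 1/c ≤ K :=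
    ⟨1 + ν^2 + C1 + ν + 1/ν + C1/ν + 1/c, by linarith, by linarith, by linarith, by linarith, by linarith, by linarith, by linarith⟩
  refine ⟨(1+C1) + (1+4*K)*(4*K^2)*(1+2*K+2*(C1+K)), by positivity, (1+4*K)*(4*K^2), by positivity, C1+K, by positivity, ?_⟩
  intro θ t u κ m A y y1 b α y2 b1 a1 hy hy1 hb hα hy0 by1 by2 bc hb0 bb1 bα ba1 hm hm1 hκ hu Λ v P1 T hΛ hv hP1 hT
  have hA : 0 ≤ A := (abs_nonneg _).trans ba1
  have hx : HasDerivAt (fun θ => exp (ν * θ)) (ν * exp (ν * θ)) θ := by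
    have := ((hasDerivAt_id θ).const_mul ν).exp
    simpa [mul_comm] using this
  set x := exp (ν * θ) with hxdef
  have hx0 : 0 < x := exp_pos _
  have hΛd : HasDerivAt Λ (|t| * (ν * x) + |u| * y1 θ) θ := by
    rw [hΛ]
    exact ((hx.const_mul |t|).const_add 1).add (hy.const_mul |u|)
  have hΛθ : Λ θ = 1 + |t| * x + |u| * y θ := by rw [hΛ]
  have hΛ1 : 1 ≤ Λ θ := by rw [hΛθ]; have : 0 ≤ |t| * x + |u| * y θ := by positivity
                           linarith
  set l1 := |t| * (ν * x) + |u| * y1 θ with hl1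
  set L := √(Λ θ) with hLdef
  have hL1 : 1 ≤ L := by rw [hLdef]; exact Real.one_le_sqrt.mpr hΛ1
  have hL2 : L^2 = Λ θ := Real.sq_sqrt (by linarith)
  have hL0 : 0 < L := by linarith
  have hLd : HasDerivAt (fun θ => √(Λ θ)) (l1 / (2 * L)) θ := hΛd.sqrt (by linarith)
  have hP1d : HasDerivAt P1 (ν * t * (ν * x) + u * y2) θ := by
    rw [hP1]
    exact (hx.const_mul (ν*t)).add (hy1.const_mul u)
  set P2 := ν * t * (ν * x) + u * y2 with hP2
  set D := |u| * (y2 - ν * y1 θ) with hD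
  have hD0 : 0 ≤ D := mul_nonneg (abs_nonneg _) (by have : 0 < c * y θ := by positivity
                                                    linarith)
  have hP1θ : P1 θ = ν * t * x + u * y1 θ := by rw [hP1]
  have hP2eq : P2 = ν * P1 θ + κ * D := by
    rw [hP2, hP1θ, hD]; rw [show κ * (|u| * (y2 - ν * y1 θ)) = (κ * |u|) * (y2 - ν * y1 θ) by ring, ← hu]; ring
  have hX0 : 0 ≤ |t| * x := by positivity
  have hY0 : 0 ≤ |u| * y θ := by positivity
  have q2 : |P2| ≤ K * L^2 := by
    rw [hL2, hΛθ]
    calc |P2| ≤ |ν * t * (ν * x)| + |u * y2| := abs_add_le _ _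
      _ = ν^2 * (|t| * x) + |u| * |y2| := by
          rw [abs_mul, abs_mul, abs_mul, abs_mul, abs_of_pos hν, abs_of_pos hx0]; ring
      _ ≤ ν^2 * (|t| * x) + |u| * (C1 * y θ) := by gcongr
      _ ≤ K * (|t| * x) + K * (|u| * y θ) := by
          have : |u| * (C1 * y θ) = C1 * (|u| * y θ) := by ring
          rw [this]
          gcongr
      _ ≤ _ := by linarith
  have q3 : |l1| ≤ K * L^2 := by
    rw [hL2, hΛθ]
    calc |l1| ≤ |(|t| * (ν * x))| + |(|u| * y1 θ)| := abs_add_le _ _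
      _ = ν * (|t| * x) + |u| * |y1 θ| := by
          rw [abs_mul, abs_mul, abs_mul, abs_of_pos hν, abs_of_pos hx0, abs_abs, abs_abs]; ring
      _ ≤ ν * (|t| * x) + |u| * (C1 * y θ) := by gcongr
      _ ≤ K * (|t| * x) + K * (|u| * y θ) := by
          have : |u| * (C1 * y θ) = C1 * (|u| * y θ) := by ring
          rw [this]
          gcongr
      _ ≤ _ := by linarith
  have q4 : |t| * x ≤ K * (|P1 θ| + |u| * y θ) := by
    have : ν * (|t| * x) ≤ |P1 θ| + C1 * (|u| * y θ) := by
      calc ν * (|t| * x) = |ν * t * x| := by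
            rw [abs_mul, abs_mul, abs_of_pos hν, abs_of_pos hx0]; ring
        _ = |P1 θ - u * y1 θ| := by rw [hP1θ]; congr 1; ring
        _ ≤ |P1 θ| + |u * y1 θ| := abs_sub _ _
        _ ≤ _ := by
          rw [abs_mul]
          have := mul_le_mul_of_nonneg_left by1 (abs_nonneg u)
          linarith
    have h' : |t| * x ≤ 1/ν * |P1 θ| + C1/ν * (|u| * y θ) := by
      have e : |t| * x = 1/ν * (ν * (|t| * x)) := by field_simp
      rw [e, show C1/ν * (|u| * y θ) = 1/ν * (C1 * (|u| * y θ)) by ring, ← mul_add]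
      gcongr
    calc _ ≤ _ := h'
      _ ≤ K * |P1 θ| + K * (|u| * y θ) := by
        gcongr
      _ = _ := by ring
  have q5 : |u| * y θ ≤ K * D := by
    have h' : c * (|u| * y θ) ≤ D := by
      rw [hD]
      have := mul_le_mul_of_nonneg_left bc (abs_nonneg u)
      linarith
    calc |u| * y θ = 1/c * (c * (|u| * y θ)) := by field_simp
      _ ≤ 1/c * D := by gcongr
      _ ≤ K * D := by gcongr
  have q6 : |l1 / (2*L)| ≤ K * L := by
    rw [abs_div, abs_of_pos (by positivity : 0 < 2*L), div_le_iff₀ (by positivity)]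
    have : 0 ≤ K * L^2 := by positivity
    linarith
  obtain ⟨r1, r2, r3⟩ := vdc_alg1 hK1 hL1 hX0 hY0 (by rw [hL2, hΛθ]) hD0 q2 q3 q4 q5
  have r4 := vdc_alg2 hK1 hL1 q6 (by rw [abs_of_pos hν]; linarith) hκ hP2eq
  have hE0 : 0 < L^2 + P1 θ^2 := by positivity
  have hEd : HasDerivAt (fun θ => Λ θ + P1 θ^2) (l1 + 2 * P1 θ * P2) θ := by
    have := hΛd.add (hP1d.pow 2)
    refine this.congr_deriv ?_
    simp only [Nat.cast_ofNat, Nat.add_one_sub_one, pow_one]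
  have hgd : HasDerivAt (fun θ => P1 θ / (Λ θ + P1 θ^2))
      ((P2 * (L^2+P1 θ^2) - P1 θ * (l1 + 2 * P1 θ * P2)) / (L^2+P1 θ^2)^2) θ := by
    have := hP1d.div hEd (by rw [← hL2]; exact hE0.ne')
    rw [hL2]; exact this
  set g1 := (P2 * (L^2+P1 θ^2) - P1 θ * (l1 + 2 * P1 θ * P2)) / (L^2+P1 θ^2)^2 with hg1
  set g := P1 θ / (L^2 + P1 θ^2) with hg
  have hgθ : P1 θ / (Λ θ + P1 θ^2) = g := by rw [hg, hL2]
  have hgabs : |g| ≤ 1 / L := by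
    rw [hg, abs_div, abs_of_pos hE0]; exact r1
  have hvθ : v θ = b θ / L := by rw [hv]
  have hv0 : 0 < v θ := by rw [hvθ]; positivity
  have hvd : HasDerivAt v ((b1 * L - b θ * (l1/(2*L))) / L^2) θ := by
    rw [hv]; exact hb.div hLd hL0.ne'
  set v1 := (b1 * L - b θ * (l1/(2*L))) / L^2 with hv1
  have hv1b : |v1| ≤ (C1 + K) * v θ := by
    rw [hv1, hvθ, abs_div, abs_of_pos (by positivity : 0 < L^2), div_le_iff₀ (by positivity)]
    have : (C1 + K) * (b θ / L) * L^2 = (C1 * b θ) * L + b θ * (K * L) := by field_simp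
    rw [this]
    calc _ ≤ |b1 * L| + |b θ * (l1/(2*L))| := abs_sub _ _
      _ ≤ _ := by
        rw [abs_mul b1, abs_mul (b θ), abs_of_pos hL0, abs_of_pos hb0]
        gcongr
  have hQd : HasDerivAt (fun θ => arctan (P1 θ / √(Λ θ))) ((P2 * L - P1 θ * (l1/(2*L))) / (L^2+P1 θ^2)) θ := by
    have := (hP1d.div hLd hL0.ne').arctan
    refine this.congr_deriv ?_
    show 1 / (1 + (P1 θ / L)^2) * ((P2 * L - P1 θ * (l1/(2*L))) / L^2) = _
    have : 1 + (P1 θ / L)^2 = (L^2 + P1 θ^2)/L^2 := by field_simp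
    rw [this]
    field_simp
  set Q1 := (P2 * L - P1 θ * (l1/(2*L))) / (L^2+P1 θ^2) with hQ1
  set Q := arctan (P1 θ / √(Λ θ)) with hQ
  have hQb : |Q| ≤ 2 := by
    rw [abs_le]
    have h1 := Real.arctan_lt_pi_div_two (P1 θ / √(Λ θ))
    have h2 := Real.neg_pi_div_two_lt_arctan (P1 θ / √(Λ θ))
    have := Real.pi_lt_four
    constructor <;> rw [hQ] <;> linarith
  have hWd := (hvd.mul hQd).const_mul κ
  -- T
  have hφd : HasDerivAt (fun θ => Complex.exp (Complex.I * ((t * exp (ν * θ) + u * y θ : ℝ) : ℂ)))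
      (Complex.exp (Complex.I * ((t * x + u * y θ : ℝ) : ℂ)) * (Complex.I * ((P1 θ : ℝ):ℂ))) θ := by
    have h1 : HasDerivAt (fun θ => t * exp (ν * θ) + u * y θ) (P1 θ) θ := by
      rw [hP1θ, mul_comm ν t, mul_assoc]
      exact (hx.const_mul t).add (hy.const_mul u)
    exact (h1.ofReal_comp.const_mul Complex.I).cexp
  set e := Complex.exp (Complex.I * ((t * x + u * y θ : ℝ) : ℂ)) with he
  have hen : ‖e‖ = 1 := by rw [he, mul_comm]; exact Complex.norm_exp_ofReal_mul_I _
  have hrd := (hα.mul hb).mul hgd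
  have hTd := ((hrd.ofReal_comp).const_mul (-Complex.I)).mul hφd
  refine ⟨_, v1, _, by rw [hT]; exact hTd, hvd, hWd, hv1b, ?_, ?_⟩
  · rw [hT]
    simp only [norm_mul, norm_neg, Complex.norm_I, one_mul, Complex.norm_real]
    rw [← hxdef, ← he, hen, mul_one, hgθ, norm_eq_abs, norm_eq_abs, norm_eq_abs, abs_of_pos hb0, hvθ]
    calc |α θ| * b θ * |g| ≤ A * m * b θ * (1/L) := by gcongr
      _ = _ := by ring
  · simp only [Pi.mul_apply]
    rw [← hxdef, ← he]
    simp only [hgθ]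
    set r1' := ((a1 * b θ + α θ * b1) * g + α θ * b θ * g1) with hr1'
    have key : ((α θ * b θ : ℝ) : ℂ) * e - (-Complex.I * (r1' : ℂ) * e + -Complex.I * ((α θ * b θ * g : ℝ):ℂ) * (e * (Complex.I * (P1 θ : ℂ))))
        = (((α θ * b θ * (1 - g * P1 θ) : ℝ):ℂ) + Complex.I * (r1' : ℂ)) * e := by
      push_cast
      linear_combination ((α θ:ℂ) * b θ * g * P1 θ * e) * Complex.I_mul_I
    rw [key, norm_mul, hen, mul_one]
    have n1 : ‖((α θ * b θ * (1 - g * P1 θ) : ℝ):ℂ) + Complex.I * (r1' : ℂ)‖ ≤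
        |α θ * b θ * (1 - g * P1 θ)| + |r1'| := by
      refine (norm_add_le _ _).trans ?_
      rw [norm_mul, Complex.norm_I, one_mul, Complex.norm_real, Complex.norm_real, norm_eq_abs, norm_eq_abs]
    refine n1.trans ?_
    set Z := L^2 / (L^2+P1 θ^2) with hZ
    have hZ0 : 0 ≤ Z := by positivity
    have n2 : |α θ * b θ * (1 - g * P1 θ)| ≤ A * m * b θ * Z := by
      have : 1 - g * P1 θ = Z := by rw [hg, hZ]; field_simp; ring
      rw [this, abs_mul, abs_mul, abs_of_pos hb0, abs_of_nonneg hZ0]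
      gcongr
    have n3 : |r1'| ≤ (A * b θ + A * m * (C1 * b θ)) * (1/L) + A * m * b θ * (4 * K * Z) := by
      rw [hr1']
      calc _ ≤ |(a1 * b θ + α θ * b1) * g| + |α θ * b θ * g1| := abs_add_le _ _
        _ ≤ (|a1| * b θ + |α θ| * |b1|) * |g| + |α θ| * b θ * |g1| := by
            rw [abs_mul, abs_mul, abs_mul, abs_of_pos hb0]
            gcongr
            refine (abs_add_le _ _).trans_eq ?_
            rw [abs_mul, abs_mul, abs_of_pos hb0]
        _ ≤ _ := by gcongr
    have n4 : b θ * Z ≤ 4*K^2*((1 + 2*K + 2*(C1+K)) * v θ + κ * (v1 * Q + v θ * Q1)) := by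
      have hbl : b θ * (1/L) = v θ := by rw [hvθ]; ring
      have s1 : b θ * (D / (L^2+P1 θ^2)) ≤ κ * (v θ * Q1) + 2*K*v θ := by
        calc _ ≤ b θ * (κ * Q1 / L + 2*K/L) := by gcongr
          _ = κ * ((b θ * (1/L)) * Q1) + 2*K*(b θ * (1/L)) := by ring
          _ = _ := by rw [hbl]
      have s2 : - (κ * (v1 * Q)) ≤ 2*(C1+K) * v θ := by
        have : |κ * (v1*Q)| ≤ (C1+K) * v θ * 2 := by
          have hk : |κ| = 1 := by rcases hκ with h|h <;> simp [h]
          rw [abs_mul, abs_mul, hk, one_mul]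
          gcongr
        have := neg_le_abs (κ * (v1*Q))
        linarith
      calc b θ * Z ≤ b θ * (4*K^2*(1/L + D/(L^2+P1 θ^2))) := by gcongr
        _ = 4*K^2*(b θ * (1/L) + b θ * (D/(L^2+P1 θ^2))) := by ring
        _ ≤ 4*K^2*(v θ + (κ * (v θ * Q1) + 2*K*v θ)) := by rw [hbl]; gcongr
        _ ≤ _ := mul_le_mul_of_nonneg_left (by linarith) (by positivity)
    have hbl : b θ * (1/L) = v θ := by rw [hvθ]; ring
    refine (add_le_add n2 n3).trans ?_
    have hAm' : A * m ≤ A := mul_le_of_le_one_right hA hm1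
    have z0 : 0 ≤ (1+4*K)*(4*K^2)*(1+2*K+2*(C1+K)) := by positivity
    change _ ≤ _ + _ * (κ * (v1 * Q + v θ * Q1))
    generalize κ * (v1 * Q + v θ * Q1) = W at n4 ⊢
    have hAm : 0 ≤ A * m * (1 + 4*K) := by positivity
    have n5 := mul_le_mul_of_nonneg_left n4 hAm
    have n6 : A * m * C1 * v θ ≤ A * C1 * v θ := by gcongr
    have n7 := mul_le_mul_of_nonneg_right (mul_le_mul_of_nonneg_right hAm' z0) hv0.le
    have n8 : A * m * b θ * Z + ((A * b θ + A * m * (C1 * b θ)) * (1/L) + A * m * b θ * (4 * K * Z)) =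
      A * v θ + A * m * C1 * v θ + A * m * (1 + 4*K) * (b θ * Z) := by rw [← hbl]; ring
    rw [n8]
    linarith

structure VH (ν C1 c A m : ℝ) (y y1 y2 b b1 α a1 : ℝ → ℝ) (θ : ℝ) : Prop where
  dy : HasDerivAt y (y1 θ) θ
  dy1 : HasDerivAt y1 (y2 θ) θ
  db : HasDerivAt b (b1 θ) θ
  da : HasDerivAt α (a1 θ) θ
  y0 : 0 < y θ
  by1 : |y1 θ| ≤ C1 * y θ
  by2 : |y2 θ| ≤ C1 * y θ
  bc : c * y θ ≤ y2 θ - ν * y1 θ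
  b0 : 0 < b θ
  bb : |b1 θ| ≤ C1 * b θ
  bα : |α θ| ≤ A * m
  ba : |a1 θ| ≤ A

def Vv (ν t u : ℝ) (y b : ℝ → ℝ) (θ : ℝ) : ℝ := b θ / √(1 + |t| * exp (ν * θ) + |u| * y θ)
def Ve (ν t u : ℝ) (y b α : ℝ → ℝ) (θ : ℝ) : ℂ :=
  ((α θ * b θ : ℝ) : ℂ) * Complex.exp (Complex.I * ((t * exp (ν * θ) + u * y θ : ℝ) : ℂ))

lemma bdry_le {p q m K : ℝ} {v : ℝ → ℝ} (hpq : p < q) (hm : 0 ≤ m) (hm2 : m ≤ 2 * (q - p)) (hm1 : m ≤ 1)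
    (hK : 0 ≤ K) (hc : ContinuousOn v (Icc p q))
    (hv : ∀ θ ∈ Icc p q, 0 < v θ ∧ ∃ v', HasDerivAt v v' θ ∧ |v'| ≤ K * v θ) :
    m * v q ≤ (2 + K) * ∫ θ in p..q, v θ ∧ m * v p ≤ (2 + K) * ∫ θ in p..q, v θ := by
  have hpq' : 0 < q - p := by linarith
  choose! v0 v' hvd hvb using hv
  have hint : IntegrableOn (fun θ => (2+K) * v θ) (Icc p q) :=
    (hc.integrableOn_Icc).const_mul _
  have hlin : ∀ θ ∈ Icc p q, ∀ s : ℝ, 0 ≤ s → s ≤ 1 → m / (q-p) * v θ + s * m * |v' θ| ≤ (2+K) * v θ := by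
    intro θ hθ s hs hs1
    have h1 : m / (q-p) ≤ 2 := by rw [div_le_iff₀ hpq']; exact hm2
    have h2 := mul_le_mul_of_nonneg_right h1 (v0 θ hθ).le
    have h3 : s * m * |v' θ| ≤ 1 * (K * v θ) :=
      mul_le_mul (mul_le_one₀ hs1 hm hm1) (hvb θ hθ) (abs_nonneg _) zero_le_one
    linarith
  rw [← intervalIntegral.integral_const_mul]
  constructor
  · have := intervalIntegral.sub_le_integral_of_hasDeriv_right_of_le (a := p) (b := q)
      (g := fun θ => (θ - p)/(q-p) * m * v θ) (g' := fun θ => m/(q-p) * v θ + (θ - p)/(q-p) * m * v' θ) hpq.le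
      (by fun_prop) (fun x hx => ?_) hint (fun x hx => ?_)
    · simpa [hpq'.ne'] using this
    · have h1 : HasDerivAt (fun θ => (θ - p)/(q-p) * m) (m/(q-p)) x :=
        ((((hasDerivAt_id x).sub_const p).div_const (q-p)).mul_const m).congr_deriv (by ring)
      exact (h1.mul (hvd x (Ioo_subset_Icc_self hx))).hasDerivWithinAt
    · have hx' := Ioo_subset_Icc_self hx
      have hs : 0 ≤ (x-p)/(q-p) := div_nonneg (by linarith [hx.1]) hpq'.le
      refine le_trans ?_ (hlin x hx' ((x-p)/(q-p)) hs ((div_le_one hpq').mpr (by linarith [hx.2])))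
      gcongr
      exact le_abs_self _
  · have := intervalIntegral.sub_le_integral_of_hasDeriv_right_of_le (a := p) (b := q)
      (g := fun θ => (θ - q)/(q-p) * m * v θ) (g' := fun θ => m/(q-p) * v θ + (θ - q)/(q-p) * m * v' θ) hpq.le
      (by fun_prop) (fun x hx => ?_) hint (fun x hx => ?_)
    · have e : (p - q) / (q-p) = -1 := by rw [div_eq_iff hpq'.ne']; ring
      simp only [e, sub_self, zero_div] at this
      linarith
    · have h1 : HasDerivAt (fun θ => (θ - q)/(q-p) * m) (m/(q-p)) x :=
        ((((hasDerivAt_id x).sub_const q).div_const (q-p)).mul_const m).congr_deriv (by ring)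
      exact (h1.mul (hvd x (Ioo_subset_Icc_self hx))).hasDerivWithinAt
    · have hx' := Ioo_subset_Icc_self hx
      have hs : 0 ≤ (q-x)/(q-p) := div_nonneg (by linarith [hx.2]) hpq'.le
      refine le_trans ?_ (hlin x hx' ((q-x)/(q-p)) hs ((div_le_one hpq').mpr (by linarith [hx.1])))
      have e : (x - q)/(q-p) * m * v' x = (q-x)/(q-p) * m * (- v' x) := by ring
      rw [e]
      gcongr
      exact neg_le_abs _

lemma osc_Icc {ν C1 c : ℝ} (hν : 0 < ν) (hC1 : 0 < C1) (hc : 0 < c) :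
    ∃ K > (0:ℝ), ∀ (t u m A p q p' q' : ℝ) (y y1 y2 b b1 α a1 : ℝ → ℝ),
    p' < p → p < q → q < q' → 0 < m → m ≤ 1 → m ≤ 2 * (q - p) →
    (∀ θ ∈ Ioo p' q', VH ν C1 c A m y y1 y2 b b1 α a1 θ) →
    ‖∫ θ in p..q, Ve ν t u y b α θ‖ ≤ K * A * ∫ θ in p..q, Vv ν t u y b θ := by
  obtain ⟨K1, hK1, K2, hK2, K4, hK4, hpt⟩ := vdc_point hν hC1 hc
  refine ⟨K1 + (2 + 4 * K2) * (2 + K4), by positivity, ?_⟩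
  intro t u m A p q p' q' y y1 y2 b b1 α a1 hp hpq hq hm hm1 hm2 H
  obtain ⟨κ, hκ, hu⟩ : ∃ κ : ℝ, (κ = 1 ∨ κ = -1) ∧ u = κ * |u| := by
    rcases le_total 0 u with h | h
    · exact ⟨1, Or.inl rfl, by rw [abs_of_nonneg h]; ring⟩
    · exact ⟨-1, Or.inr rfl, by rw [abs_of_nonpos h]; ring⟩
  have hsub : Icc p q ⊆ Ioo p' q' := fun x hx => ⟨hp.trans_le hx.1, hx.2.trans_lt hq⟩
  have hpS : p ∈ Ioo p' q' := hsub ⟨le_rfl, hpq.le⟩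
  have hA : 0 ≤ A := (abs_nonneg _).trans (H p hpS).ba
  let P1 : ℝ → ℝ := fun θ => ν * t * exp (ν * θ) + u * y1 θ
  let Λ : ℝ → ℝ := fun θ => 1 + |t| * exp (ν * θ) + |u| * y θ
  let v := Vv ν t u y b
  let T : ℝ → ℂ := (fun θ => -Complex.I * ((α θ * b θ * (P1 θ / (Λ θ + P1 θ ^ 2)) : ℝ) : ℂ) *
        Complex.exp (Complex.I * ((t * exp (ν * θ) + u * y θ : ℝ) : ℂ)))
  let W : ℝ → ℝ := fun θ => κ * (v θ * arctan (P1 θ / √(Λ θ)))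
  have key : ∀ θ ∈ Ioo p' q', ∃ T' : ℂ, ∃ v' W' : ℝ, HasDerivAt T T' θ ∧ HasDerivAt v v' θ ∧ 
      HasDerivAt W W' θ ∧ |v'| ≤ K4 * v θ ∧ ‖T θ‖ ≤ A * m * v θ ∧
      ‖Ve ν t u y b α θ - T'‖ ≤ K1 * A * v θ + K2 * A * m * W' := by
    intro θ hθ
    have h := H θ hθ
    exact hpt θ t u κ m A y y1 b α (y2 θ) (b1 θ) (a1 θ) h.dy h.dy1 h.db h.da h.y0 h.by1 h.by2 h.bc h.b0 h.bb
      h.bα h.ba hm hm1 hκ hu Λ v P1 T rfl rfl rfl rfl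
  choose! T' v' W' hT hv hW hv' hTb hmain using key
  have hv0 : ∀ θ ∈ Ioo p' q', 0 < v θ := by
    intro θ hθ
    have h := H θ hθ
    have := h.y0
    have : 0 < 1 + |t| * exp (ν * θ) + |u| * y θ := by positivity
    exact div_pos h.b0 (Real.sqrt_pos.mpr this)
  have hvc : ContinuousOn v (Ioo p' q') := fun θ hθ => (hv θ hθ).continuousAt.continuousWithinAt
  have hec : ContinuousOn (Ve ν t u y b α) (Ioo p' q') := by
    intro θ hθ
    have h := H θ hθ
    have c1 := h.dy.continuousAt
    have c2 := h.db.continuousAt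
    have c3 := h.da.continuousAt
    apply ContinuousAt.continuousWithinAt
    unfold Ve
    fun_prop
  have hIv : ∀ a ∈ Icc p q, IntervalIntegrable v volume p a := fun a ha =>
    ((hvc.mono hsub).mono (by rw [uIcc_of_le ha.1]; exact Icc_subset_Icc_right ha.2)).intervalIntegrable
  have hIe : ∀ a ∈ Icc p q, IntervalIntegrable (Ve ν t u y b α) volume p a := fun a ha =>
    ((hec.mono hsub).mono (by rw [uIcc_of_le ha.1]; exact Icc_subset_Icc_right ha.2)).intervalIntegrable
  have dIv : ∀ a ∈ Icc p q, HasDerivAt (fun a => ∫ θ in p..a, v θ) (v a) a := fun a ha =>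
    intervalIntegral.integral_hasDerivAt_right (hIv a ha)
      (hvc.stronglyMeasurableAtFilter isOpen_Ioo a (hsub ha)) (hv a (hsub ha)).continuousAt
  have dIe : ∀ a ∈ Icc p q, HasDerivAt (fun a => ∫ θ in p..a, Ve ν t u y b α θ) (Ve ν t u y b α a) a := fun a ha =>
    intervalIntegral.integral_hasDerivAt_right (hIe a ha)
      (hec.stronglyMeasurableAtFilter isOpen_Ioo a (hsub ha)) (hec.continuousAt (isOpen_Ioo.mem_nhds (hsub ha)))
  have dF : ∀ a ∈ Icc p q, HasDerivAt (fun a => (∫ θ in p..a, Ve ν t u y b α θ) - (T a - T p)) (Ve ν t u y b α a - T' a) a :=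
    fun a ha => (dIe a ha).sub ((hT a (hsub ha)).sub_const (T p))
  have dB : ∀ a ∈ Icc p q, HasDerivAt (fun a => K1 * A * (∫ θ in p..a, v θ) + K2 * A * m * (W a - W p)) (K1 * A * v a + K2 * A * m * W' a) a :=
    fun a ha => ((dIv a ha).const_mul _).add (((hW a (hsub ha)).sub_const (W p)).const_mul _)
  have main := image_norm_le_of_norm_deriv_right_le_deriv_boundary' (a := p) (b := q)
    (f := fun a => (∫ θ in p..a, Ve ν t u y b α θ) - (T a - T p)) (f' := fun a => Ve ν t u y b α a - T' a)
    (B := fun a => K1 * A * (∫ θ in p..a, v θ) + K2 * A * m * (W a - W p)) (B' := fun a => K1 * A * v a + K2 * A * m * W' a)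
    (fun a ha => (dF a ha).continuousAt.continuousWithinAt)
    (fun a ha => (dF a (Ico_subset_Icc_self ha)).hasDerivWithinAt)
    (by simp)
    (fun a ha => (dB a ha).continuousAt.continuousWithinAt)
    (fun a ha => (dB a (Ico_subset_Icc_self ha)).hasDerivWithinAt)
    (fun a ha => hmain a (hsub (Ico_subset_Icc_self ha))) (right_mem_Icc.mpr hpq.le)
  obtain ⟨b1', b2'⟩ := bdry_le hpq hm.le hm2 hm1 hK4.le (hvc.mono hsub)
    (fun θ hθ => ⟨hv0 θ (hsub hθ), v' θ, hv θ (hsub hθ), hv' θ (hsub hθ)⟩)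
  have hqS : q ∈ Ioo p' q' := hsub ⟨hpq.le, le_rfl⟩
  have hWb : ∀ θ ∈ Ioo p' q', |W θ| ≤ 2 * v θ := by
    intro θ hθ
    have h1 := Real.arctan_lt_pi_div_two (P1 θ / √(Λ θ))
    have h2 := Real.neg_pi_div_two_lt_arctan (P1 θ / √(Λ θ))
    have := Real.pi_lt_four
    have h3 : |arctan (P1 θ / √(Λ θ))| ≤ 2 := abs_le.mpr ⟨by linarith, by linarith⟩
    have hk : |κ| = 1 := by rcases hκ with h|h <;> simp [h]
    have h4 := mul_le_mul_of_nonneg_left h3 (hv0 θ hθ).le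
    show |κ * (v θ * arctan (P1 θ / √(Λ θ)))| ≤ _
    rw [abs_mul, abs_mul, hk, abs_of_pos (hv0 θ hθ)]
    linarith
  set J := ∫ θ in p..q, v θ
  have hn : ‖∫ θ in p..q, Ve ν t u y b α θ‖ ≤ K1 * A * J + K2 * A * m * (W q - W p) + (‖T q‖ + ‖T p‖) := by
    have h1 := norm_add_le ((∫ θ in p..q, Ve ν t u y b α θ) - (T q - T p)) (T q - T p)
    rw [sub_add_cancel] at h1
    have h2 := norm_sub_le (T q) (T p)
    have h3 : ‖(∫ θ in p..q, Ve ν t u y b α θ) - (T q - T p)‖ ≤ K1 * A * J + K2 * A * m * (W q - W p) := main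
    linarith
  have hW1 := abs_le.mp (hWb q hqS)
  have hW2 := abs_le.mp (hWb p hpS)
  have hW3 : W q - W p ≤ 2 * (v q + v p) := by linarith
  have hAm : 0 ≤ K2 * A * m := by positivity
  have h5 := mul_le_mul_of_nonneg_left hW3 hAm
  have h6 := hTb q hqS
  have h7 := hTb p hpS
  have h8 : 0 ≤ A * (1 + 2 * K2) := by positivity
  have h9 := mul_le_mul_of_nonneg_left (add_le_add b1' b2') h8
  show _ ≤ (K1 + (2 + 4 * K2) * (2 + K4)) * A * J
  change A * (1 + 2 * K2) * (m * v q + m * v p) ≤ A * (1 + 2 * K2) * ((2+K4) * J + (2 + K4) * J) at h9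
  linarith

lemma Vv_norm_le {ν t u : ℝ} {y b : ℝ → ℝ} {θ : ℝ} (hy : 0 < y θ) (hb : 0 < b θ) :
    ‖Vv ν t u y b θ‖ ≤ ‖b θ‖ := by
  have : 1 ≤ 1 + |t| * exp (ν * θ) + |u| * y θ := by
    have : 0 ≤ |t| * exp (ν * θ) + |u| * y θ := by positivity
    linarith
  have h1 : 1 ≤ √(1 + |t| * exp (ν * θ) + |u| * y θ) := Real.one_le_sqrt.mpr this
  unfold Vv
  rw [norm_div, norm_eq_abs (√_), abs_of_pos (by linarith)]
  exact div_le_self (norm_nonneg _) h1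

lemma osc_gen {ν C1 c K A m t u : ℝ} {y y1 y2 b b1 α a1 : ℝ → ℝ} {S : Set ℝ} (hS : IsOpen S)
    (hH : ∀ θ ∈ S, VH ν C1 c A m y y1 y2 b b1 α a1 θ) (hb : IntegrableOn b S)
    (hK : ∀ p q p' q' : ℝ, p' < p → p < q → q < q' → m ≤ 2 * (q - p) →
      (∀ θ ∈ Ioo p' q', VH ν C1 c A m y y1 y2 b b1 α a1 θ) →
      ‖∫ θ in p..q, Ve ν t u y b α θ‖ ≤ K * A * ∫ θ in p..q, Vv ν t u y b θ)
    (p q p' q' : ℕ → ℝ) (h1 : ∀ n, p' n < p n) (h2 : ∀ n, p n < q n) (h3 : ∀ n, q n < q' n)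
    (h4 : ∀ n, Ioo (p' n) (q' n) ⊆ S) (h5 : ∀ n, m ≤ 2 * (q n - p n))
    (h6 : ∀ x ∈ S, ∀ᶠ n in atTop, x ∈ Ioc (p n) (q n)) :
    ‖∫ θ in S, Ve ν t u y b α θ‖ ≤ K * A * ∫ θ in S, Vv ν t u y b θ := by
  have hcov : AECover (volume.restrict S) atTop (fun n => Ioc (p n) (q n)) :=
    ⟨(ae_restrict_iff' hS.measurableSet).mpr (Eventually.of_forall h6), fun n => measurableSet_Ioc⟩
  have hsub : ∀ n, Ioc (p n) (q n) ⊆ S := fun n x hx => h4 n ⟨(h1 n).trans hx.1, hx.2.trans_lt (h3 n)⟩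
  have hcv : ContinuousOn (Vv ν t u y b) S := by
    intro θ hθ
    have h := hH θ hθ
    have c1 := h.dy.continuousAt
    have c2 := h.db.continuousAt
    apply ContinuousAt.continuousWithinAt
    have := h.y0
    have : 0 < 1 + |t| * exp (ν * θ) + |u| * y θ := by positivity
    have hne : √(1 + |t| * exp (ν * θ) + |u| * y θ) ≠ 0 := (Real.sqrt_pos.mpr this).ne'
    unfold Vv
    exact c2.div (by fun_prop) hne
  have hec : ContinuousOn (Ve ν t u y b α) S := by
    intro θ hθ
    have h := hH θ hθ
    have c1 := h.dy.continuousAt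
    have c2 := h.db.continuousAt
    have c3 := h.da.continuousAt
    apply ContinuousAt.continuousWithinAt
    unfold Ve
    fun_prop
  have iv : IntegrableOn (Vv ν t u y b) S := by
    refine Integrable.mono hb (hcv.aestronglyMeasurable hS.measurableSet) ?_
    exact (ae_restrict_iff' hS.measurableSet).mpr (Eventually.of_forall fun θ hθ => Vv_norm_le (hH θ hθ).y0 (hH θ hθ).b0)
  have ie : IntegrableOn (Ve ν t u y b α) S := by
    refine Integrable.mono (hb.const_mul (A * m)) (hec.aestronglyMeasurable hS.measurableSet) ?_
    refine (ae_restrict_iff' hS.measurableSet).mpr (Eventually.of_forall fun θ hθ => ?_)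
    have h := hH θ hθ
    have he : ‖Ve ν t u y b α θ‖ = |α θ| * b θ := by
      unfold Ve
      rw [norm_mul, mul_comm Complex.I, Complex.norm_exp_ofReal_mul_I, mul_one, Complex.norm_real, norm_eq_abs, abs_mul,
        abs_of_pos h.b0]
    rw [he, norm_eq_abs]
    exact (mul_le_mul_of_nonneg_right h.bα h.b0.le).trans (le_abs_self _)
  have t1 := hcov.integral_tendsto_of_countably_generated ie
  have t2 := hcov.integral_tendsto_of_countably_generated iv
  refine le_of_tendsto_of_tendsto' t1.norm (t2.const_mul (K * A)) fun n => ?_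
  rw [Measure.restrict_restrict_of_subset (hsub n), ← intervalIntegral.integral_of_le (h2 n).le,
    ← intervalIntegral.integral_of_le (h2 n).le]
  exact hK _ _ _ _ (h1 n) (h2 n) (h3 n) (h5 n) fun θ hθ => hH θ (h4 n hθ)

lemma osc_1D {ν C1 c : ℝ} (hν : 0 < ν) (hC1 : 0 < C1) (hc : 0 < c) :
    ∃ K > (0:ℝ), ∀ (t u m A : ℝ) (S : Set ℝ) (y y1 y2 b b1 α a1 : ℝ → ℝ), 
    (0 < m ∧ m ≤ 1) → ((∃ q, S = Iio q) ∨ ∃ p q, p < q ∧ S = Ioo p q ∧ m ≤ q - p) →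
    (∀ θ ∈ S, VH ν C1 c A m y y1 y2 b b1 α a1 θ) → IntegrableOn b S →
    ‖∫ θ in S, Ve ν t u y b α θ‖ ≤ K * A * ∫ θ in S, Vv ν t u y b θ := by
  obtain ⟨K, hK, hmain⟩ := osc_Icc hν hC1 hc
  refine ⟨K, hK, ?_⟩
  rintro t u m A S y y1 y2 b b1 α a1 ⟨hm, hm1⟩ hS hH hb
  have tz : Tendsto (fun n : ℕ => (1:ℝ) / (n + 1)) atTop (𝓝 0) := tendsto_one_div_add_atTop_nhds_zero_nat
  have hK' : ∀ p q p' q' : ℝ, p' < p → p < q → q < q' → m ≤ 2 * (q - p) →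
      (∀ θ ∈ Ioo p' q', VH ν C1 c A m y y1 y2 b b1 α a1 θ) →
      ‖∫ θ in p..q, Ve ν t u y b α θ‖ ≤ K * A * ∫ θ in p..q, Vv ν t u y b θ := 
    fun p q p' q' h1 h2 h3 h4 h5 => hmain t u m A p q p' q' y y1 y2 b b1 α a1 h1 h2 h3 hm hm1 h4 h5
  have hn : ∀ n : ℕ, 0 < (1:ℝ) / (n + 1) ∧ (1:ℝ)/(n+1) ≤ 1 := fun n =>
    ⟨by positivity, by rw [div_le_one (by positivity)]; linarith [(Nat.cast_nonneg n : (0:ℝ) ≤ n)]⟩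
  rcases hS with ⟨q, rfl⟩ | ⟨p, q, hpq, rfl, hmpq⟩
  · refine osc_gen isOpen_Iio hH hb hK' (fun n => q - 2 - n) (fun n => q - 1/(n+1)) (fun n => q - 3 - n) (fun _ => q) 
      (fun n => by linarith) (fun n => ?_) (fun n => ?_) (fun n => Ioo_subset_Iio_self) (fun n => ?_) ?_
    · have := hn n; have : (0:ℝ) ≤ n := Nat.cast_nonneg n; linarith
    · have := hn n; linarith
    · have := hn n; have : (0:ℝ) ≤ n := Nat.cast_nonneg n; linarith
    · intro x hx
      have e1 := (tz.eventually (gt_mem_nhds (show (0:ℝ) < q - x by linarith [mem_Iio.mp hx])))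
      have e2 := (tendsto_natCast_atTop_atTop (R := ℝ)).eventually_gt_atTop (q - 2 - x)
      filter_upwards [e1, e2] with n h1 h2
      exact ⟨by linarith, by linarith⟩
  · have hd : 0 < q - p := by linarith
    have hn' : ∀ n : ℕ, 0 < (q - p)/4 * (1 / ((n:ℝ)+1)) ∧ (q - p)/4 * (1 / ((n:ℝ)+1)) ≤ (q-p)/4 := fun n =>
      ⟨mul_pos (by linarith) (hn n).1, mul_le_of_le_one_right (by linarith) (hn n).2⟩
    refine osc_gen isOpen_Ioo hH hb hK' (fun n => p + (q - p)/4 * (1 / (n+1))) (fun n => q - (q - p)/4 * (1 / (n+1)))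
      (fun _ => p) (fun _ => q) (fun n => ?_) (fun n => ?_) (fun n => ?_) (fun n => Subset.rfl) (fun n => ?_) ?_
    · have := hn' n; linarith
    · have := hn' n; linarith
    · have := hn' n; linarith
    · have := hn' n; linarith
    · intro x hx
      have t0 : Tendsto (fun n : ℕ => (q-p)/4 * ((1:ℝ) / (n + 1))) atTop (𝓝 0) := by simpa using tz.const_mul ((q-p)/4)
      have e1 := (t0.eventually (gt_mem_nhds (show (0:ℝ) < q - x by linarith [hx.2])))
      have e2 := (t0.eventually (gt_mem_nhds (show (0:ℝ) < x - p by linarith [hx.1])))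
      filter_upwards [e1, e2] with n h1 h2
      exact ⟨by linarith, by linarith⟩

/-- The leaf map. -/
def Psi (N : ℕ) (H : ℝ → ℝ) (e τ : ℝ) (q : ℝ × ℝ) : ℝ × ℝ :=
  (exp (N * q.1), H q.1 + τ * exp (e * q.1) * q.2)

lemma Psi_inj {N : ℕ} (hN : 0 < N) (H : ℝ → ℝ) (e : ℝ) {τ : ℝ} (hτ : τ = 1 ∨ τ = -1) :
    Function.Injective (Psi N H e τ) := by
  rintro ⟨a, w⟩ ⟨a', w'⟩ h
  simp only [Psi, Prod.mk.injEq, Real.exp_eq_exp] at h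
  have h1 : a = a' := mul_left_cancel₀ (by positivity : (N:ℝ) ≠ 0) h.1
  subst h1
  have h2 := h.2
  have h3 : τ * exp (e * a) ≠ 0 := mul_ne_zero (by rcases hτ with h|h <;> simp [h]) (exp_pos _).ne'
  have h4 : w = w' := mul_left_cancel₀ h3 (add_left_cancel h2)
  rw [h4]

lemma Psi_meas {N : ℕ} {H : ℝ → ℝ} (hH : Measurable H) (e τ : ℝ) : Measurable (Psi N H e τ) := by
  unfold Psi
  fun_prop

lemma Psi_image {N : ℕ} (hN : 0 < N) (H : ℝ → ℝ) (e : ℝ) {τ : ℝ} (hτ : τ = 1 ∨ τ = -1) {R : Set (ℝ × ℝ)}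
    (hR : ∀ p ∈ R, 0 < p.1) : Psi N H e τ '' (Psi N H e τ ⁻¹' R) = R := by
  apply image_preimage_eq_of_subset
  intro p hp
  have hx := hR p hp
  have h3 : τ ≠ 0 := by rcases hτ with h|h <;> simp [h]
  refine ⟨(log p.1 / N, (p.2 - H (log p.1 / N)) / (τ * exp (e * (log p.1 / N)))), ?_⟩
  have hN' : (N:ℝ) ≠ 0 := by positivity
  have h4 : τ * exp (e * (log p.1 / N)) ≠ 0 := mul_ne_zero h3 (exp_pos _).ne'
  refine Prod.ext ?_ ?_
  · show exp (N * (log p.1 / N)) = p.1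
    rw [mul_div_cancel₀ _ hN', exp_log hx]
  · show H (log p.1 / N) + τ * exp (e * (log p.1 / N)) * ((p.2 - H (log p.1 / N)) / (τ * exp (e * (log p.1 / N)))) = p.2
    rw [mul_div_cancel₀ _ h4]; ring

lemma Psi_fderiv {N : ℕ} {H : ℝ → ℝ} {e τ H1 : ℝ} {q : ℝ × ℝ} (hH : HasDerivAt H H1 q.1) (hτ : τ = 1 ∨ τ = -1) :
    ∃ L : ℝ × ℝ →L[ℝ] ℝ × ℝ, HasFDerivAt (Psi N H e τ) L q ∧ |L.det| = N * exp ((N + e) * q.1) := by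
  refine ⟨(Matrix.toLin (Module.Basis.finTwoProd ℝ) (Module.Basis.finTwoProd ℝ)
    !![N * exp (N * q.1), 0; H1 + τ * (e * exp (e * q.1)) * q.2, τ * exp (e * q.1)]).toContinuousLinearMap, ?_, ?_⟩
  · rw [Matrix.toLin_finTwoProd_toContinuousLinearMap]
    have h1 : HasFDerivAt (fun q : ℝ × ℝ => q.1) (ContinuousLinearMap.fst ℝ ℝ ℝ) q := hasFDerivAt_fst
    have h2 : HasFDerivAt (fun q : ℝ × ℝ => q.2) (ContinuousLinearMap.snd ℝ ℝ ℝ) q := hasFDerivAt_snd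
    have h3 := hH.comp_hasFDerivAt q h1
    have h4 := (h1.const_mul (N:ℝ)).exp
    have h5 := (((h1.const_mul e).exp).const_mul τ).mul h2
    have h6 := h4.prodMk (h3.add h5)
    refine h6.congr_fderiv ?_
    ext <;> simp <;> ring
  · rw [LinearMap.det_toContinuousLinearMap, LinearMap.det_toLin, Matrix.det_fin_two_of, zero_mul, sub_zero, add_mul, exp_add,
      abs_mul, abs_mul, abs_mul, abs_of_pos (exp_pos _), abs_of_pos (exp_pos _)]
    have : |τ| = 1 := by rcases hτ with h|h <;> simp [h]
    rw [this]; simp; ring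

lemma leaf_cov {E : Type*} [NormedAddCommGroup E] [NormedSpace ℝ E] {N : ℕ} (hN : 0 < N) {H H1 : ℝ → ℝ} (hHm : Measurable H)
    (e : ℝ) {τ : ℝ} (hτ : τ = 1 ∨ τ = -1) {R : Set (ℝ × ℝ)} (hRm : MeasurableSet R) (hR : ∀ p ∈ R, 0 < p.1)
    (hH : ∀ q, Psi N H e τ q ∈ R → HasDerivAt H (H1 q.1) q.1) (F : ℝ × ℝ → E) (hF : IntegrableOn F R) :
    (∫ p in R, F p = ∫ w, ∫ θ in {θ | Psi N H e τ (θ, w) ∈ R}, (N * exp ((N + e) * θ)) • F (Psi N H e τ (θ, w))) ∧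
    (∀ᵐ w, IntegrableOn (fun θ => (N * exp ((N + e) * θ)) • F (Psi N H e τ (θ, w))) {θ | Psi N H e τ (θ, w) ∈ R}) ∧
    Integrable (fun w => ∫ θ in {θ | Psi N H e τ (θ, w) ∈ R}, (N * exp ((N + e) * θ)) • F (Psi N H e τ (θ, w))) := by
  set Ω := Psi N H e τ ⁻¹' R with hΩ
  have hm : MeasurableSet Ω := Psi_meas hHm e τ hRm
  have him := Psi_image hN H e hτ hR
  have hd : ∀ q ∈ Ω, ∃ L : ℝ × ℝ →L[ℝ] ℝ × ℝ, HasFDerivAt (Psi N H e τ) L q ∧ |L.det| = N * exp ((N + e) * q.1) :=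
    fun q hq => Psi_fderiv (hH q hq) hτ
  choose! L hL hdet using hd
  have hinj : InjOn (Psi N H e τ) Ω := (Psi_inj hN H e hτ).injOn
  have e1 := integral_image_eq_integral_abs_det_fderiv_smul volume hm (fun q hq => (hL q hq).hasFDerivWithinAt) hinj F
  have e2 := (integrableOn_image_iff_integrableOn_abs_det_fderiv_smul volume hm (fun q hq => (hL q hq).hasFDerivWithinAt) hinj F)
  rw [← hΩ] at him
  rw [him] at e1 e2
  set g : ℝ × ℝ → E := fun q => (N * exp ((N + e) * q.1)) • F (Psi N H e τ q) with hg
  have hc : ∀ q ∈ Ω, |(L q).det| • F (Psi N H e τ q) = g q := fun q hq => by rw [hdet q hq]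
  rw [setIntegral_congr_fun hm hc] at e1
  have e3 : IntegrableOn g Ω := (e2.mp hF).congr_fun hc hm
  have e4 : Integrable (Ω.indicator g) (volume.prod volume) := (integrable_indicator_iff hm).mpr e3
  have hsl : ∀ w, MeasurableSet {θ | Psi N H e τ (θ, w) ∈ R} := fun w => 
    (measurable_prodMk_right (y := w)) hm
  have hin : ∀ w, (fun θ => Ω.indicator g (θ, w)) = ({θ | Psi N H e τ (θ, w) ∈ R}).indicator (fun θ => g (θ, w)) := by
    intro w; ext θ; rfl
  refine ⟨?_, ?_, ?_⟩
  · rw [e1, ← integral_indicator hm]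
    have := integral_prod_symm _ e4
    rw [Measure.volume_eq_prod, this]
    refine integral_congr_ae (Eventually.of_forall fun w => ?_)
    show ∫ θ, Ω.indicator g (θ, w) = _
    rw [hin w, integral_indicator (hsl w)]
  · have := e4.prod_left_ae
    filter_upwards [this] with w hw
    rw [hin w, integrable_indicator_iff (hsl w)] at hw
    exact hw
  · have := e4.integral_prod_right
    refine this.congr (Eventually.of_forall fun w => ?_)
    show ∫ θ, Ω.indicator g (θ, w) = _
    rw [hin w, integral_indicator (hsl w)]

def oscF (h : ℝ × ℝ → ℝ) (t u : ℝ) (p : ℝ × ℝ) : ℂ :=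
  (h p : ℂ) * Complex.exp (Complex.I * ((t : ℂ) * (p.1 : ℂ) + (u : ℂ) * (p.2 : ℂ)))
def lamF (G : ℝ × ℝ → ℝ) (t u : ℝ) (p : ℝ × ℝ) : ℝ :=
  (1 + |t * p.1| + |u * p.2|) ^ (-(1/2 : ℝ)) * G p

def EstS (G : ℝ × ℝ → ℝ) (R : Set (ℝ × ℝ)) : Prop :=
  ∃ r0 > (0:ℝ), ∀ r, 0 < r → r ≤ r0 → ∀ A > (0:ℝ), ∃ C > (0:ℝ), ∀ α : ℝ × ℝ → ℝ, AlphaBound α A →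
    tsupport α ⊆ disk2 r → ∀ t u : ℝ,
      ‖∫ p in disk2 r ∩ R, oscF (fun p => α p * G p) t u p‖ ≤ C * ∫ p in disk2 r ∩ R, lamF G t u p

lemma disk2_open (r : ℝ) : IsOpen (disk2 r) :=
  isOpen_lt (by fun_prop) continuous_const

lemma disk2_mono {r s : ℝ} (hr : 0 < r) (h : r ≤ s) : disk2 r ⊆ disk2 s := fun p hp =>
  lt_of_lt_of_le hp (pow_le_pow_left₀ hr.le h 2)

lemma alpha_aesm {α : ℝ × ℝ → ℝ} {A : ℝ} (h : AlphaBound α A) : AEStronglyMeasurable α volume := by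
  have h1 : AEStronglyMeasurable α (volume.restrict {(0:ℝ×ℝ)}ᶜ) :=
    h.1.continuousOn.aestronglyMeasurable (measurableSet_singleton _).compl
  rwa [Measure.restrict_eq_self_of_ae_mem] at h1
  exact (measure_eq_zero_iff_ae_notMem.mp (measure_singleton 0))

lemma lam_pos (t u : ℝ) (p : ℝ × ℝ) : 1 ≤ 1 + |t * p.1| + |u * p.2| := by
  have := abs_nonneg (t * p.1); have := abs_nonneg (u * p.2); linarith

lemma lamF_nonneg {G : ℝ × ℝ → ℝ} (hG : ∀ p, 0 ≤ G p) (t u : ℝ) (p : ℝ × ℝ) : 0 ≤ lamF G t u p :=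
  mul_nonneg (rpow_nonneg (by linarith [lam_pos t u p]) _) (hG p)

lemma int_lam {G : ℝ × ℝ → ℝ} {R : Set (ℝ × ℝ)} (h : IntegrableOn G R) (t u : ℝ) : IntegrableOn (lamF G t u) R := by
  refine Integrable.mono h (AEStronglyMeasurable.mul ?_ h.1) (Eventually.of_forall fun p => ?_)
  · exact (by fun_prop : Measurable fun p : ℝ × ℝ => (1 + |t * p.1| + |u * p.2|) ^ (-(1/2 : ℝ))).aestronglyMeasurable
  · unfold lamF
    rw [norm_mul]
    refine mul_le_of_le_one_left (norm_nonneg _) ?_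
    have := lam_pos t u p
    rw [norm_eq_abs, abs_of_nonneg (rpow_nonneg (by linarith) _)]
    exact rpow_le_one_of_one_le_of_nonpos this (by norm_num)

lemma oscF_norm (h : ℝ × ℝ → ℝ) (t u : ℝ) (p : ℝ × ℝ) : ‖oscF h t u p‖ = |h p| := by
  unfold oscF
  rw [norm_mul, show Complex.I * ((t : ℂ) * (p.1 : ℂ) + (u : ℂ) * (p.2 : ℂ)) = ((t * p.1 + u * p.2 : ℝ):ℂ) * Complex.I by
    push_cast; ring, Complex.norm_exp_ofReal_mul_I, mul_one, Complex.norm_real, norm_eq_abs]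

lemma int_osc {G : ℝ × ℝ → ℝ} {R : Set (ℝ × ℝ)} (h : IntegrableOn G R) {α : ℝ × ℝ → ℝ} {A : ℝ} (hα : AlphaBound α A)
    (t u : ℝ) : IntegrableOn (oscF (fun p => α p * G p) t u) R := by
  have hm : AEStronglyMeasurable (fun p => α p * G p) (volume.restrict R) := (alpha_aesm hα).restrict.mul h.1
  refine Integrable.mono (h.const_mul A) ?_ (Eventually.of_forall fun p => ?_)
  · refine AEStronglyMeasurable.mul (Complex.continuous_ofReal.comp_aestronglyMeasurable hm) ?_
    exact (by fun_prop : Continuous fun p : ℝ × ℝ => Complex.exp (Complex.I * ((t : ℂ) * (p.1 : ℂ) + (u : ℂ) * (p.2 : ℂ)))).aestronglyMeasurable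
  · rw [oscF_norm, norm_mul, abs_mul, norm_eq_abs, norm_eq_abs]
    exact mul_le_mul_of_nonneg_right ((hα.2.1 p).trans (le_abs_self A)) (abs_nonneg _)

lemma nrm2_ge (p : ℝ × ℝ) : |p.1| ≤ nrm2 p := by
  unfold nrm2
  exact Real.abs_le_sqrt (by nlinarith [sq_nonneg p.2])

/-- derivative of alpha along a curve -/
lemma alpha_curve {α : ℝ × ℝ → ℝ} {A : ℝ} (hα : AlphaBound α A) {X Y : ℝ → ℝ} {X1 Y1 θ C : ℝ}
    (hX : HasDerivAt X X1 θ) (hY : HasDerivAt Y Y1 θ) (h0 : 0 < X θ) (hC : 0 ≤ C) (h1 : |X1| ≤ C * X θ) (h2 : |Y1| ≤ C * X θ) :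
    ∃ a1, HasDerivAt (fun θ => α (X θ, Y θ)) a1 θ ∧ |a1| ≤ A * C := by
  have hne : ((X θ, Y θ) : ℝ × ℝ) ≠ 0 := fun h => h0.ne' (congrArg Prod.fst h)
  have hd : DifferentiableAt ℝ α (X θ, Y θ) :=
    ((hα.1.differentiableOn one_ne_zero).differentiableAt (isOpen_compl_singleton.mem_nhds hne))
  have hA : 0 ≤ A := (abs_nonneg _).trans (hα.2.1 0)
  have := hd.hasFDerivAt.comp_hasDerivAt θ (hX.prodMk hY)
  refine ⟨_, this, ?_⟩
  have hn : X θ ≤ nrm2 (X θ, Y θ) := (le_abs_self _).trans (nrm2_ge (X θ, Y θ))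
  calc |fderiv ℝ α (X θ, Y θ) (X1, Y1)| ≤ ‖fderiv ℝ α (X θ, Y θ)‖ * ‖(X1, Y1)‖ := by
        rw [← norm_eq_abs]; exact ContinuousLinearMap.le_opNorm _ _
    _ ≤ (A * (nrm2 (X θ, Y θ))⁻¹) * (C * X θ) := by
        refine mul_le_mul (hα.2.2 _ hne) ?_ (norm_nonneg _) (by have := h0.trans_le hn; positivity)
        rw [Prod.norm_mk]
        exact max_le h1 h2
    _ ≤ (A * (X θ)⁻¹) * (C * X θ) := by gcongr
    _ = A * C := by field_simp

structure LeafPt (G : ℝ × ℝ → ℝ) (N : ℕ) (H H1 H2 : ℝ → ℝ) (e τ σ C1 c1 θ w : ℝ) : Prop where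
  dH : HasDerivAt H (H1 θ) θ
  dH1 : HasDerivAt H1 (H2 θ) θ
  G0 : 0 < G (Psi N H e τ (θ, w))
  G1 : ∃ g', HasDerivAt (fun θ => G (Psi N H e τ (θ, w))) g' θ ∧ |g'| ≤ C1 * G (Psi N H e τ (θ, w))
  Y0 : 0 < σ * (H θ + τ * exp (e * θ) * w)
  Y1 : |H1 θ + τ * (e * exp (e * θ)) * w| ≤ C1 * (σ * (H θ + τ * exp (e * θ) * w))
  Y2 : |H2 θ + τ * (e * (e * exp (e * θ))) * w| ≤ C1 * (σ * (H θ + τ * exp (e * θ) * w))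
  Yc : c1 * (σ * (H θ + τ * exp (e * θ) * w)) ≤
    σ * ((H2 θ + τ * (e * (e * exp (e * θ))) * w) - N * (H1 θ + τ * (e * exp (e * θ)) * w))
  Yx : σ * (H θ + τ * exp (e * θ) * w) ≤ C1 * exp (N * θ)

lemma leaf_slice {G : ℝ × ℝ → ℝ} {N : ℕ} (hN : 0 < N) {e τ σ C1 c1 : ℝ}
    (hσ : σ = 1 ∨ σ = -1) (hC1 : 0 < C1) (hc1 : 0 < c1) : ∃ K > (0:ℝ), ∀ (H H1 H2 : ℝ → ℝ)
    (r A : ℝ) (S : Set ℝ) (w : ℝ) (_ : 0 < A)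
    (_ : ∀ θ ∈ S, LeafPt G N H H1 H2 e τ σ C1 c1 θ w)
    (_ : ∀ θ ∈ S, Psi N H e τ (θ, w) ∈ disk2 r)
    (_ : S = ∅ ∨ (∃ q, Iio q ⊆ S ∧ S ⊆ Iic q) ∨
      (∃ p q, p < q ∧ S = Ioo p q ∧ (1 ≤ C1 * (q - p) ∨ (Psi N H e τ (q, w) ∉ disk2 r ∧ ContinuousAt H q))))
    (α : ℝ × ℝ → ℝ) (_ : AlphaBound α A) (_ : tsupport α ⊆ disk2 r) (t u : ℝ)
    (_ : IntegrableOn (fun θ => (N * exp ((N + e) * θ)) • G (Psi N H e τ (θ, w))) S),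
    ‖∫ θ in S, (N * exp ((N + e) * θ)) • oscF (fun p => α p * G p) t u (Psi N H e τ (θ, w))‖ ≤
      (K * A) * ∫ θ in S, (N * exp ((N + e) * θ)) • lamF G t u (Psi N H e τ (θ, w)) := by
  have hNr : (0:ℝ) < N := by exact_mod_cast hN
  obtain ⟨K, hK, hmain⟩ := osc_1D (ν := N) (C1 := C1 + N + |e|) (c := c1) hNr (by positivity) hc1
  set M : ℝ := 1 + N + C1 + C1^2 with hM
  refine ⟨K * M, by positivity, ?_⟩
  intro H H1 H2 r A S w hA hpt hdisk hS α hα hsup t u hint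
  have hσ2 : σ * σ = 1 := by rcases hσ with h|h <;> simp [h]
  have hσa : |σ| = 1 := by rcases hσ with h|h <;> simp [h]
  let Y : ℝ → ℝ := fun θ => H θ + τ * exp (e * θ) * w
  let Y1 : ℝ → ℝ := fun θ => H1 θ + τ * (e * exp (e * θ)) * w
  let b : ℝ → ℝ := fun θ => (N * exp ((N + e) * θ)) * G (Psi N H e τ (θ, w))
  have dex : ∀ k θ : ℝ, HasDerivAt (fun θ => exp (k * θ)) (k * exp (k * θ)) θ := by
    intro k θ
    have := ((hasDerivAt_id θ).const_mul k).exp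
    simpa [mul_comm] using this
  have dY : ∀ θ ∈ S, HasDerivAt Y (Y1 θ) θ := fun θ hθ =>
    (hpt θ hθ).dH.add (((dex e θ).const_mul τ).mul_const w)
  have hab : ∀ θ ∈ S, ∃ b1, HasDerivAt b b1 θ ∧ |b1| ≤ (C1 + N + |e|) * b θ := by
    intro θ hθ
    obtain ⟨g', hg', hgb⟩ := (hpt θ hθ).G1
    have hG0 := (hpt θ hθ).G0
    refine ⟨_, ((dex (N+e) θ).const_mul (N:ℝ)).mul hg', ?_⟩
    have e1 : (↑N * ((↑N + e) * exp ((N + e) * θ))) * G (Psi N H e τ (θ, w)) + (N * exp ((N+e)*θ)) * g'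
      = (N + e) * b θ + (N * exp ((N+e)*θ)) * g' := by simp only [b]; ring
    rw [e1]
    have hb0 : 0 < b θ := by positivity
    calc _ ≤ |(N + e) * b θ| + |(N * exp ((N+e)*θ)) * g'| := abs_add_le _ _
      _ ≤ (N + |e|) * b θ + (N * exp ((N+e)*θ)) * (C1 * G (Psi N H e τ (θ, w))) := by
          rw [abs_mul _ (b θ), abs_mul _ g', abs_of_pos hb0, abs_of_pos (by positivity : 0 < N * exp ((N+e)*θ))]
          gcongr
          exact (abs_add_le _ _).trans (by rw [abs_of_pos hNr])
      _ = _ := by simp only [b]; ring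
  choose! b1 hb1 hbb using hab
  have hAM : A ≤ A * M := by
    have : 1 ≤ M := by rw [hM]; nlinarith [sq_nonneg C1]
    nlinarith
  have haa : ∀ θ ∈ S, ∃ a1, HasDerivAt (fun θ => α (Psi N H e τ (θ, w))) a1 θ ∧ |a1| ≤ A * M := by
    intro θ hθ
    have h := hpt θ hθ
    refine alpha_curve hα (X := fun θ => exp (N * θ)) (Y := Y) (dex N θ) (dY θ hθ) (exp_pos _) (by positivity) ?_ ?_
    · rw [abs_mul, abs_of_pos hNr, abs_of_pos (exp_pos _)]
      gcongr
      rw [hM]; nlinarith [sq_nonneg C1]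
    · calc _ ≤ _ := h.Y1
        _ ≤ C1 * (C1 * exp (N * θ)) := mul_le_mul_of_nonneg_left h.Yx hC1.le
        _ = C1^2 * exp (N*θ) := by ring
        _ ≤ _ := by gcongr; rw [hM]; linarith
  choose! a1 ha1 haab using haa
  have hVH : ∀ m : ℝ, (∀ θ ∈ S, |α (Psi N H e τ (θ, w))| ≤ A * M * m) → ∀ θ ∈ S,
      VH N (C1 + N + |e|) c1 (A * M) m (fun θ => σ * Y θ) (fun θ => σ * Y1 θ)
        (fun θ => σ * (H2 θ + τ * (e * (e * exp (e * θ))) * w)) b b1 (fun θ => α (Psi N H e τ (θ, w))) a1 θ := by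
    intro m hm θ hθ
    have h := hpt θ hθ
    have hle : C1 ≤ C1 + N + |e| := by have := abs_nonneg e; linarith
    refine ⟨(dY θ hθ).const_mul σ, ?_, hb1 θ hθ, ha1 θ hθ, h.Y0, ?_, ?_, ?_, ?_, hbb θ hθ, hm θ hθ, haab θ hθ⟩
    · exact (h.dH1.add ((((dex e θ).const_mul e).const_mul τ).mul_const w)).const_mul σ
    · rw [abs_mul, hσa, one_mul]; exact h.Y1.trans (mul_le_mul_of_nonneg_right hle h.Y0.le)
    · rw [abs_mul, hσa, one_mul]; exact h.Y2.trans (mul_le_mul_of_nonneg_right hle h.Y0.le)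
    · have := h.Yc
      calc _ ≤ _ := this
        _ = _ := by ring
    · have := h.G0; positivity
  have hVe : ∀ θ, (N * exp ((N + e) * θ)) • oscF (fun p => α p * G p) t u (Psi N H e τ (θ, w)) =
      Ve N t (σ * u) (fun θ => σ * Y θ) b (fun θ => α (Psi N H e τ (θ, w))) θ := by
    intro θ
    unfold oscF Ve
    rw [Complex.real_smul, ← mul_assoc]
    congr 1
    · simp only [b]; push_cast; ring
    · congr 2
      have : t * exp (N * θ) + σ * u * (σ * Y θ) = t * exp (N * θ) + u * Y θ := by
        linear_combination (u * Y θ) * hσ2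
      rw [this]
      simp only [Psi, Y]
      push_cast; ring
  have hVv : ∀ θ ∈ S, (N * exp ((N + e) * θ)) • lamF G t u (Psi N H e τ (θ, w)) =
      Vv N t (σ * u) (fun θ => σ * Y θ) b θ := by
    intro θ hθ
    have h0 : 0 < σ * Y θ := (hpt θ hθ).Y0
    unfold lamF Vv
    rw [rpow_neg (by linarith [lam_pos t u (Psi N H e τ (θ, w))]), ← sqrt_eq_rpow]
    have e1 : 1 + |t * (Psi N H e τ (θ, w)).1| + |u * (Psi N H e τ (θ, w)).2| = 1 + |t| * exp (N * θ) + |σ * u| * (σ * Y θ) := by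
      rw [abs_mul, abs_mul, abs_mul, hσa, one_mul]
      have : |Y θ| = σ * Y θ := by
        rw [← abs_of_pos h0, abs_mul, hσa, one_mul]
      rw [← this]
      simp only [Psi, abs_of_pos (exp_pos _), Y]
    rw [e1, smul_eq_mul]
    simp only [b]
    ring
  have hcong : ∀ T : Set ℝ, MeasurableSet T → T ⊆ S → (∫ θ in T, (N * exp ((N + e) * θ)) • lamF G t u (Psi N H e τ (θ, w))) =
      ∫ θ in T, Vv N t (σ * u) (fun θ => σ * Y θ) b θ := fun T hT hTS =>
    setIntegral_congr_fun hT fun θ hθ => hVv θ (hTS hθ)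
  simp_rw [hVe]
  have hKK : K * M * A = K * (A * M) := by ring
  rw [hKK]
  rcases hS with rfl | ⟨q, h1, h2⟩ | ⟨p, q, hpq, rfl, hcase⟩
  · simp
  · have hae : S =ᵐ[volume] Iio q := by
      refine Filter.EventuallyEq.trans ?_ Iio_ae_eq_Iic.symm
      refine HasSubset.Subset.eventuallyLE h2 |>.antisymm ?_
      exact Iio_ae_eq_Iic.symm.le.trans h1.eventuallyLE
    rw [setIntegral_congr_set hae, setIntegral_congr_set hae, hcong _ measurableSet_Iio h1]
    refine hmain t (σ * u) 1 (A * M) (Iio q) _ _ _ b b1 _ a1 ⟨one_pos, le_rfl⟩ (Or.inl ⟨q, rfl⟩) 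
      (fun θ hθ => hVH 1 (fun θ _ => ?_) θ (h1 hθ)) (hint.mono_set h1)
    rw [mul_one]; exact (hα.2.1 _).trans hAM
  · rw [hcong _ measurableSet_Ioo Subset.rfl]
    have hd : 0 < q - p := by linarith
    rcases hcase with hc | ⟨hex, hcont⟩
    · have hm0 : 0 < min 1 (1/C1) := by positivity
      refine hmain t (σ * u) (min 1 (1/C1)) (A * M) _ _ _ _ b b1 _ a1 ⟨hm0, min_le_left _ _⟩ 
        (Or.inr ⟨p, q, hpq, rfl, (min_le_right _ _).trans ?_⟩) (hVH _ fun θ _ => (hα.2.1 _).trans ?_) hint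
      · rw [div_le_iff₀ hC1]; linarith
      · rcases min_cases 1 (1/C1) with ⟨h, _⟩ | ⟨h, _⟩
        · rw [h, mul_one]; exact hAM
        · rw [h, mul_assoc]
          refine le_mul_of_one_le_right hA.le ?_
          rw [mul_one_div, one_le_div hC1, hM]
          nlinarith [sq_nonneg C1]
    · refine hmain t (σ * u) (min 1 (q - p)) (A * M) _ _ _ _ b b1 _ a1 ⟨lt_min one_pos hd, min_le_left _ _⟩ 
        (Or.inr ⟨p, q, hpq, rfl, min_le_right _ _⟩) (hVH _ fun θ hθ => ?_) hint
      rcases min_cases 1 (q - p) with ⟨h, _⟩ | ⟨h, _⟩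
      · rw [h, mul_one]; exact (hα.2.1 _).trans hAM
      · rw [h]
        have hz : α (Psi N H e τ (q, w)) = 0 := by
          by_contra hne
          exact hex (hsup (subset_tsupport α hne))
        have hcq : ContinuousAt (fun θ => α (Psi N H e τ (θ, w))) q := by
          have hne : Psi N H e τ (q, w) ≠ 0 := fun h => (exp_pos (N * q)).ne' (congrArg Prod.fst h)
          have h1 : ContinuousAt α (Psi N H e τ (q, w)) := hα.1.continuousOn.continuousAt (isOpen_compl_singleton.mem_nhds hne)
          have h2 : ContinuousAt (fun θ => Psi N H e τ (θ, w)) q := by unfold Psi; fun_prop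
          exact ContinuousAt.comp (f := fun θ => Psi N H e τ (θ, w)) h1 h2
        have hmv2 := image_norm_le_of_norm_deriv_right_le_deriv_boundary' (f := fun s => α (Psi N H e τ (s, w)) - α (Psi N H e τ (θ, w)))
          (f' := a1) (a := θ) (b := q) (B := fun s => A * M * (s - θ)) (B' := fun _ => A * M) ?_ ?_ (by simp) (by fun_prop) ?_ ?_
          (right_mem_Icc.mpr hθ.2.le)
        · simp only [hz, zero_sub, norm_neg] at hmv2
          refine hmv2.trans ?_
          gcongr
          exact hθ.1.le
        · intro s hs
          apply ContinuousAt.continuousWithinAt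
          rcases hs.2.lt_or_eq with h | h
          · exact (ha1 s ⟨hθ.1.trans_le hs.1, h⟩).continuousAt.sub continuousAt_const
          · rw [h]; exact hcq.sub continuousAt_const
        · intro s hs
          exact ((ha1 s ⟨hθ.1.trans_le hs.1, hs.2⟩).sub_const _).hasDerivWithinAt
        · intro s hs
          exact (((hasDerivAt_id s).sub_const θ).const_mul (A*M)).hasDerivWithinAt.congr_deriv (by simp)
        · intro s hs
          exact haab s ⟨hθ.1.trans_le hs.1, hs.2⟩

lemma down_closed {S : Set ℝ} (hb : BddAbove S) (hd : ∀ a ∈ S, ∀ b < a, b ∈ S) :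
    S = ∅ ∨ (∃ q, Iio q ⊆ S ∧ S ⊆ Iic q) := by
  rcases S.eq_empty_or_nonempty with h | h
  · exact Or.inl h
  · refine Or.inr ⟨sSup S, fun x hx => ?_, fun x hx => le_csSup hb hx⟩
    obtain ⟨y, hy, hxy⟩ := exists_lt_of_lt_csSup h hx
    exact hd y hy x hxy

lemma leaf2D {G : ℝ × ℝ → ℝ} {rG : ℝ} (hrG : 0 < rG) (hG : IntegrableOn G (disk2 rG))
    {N : ℕ} (hN : 0 < N) {H H1 H2 : ℝ → ℝ} (hHm : Measurable H) {e τ σ C1 c1 r0 : ℝ} (hτ : τ = 1 ∨ τ = -1)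
    (hσ : σ = 1 ∨ σ = -1) (hC1 : 0 < C1) (hc1 : 0 < c1) (hr0 : 0 < r0) {R : Set (ℝ × ℝ)} (hRm : MeasurableSet R)
    (hR : ∀ p ∈ R, 0 < p.1)
    (hpt : ∀ θ w, Psi N H e τ (θ, w) ∈ disk2 r0 ∩ R → LeafPt G N H H1 H2 e τ σ C1 c1 θ w)
    (hS : ∀ r w, 0 < r → r ≤ r0 → {θ | Psi N H e τ (θ, w) ∈ disk2 r ∩ R} = ∅ ∨
      (∃ q, Iio q ⊆ {θ | Psi N H e τ (θ, w) ∈ disk2 r ∩ R} ∧ {θ | Psi N H e τ (θ, w) ∈ disk2 r ∩ R} ⊆ Iic q) ∨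
      (∃ p q, p < q ∧ {θ | Psi N H e τ (θ, w) ∈ disk2 r ∩ R} = Ioo p q ∧
        (1 ≤ C1 * (q - p) ∨ (Psi N H e τ (q, w) ∉ disk2 r ∧ ContinuousAt H q)))) :
    EstS G R := by
  obtain ⟨K, hK, hmain⟩ := leaf_slice (G := G) (e := e) (τ := τ) hN hσ hC1 hc1
  refine ⟨min r0 rG, lt_min hr0 hrG, fun r hr hrr A hA => ⟨K * A, by positivity, fun α hα hsup t u => ?_⟩⟩
  have hr1 : r ≤ r0 := hrr.trans (min_le_left _ _)
  have hGR : IntegrableOn G (disk2 r ∩ R) := hG.mono_set (inter_subset_left.trans (disk2_mono hr (hrr.trans (min_le_right _ _))))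
  have hm : MeasurableSet (disk2 r ∩ R) := (disk2_open r).measurableSet.inter hRm
  have hpos : ∀ p ∈ disk2 r ∩ R, 0 < p.1 := fun p hp => hR p hp.2
  have hpt' : ∀ θ w, Psi N H e τ (θ, w) ∈ disk2 r ∩ R → LeafPt G N H H1 H2 e τ σ C1 c1 θ w := fun θ w h =>
    hpt θ w ⟨disk2_mono hr hr1 h.1, h.2⟩
  have hH : ∀ q, Psi N H e τ q ∈ disk2 r ∩ R → HasDerivAt H (H1 q.1) q.1 := fun q hq => (hpt' q.1 q.2 hq).dH
  obtain ⟨a1, a2, a3⟩ := leaf_cov hN hHm e hτ hm hpos hH _ (int_osc hGR hα t u)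
  obtain ⟨b1, b2, b3⟩ := leaf_cov hN hHm e hτ hm hpos hH _ (int_lam hGR t u)
  obtain ⟨c1', c2', c3'⟩ := leaf_cov hN hHm e hτ hm hpos hH _ hGR
  rw [a1, b1, ← integral_const_mul]
  refine norm_integral_le_of_norm_le (b3.const_mul _) ?_
  filter_upwards [c2'] with w hw
  exact hmain H H1 H2 r A _ w hA (fun θ hθ => hpt' θ w hθ) (fun θ hθ => hθ.1) (hS r w hr hr1) α hα hsup t u hw

lemma disk2_mem_nhds {r : ℝ} (hr : 0 < r) : disk2 r ∈ 𝓝 (0 : ℝ × ℝ) :=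
  (disk2_open r).mem_nhds (by simp [disk2, hr])

lemma EstS_empty (G : ℝ × ℝ → ℝ) : EstS G ∅ :=
  ⟨1, one_pos, fun r _ _ A _ => ⟨1, one_pos, fun α _ _ t u => by simp⟩⟩

lemma EstS_congr {G : ℝ × ℝ → ℝ} {R R' : Set (ℝ × ℝ)} {ρ : ℝ} (hρ : 0 < ρ)
    (h : ∀ᵐ p, p ∈ disk2 ρ → (p ∈ R ↔ p ∈ R')) (hR : EstS G R) : EstS G R' := by
  obtain ⟨r0, hr0, H⟩ := hR
  refine ⟨min r0 ρ, lt_min hr0 hρ, fun r hr hrr => ?_⟩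
  have hae : (disk2 r ∩ R : Set (ℝ × ℝ)) =ᵐ[volume] (disk2 r ∩ R' : Set (ℝ × ℝ)) := by
    filter_upwards [h] with p hp
    refine propext ⟨fun h => ⟨h.1, (hp (disk2_mono hr (hrr.trans (min_le_right _ _)) h.1)).mp h.2⟩,
      fun h => ⟨h.1, (hp (disk2_mono hr (hrr.trans (min_le_right _ _)) h.1)).mpr h.2⟩⟩
  have := H r hr (hrr.trans (min_le_left _ _))
  simp_rw [setIntegral_congr_set hae] at this
  exact this

lemma EstS_congr' {G : ℝ × ℝ → ℝ} {R R' : Set (ℝ × ℝ)} (h : ∀ᵐ p, (p ∈ R ↔ p ∈ R')) (hR : EstS G R) : EstS G R' :=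
  EstS_congr one_pos (h.mono fun p hp _ => hp) hR

lemma EstS_union {G : ℝ × ℝ → ℝ} (hG0 : ∀ p, 0 ≤ G p) {rG : ℝ} (hrG : 0 < rG) (hG : IntegrableOn G (disk2 rG))
    {R R' : Set (ℝ × ℝ)} (hd : Disjoint R R') (hm' : MeasurableSet R')
    (hR : EstS G R) (hR' : EstS G R') : EstS G (R ∪ R') := by
  obtain ⟨r0, hr0, H⟩ := hR
  obtain ⟨r1, hr1, H'⟩ := hR'
  refine ⟨min rG (min r0 r1), lt_min hrG (lt_min hr0 hr1), fun r hr hrr A hA => ?_⟩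
  have hle := hrr.trans (min_le_right _ _)
  obtain ⟨C, hC, h1⟩ := H r hr (hle.trans (min_le_left _ _)) A hA
  obtain ⟨C', hC', h2⟩ := H' r hr (hle.trans (min_le_right _ _)) A hA
  refine ⟨C + C', by positivity, fun α hα hs t u => ?_⟩
  have hGd := hG.mono_set (disk2_mono hr (hrr.trans (min_le_left _ _)))
  have hdd : Disjoint (disk2 r ∩ R) (disk2 r ∩ R') := hd.mono inter_subset_right inter_subset_right
  have hmm : MeasurableSet (disk2 r ∩ R') := (disk2_open r).measurableSet.inter hm'
  have i1 := int_osc hGd hα t u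
  have i2 := int_lam hGd t u
  rw [inter_union_distrib_left, setIntegral_union hdd hmm (i1.mono_set inter_subset_left) (i1.mono_set inter_subset_left),
    setIntegral_union hdd hmm (i2.mono_set inter_subset_left) (i2.mono_set inter_subset_left)]
  have n1 : 0 ≤ ∫ p in disk2 r ∩ R, lamF G t u p := integral_nonneg (lamF_nonneg hG0 t u)
  have n2 : 0 ≤ ∫ p in disk2 r ∩ R', lamF G t u p := integral_nonneg (lamF_nonneg hG0 t u)
  have e1 := h1 α hα hs t u
  have e2 := h2 α hα hs t u
  have e3 := norm_add_le (∫ p in disk2 r ∩ R, oscF (fun p => α p * G p) t u p) (∫ p in disk2 r ∩ R', oscF (fun p => α p * G p) t u p)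
  have e4 := mul_nonneg hC.le n2
  have e5 := mul_nonneg hC'.le n1
  linarith

structure SymT (T : (ℝ × ℝ) ≃L[ℝ] (ℝ × ℝ)) : Prop where
  mp : MeasurePreserving T volume volume
  nrm : ∀ p, (T p).1 ^ 2 + (T p).2 ^ 2 = p.1 ^ 2 + p.2 ^ 2
  op : ∀ p, ‖T p‖ ≤ ‖p‖
  ph : ∀ t u : ℝ, ∃ t' u' : ℝ, ∀ p, t * (T p).1 + u * (T p).2 = t' * p.1 + u' * p.2 ∧
    |t * (T p).1| + |u * (T p).2| = |t' * p.1| + |u' * p.2|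

lemma EstS_sym {G : ℝ × ℝ → ℝ} {R : Set (ℝ × ℝ)} {T : (ℝ × ℝ) ≃L[ℝ] (ℝ × ℝ)} (hT : SymT T)
    (h : EstS (fun p => G (T p)) (T ⁻¹' R)) : EstS G R := by
  obtain ⟨r0, hr0, H⟩ := h
  refine ⟨r0, hr0, fun r hr hrr A hA => ?_⟩
  obtain ⟨C, hC, h1⟩ := H r hr hrr A hA
  refine ⟨C, hC, fun α hα hs t u => ?_⟩
  have hdisk : T ⁻¹' (disk2 r ∩ R) = disk2 r ∩ T ⁻¹' R := by
    ext p; simp only [mem_preimage, mem_inter_iff, disk2, mem_ofPred_eq, hT.nrm p]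
  have hemb : MeasurableEmbedding T := T.toHomeomorph.measurableEmbedding
  obtain ⟨t', u', hph⟩ := hT.ph t u
  rw [← hT.mp.setIntegral_preimage_emb hemb (oscF _ t u), ← hT.mp.setIntegral_preimage_emb hemb (lamF G t u), hdisk]
  have e1 : ∀ p, oscF (fun p => α p * G p) t u (T p) = oscF (fun p => α (T p) * G (T p)) t' u' p := by
    intro p
    unfold oscF
    congr 3
    exact_mod_cast (hph p).1
  have e2 : ∀ p, lamF G t u (T p) = lamF (fun p => G (T p)) t' u' p := by
    intro p
    unfold lamF
    rw [add_assoc, (hph p).2, ← add_assoc]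
  simp_rw [e1, e2]
  refine h1 (fun p => α (T p)) ⟨?_, fun p => hα.2.1 _, fun p hp => ?_⟩ ?_ t' u'
  · refine hα.1.comp T.contDiff.contDiffOn fun p hp => ?_
    simpa using hp
  · have hTp : T p ≠ 0 := by simpa using hp
    have hd : DifferentiableAt ℝ α (T p) :=
      ((hα.1.differentiableOn one_ne_zero).differentiableAt (isOpen_compl_singleton.mem_nhds hTp))
    have h2 : fderiv ℝ (fun p => α (T p)) p = (fderiv ℝ α (T p)).comp (T : ℝ × ℝ →L[ℝ] ℝ × ℝ) :=
      (hd.hasFDerivAt.comp p T.hasFDerivAt).fderiv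
    have hn : nrm2 (T p) = nrm2 p := by unfold nrm2; rw [hT.nrm]
    have hop : ‖(T : ℝ × ℝ →L[ℝ] ℝ × ℝ)‖ ≤ 1 :=
      ContinuousLinearMap.opNorm_le_bound _ zero_le_one (fun p => by rw [one_mul]; exact hT.op p)
    rw [h2, ← hn]
    exact ((ContinuousLinearMap.opNorm_comp_le _ _).trans (mul_le_of_le_one_right (norm_nonneg _) hop)).trans (hα.2.2 _ hTp)
  · refine (tsupport_comp_subset_preimage α T.continuous).trans fun p hp => ?_
    have := hs hp
    simpa only [disk2, mem_ofPred_eq, hT.nrm p] using this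

lemma sym_swap : ∃ T : (ℝ × ℝ) ≃L[ℝ] (ℝ × ℝ), SymT T ∧ ∀ p, T p = (p.2, p.1) := by
  refine ⟨ContinuousLinearEquiv.prodComm ℝ ℝ ℝ, ⟨?_, fun p => ?_, fun p => ?_, fun t u => ⟨u, t, fun p => ⟨?_, ?_⟩⟩⟩, fun p => rfl⟩
  · exact Measure.measurePreserving_swap
  · show p.2^2 + p.1^2 = _; ring
  · show ‖(p.2, p.1)‖ ≤ ‖p‖
    rw [Prod.norm_mk, Prod.norm_def, max_comm]
  · show t * p.2 + u * p.1 = _; ring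
  · show |t * p.2| + |u * p.1| = _; ring

lemma sym_refl {ε δ : ℝ} (hε : ε = 1 ∨ ε = -1) (hδ : δ = 1 ∨ δ = -1) :
    ∃ T : (ℝ × ℝ) ≃L[ℝ] (ℝ × ℝ), SymT T ∧ ∀ p, T p = (ε * p.1, δ * p.2) := by
  have key : ∀ ε : ℝ, (ε = 1 ∨ ε = -1) → ∃ L : ℝ ≃L[ℝ] ℝ, (∀ x, L x = ε * x) ∧ MeasurePreserving L volume volume := by
    rintro ε (rfl | rfl)
    · exact ⟨ContinuousLinearEquiv.refl ℝ ℝ, fun x => by simp, MeasurePreserving.id volume⟩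
    · exact ⟨ContinuousLinearEquiv.neg ℝ, fun x => by simp, Measure.measurePreserving_neg volume⟩
  obtain ⟨L, hL, mL⟩ := key ε hε
  obtain ⟨M, hM, mM⟩ := key δ hδ
  have aε : |ε| = 1 := by rcases hε with h|h <;> simp [h]
  have aδ : |δ| = 1 := by rcases hδ with h|h <;> simp [h]
  have hp : ∀ p, (L.prodCongr M) p = (ε * p.1, δ * p.2) := fun p => by
    show (L p.1, M p.2) = _
    rw [hL, hM]
  refine ⟨L.prodCongr M, ⟨?_, fun p => ?_, fun p => ?_, fun t u => ⟨t * ε, u * δ, fun p => ⟨?_, ?_⟩⟩⟩, hp⟩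
  · exact mL.prod mM
  · rw [hp, ← sq_abs (ε * p.1), ← sq_abs (δ * p.2), abs_mul, abs_mul, aε, aδ]; simp
  · rw [hp, Prod.norm_mk, Prod.norm_def, norm_mul, norm_mul, norm_eq_abs, norm_eq_abs δ, aε, aδ]; simp
  · rw [hp]; ring
  · rw [hp]; simp only [abs_mul, aε, aδ]; ring

/-- gluing lemma for intervals -/
lemma glue {P : ℝ → ℝ → Prop} (hadd : ∀ u v w, u < v → v < w → P u v → P v w → P u w)
    {u0 a B : ℝ} (hu0 : u0 ≤ a) (haB : a ≤ B) (hbase : ∃ δ > 0, ∀ v ∈ Ioo a (a + δ), P u0 v)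
    (hloc : ∀ ζ ∈ Ioc a B, ∃ δ > 0, ∀ u ∈ Ioo (ζ - δ) ζ, ∀ v ∈ Ioo ζ (ζ + δ), P u v) :
    ∃ β > B, ∀ v ∈ Ioo B β, P u0 v := by
  obtain ⟨δ0, hδ0, hb⟩ := hbase
  let S : Set ℝ := {v | a < v ∧ P u0 v}
  by_contra hcon
  have hne : S.Nonempty := ⟨a + δ0/2, by linarith, hb _ ⟨by linarith, by linarith⟩⟩
  -- a point of Ioc a B at which all of the interval before is good, not beyond
  let Z : Set ℝ := {z | a < z ∧ ∀ v ∈ Ioo a z, ∃ v' ∈ Ico v z, P u0 v'}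
  have step : ∀ z ∈ Ioc a B, z ∈ Z → ∃ β > z, ∀ v ∈ Ioo z β, P u0 v := by
    intro z hz hzZ
    obtain ⟨δ, hδ, hl⟩ := hloc z hz
    obtain ⟨v', hv', hP⟩ := hzZ.2 (max (z - δ/2) ((a+z)/2)) ⟨lt_max_of_lt_right (by linarith [hz.1]), max_lt (by linarith) (by linarith [hz.1])⟩
    have h1 : z - δ/2 ≤ v' := (le_max_left _ _).trans hv'.1
    have h2 : (a+z)/2 ≤ v' := (le_max_right _ _).trans hv'.1
    refine ⟨z + δ, by linarith, fun v hv => hadd u0 v' v (by linarith [hz.1]) (hv'.2.trans hv.1) hP (hl v' ⟨by linarith, hv'.2⟩ v hv)⟩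
  have hZ0 : ∀ z β : ℝ, a ≤ z → z < β → (∀ v ∈ Ioo z β, P u0 v) → β ∈ Z := by
    intro z β haz hzβ h
    refine ⟨by linarith, fun v hv => ⟨max v ((z+β)/2), ⟨le_max_left _ _, max_lt hv.2 (by linarith)⟩, h _ ⟨lt_max_of_lt_right (by linarith), max_lt hv.2 (by linarith)⟩⟩⟩
  rcases haB.eq_or_lt with rfl | haB'
  · exact hcon ⟨a + δ0, by linarith, hb⟩
  have hZne : (Z ∩ Iic B).Nonempty := by
    refine ⟨min (a + δ0) B, hZ0 a _ le_rfl (lt_min (by linarith) haB') fun v hv => hb v ⟨hv.1, hv.2.trans_le (min_le_left _ _)⟩, mem_Iic.mpr (min_le_right _ _)⟩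
  have hbd : BddAbove (Z ∩ Iic B) := ⟨B, fun z hz => hz.2⟩
  set s := sSup (Z ∩ Iic B) with hs
  have hsB : s ≤ B := csSup_le hZne fun z hz => hz.2
  obtain ⟨z0, hz0⟩ := hZne
  have has : a < s := hz0.1.1.trans_le (le_csSup hbd hz0)
  have hsZ : s ∈ Z := by
    refine ⟨has, fun v hv => ?_⟩
    obtain ⟨z, hz, hvz⟩ := exists_lt_of_lt_csSup ⟨z0, hz0⟩ hv.2
    obtain ⟨v', hv', hP⟩ := hz.1.2 v ⟨hv.1, hvz⟩
    exact ⟨v', ⟨hv'.1, hv'.2.trans_le (le_csSup hbd hz)⟩, hP⟩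
  obtain ⟨β, hβ, hPβ⟩ := step s ⟨has, hsB⟩ hsZ
  rcases hsB.eq_or_lt with h | h
  · exact hcon ⟨β, h ▸ hβ, h ▸ hPβ⟩
  · have : min β B ∈ Z ∩ Iic B := ⟨hZ0 s _ has.le (lt_min hβ h) fun v hv => hPβ v ⟨hv.1, hv.2.trans_le (min_le_left _ _)⟩, mem_Iic.mpr (min_le_right _ _)⟩
    exact absurd (le_csSup hbd this) (not_le.mpr (lt_min hβ h))

lemma avg_analytic {f : ℝ × ℝ → ℝ} (hf : AnalyticAt ℝ f 0) (A : ℝ → (ℝ × ℝ) →L[ℝ] (ℝ × ℝ))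
    (hA : Continuous A) (hA1 : ∀ θ ∈ uIoc (0:ℝ) 1, ‖A θ‖ ≤ 1) :
    AnalyticAt ℝ (fun v => ∫ θ in (0:ℝ)..1, f (A θ v)) 0 := by
  obtain ⟨p, r, hp⟩ := hf
  obtain ⟨ρ, hρ0, hρr⟩ := ENNReal.lt_iff_exists_nnreal_btwn.mp hp.r_pos
  have hρp : (ρ : ℝ≥0∞) < p.radius := hρr.trans_le hp.r_le
  obtain ⟨C, hC, hpC⟩ := p.norm_mul_pow_le_of_lt_radius hρp
  let q : FormalMultilinearSeries ℝ (ℝ × ℝ) ℝ := fun n =>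
    ∫ θ in (0:ℝ)..1, (p n).compContinuousLinearMap (fun _ => A θ)
  have hcont : ∀ n, Continuous (fun θ => (p n).compContinuousLinearMap (fun _ => A θ)) := by
    intro n
    have := (ContinuousMultilinearMap.compContinuousLinearMapLRight (E := fun _ : Fin n => ℝ × ℝ) (p n)).cont
    exact this.comp (continuous_pi fun _ => hA)
  have hqn : ∀ n, ‖q n‖ ≤ ‖p n‖ := by
    intro n
    have := intervalIntegral.norm_integral_le_of_norm_le_const (a := (0:ℝ)) (b := 1) (C := ‖p n‖)
      (f := fun θ => (p n).compContinuousLinearMap (fun _ => A θ)) (fun θ hθ => by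
        refine (ContinuousMultilinearMap.norm_compContinuousLinearMap_le _ _).trans ?_
        refine mul_le_of_le_one_right (norm_nonneg _) ?_
        exact Finset.prod_le_one (fun _ _ => norm_nonneg _) (fun _ _ => hA1 θ hθ))
    simpa using this
  refine ⟨q, ρ, ⟨q.le_radius_of_bound C fun n => (mul_le_mul_of_nonneg_right (hqn n) (by positivity)).trans (hpC n), hρ0, ?_⟩⟩
  intro y hy
  have hyρ : ‖y‖₊ < ρ := by
    have : edist y 0 < ρ := hy
    rw [edist_zero_right] at this
    exact_mod_cast this
  have hq : ∀ n, q n (fun _ => y) = ∫ θ in (0:ℝ)..1, p n (fun _ => A θ y) := by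
    intro n
    have := (ContinuousMultilinearMap.apply ℝ (fun _ : Fin n => ℝ × ℝ) ℝ (fun _ => y)).intervalIntegral_comp_comm
      ((hcont n).intervalIntegrable 0 1 (μ := volume))
    exact this.symm
  have hAy : ∀ θ ∈ uIoc (0:ℝ) 1, ‖A θ y‖ ≤ ‖y‖ := fun θ hθ =>
    ((A θ).le_opNorm y).trans (mul_le_of_le_one_left (norm_nonneg _) (hA1 θ hθ))
  simp_rw [hq, zero_add]
  have hsum : Summable fun n => ‖p n‖ * ‖y‖ ^ n :=
    p.summable_norm_mul_pow (r := ‖y‖₊) (lt_trans (by exact_mod_cast hyρ) hρp)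
  refine intervalIntegral.hasSum_integral_of_dominated_convergence (fun n _ => ‖p n‖ * ‖y‖ ^ n) ?_ ?_ ?_ ?_ ?_
  · intro n
    refine Continuous.aestronglyMeasurable ?_
    exact (p n).cont.comp (continuous_pi fun _ => hA.clm_apply continuous_const)
  · intro n
    refine Eventually.of_forall fun θ hθ => ?_
    refine ((p n).le_opNorm _).trans (mul_le_mul_of_nonneg_left ?_ (norm_nonneg _))
    rw [Finset.prod_const, Finset.card_univ, Fintype.card_fin]
    exact pow_le_pow_left₀ (norm_nonneg _) (hAy θ hθ) n
  · exact Eventually.of_forall fun θ hθ => hsum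
  · exact intervalIntegrable_const
  · refine Eventually.of_forall fun θ hθ => ?_
    have h1 : A θ y ∈ eball (0 : ℝ × ℝ) r := by
      show edist (A θ y) 0 < r
      rw [edist_zero_right]
      refine lt_trans (lt_of_le_of_lt ?_ (show (‖y‖₊ : ℝ≥0∞) < ρ by exact_mod_cast hyρ)) hρr
      exact_mod_cast hAy θ hθ
    simpa using hp.hasSum h1

lemma divZ {F : ℝ × ℝ → ℝ} (hF : AnalyticAt ℝ F 0) :
    ∃ U : ℝ × ℝ → ℝ, AnalyticAt ℝ U 0 ∧ ∀ᶠ p in 𝓝 (0 : ℝ × ℝ), F p = F (p.1, 0) + p.2 * U p := by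
  let D : ℝ × ℝ → ℝ := fun p => fderiv ℝ F p (0, 1)
  have hD : AnalyticAt ℝ D 0 :=
    ((ContinuousLinearMap.apply ℝ ℝ ((0, 1) : ℝ × ℝ)).analyticAt _).comp hF.fderiv
  let A : ℝ → (ℝ × ℝ) →L[ℝ] (ℝ × ℝ) := fun θ =>
    (ContinuousLinearMap.fst ℝ ℝ ℝ).prod (θ • ContinuousLinearMap.snd ℝ ℝ ℝ)
  have hAp : ∀ θ p, A θ p = (p.1, θ * p.2) := fun θ p => by simp [A]
  have hA : Continuous A := by
    refine continuous_clm_apply.mpr fun p => ?_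
    simp_rw [hAp]; fun_prop
  have hA1 : ∀ θ ∈ Icc (0:ℝ) 1, ∀ p, ‖A θ p‖ ≤ ‖p‖ := by
    intro θ hθ p
    rw [hAp, Prod.norm_mk, Prod.norm_def, norm_mul, norm_eq_abs θ, abs_of_nonneg hθ.1]
    exact max_le_max le_rfl (mul_le_of_le_one_left (norm_nonneg _) hθ.2)
  refine ⟨fun v => ∫ θ in (0:ℝ)..1, D (A θ v), avg_analytic hD A hA ?_, ?_⟩
  · intro θ hθ
    rw [uIoc_of_le zero_le_one] at hθ
    exact ContinuousLinearMap.opNorm_le_bound _ zero_le_one fun p => by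
      rw [one_mul]; exact hA1 θ ⟨hθ.1.le, hθ.2⟩ p
  · have h1 : ∀ᶠ p in 𝓝 (0 : ℝ × ℝ), AnalyticAt ℝ F p := hF.eventually_analyticAt
    obtain ⟨ε, hε, hb⟩ := Metric.eventually_nhds_iff.mp h1
    refine Metric.eventually_nhds_iff.mpr ⟨ε, hε, fun p hp => ?_⟩
    rw [dist_zero_right] at hp
    have h2 : ∀ θ ∈ uIcc (0:ℝ) 1, AnalyticAt ℝ F (p.1, θ * p.2) := by
      intro θ hθ
      rw [uIcc_of_le zero_le_one] at hθ
      rw [← hAp]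
      exact hb (by rw [dist_zero_right]; exact (hA1 θ hθ p).trans_lt hp)
    have h3 : ∀ θ ∈ uIcc (0:ℝ) 1, HasDerivAt (fun θ => F (p.1, θ * p.2)) (p.2 * D (A θ p)) θ := by
      intro θ hθ
      have e1 : HasDerivAt (fun θ : ℝ => (p.1, θ * p.2)) (0, p.2) θ := by
        have := (hasDerivAt_id θ).mul_const p.2
        simpa using (hasDerivAt_const θ p.1).prodMk this
      have e2 := (h2 θ hθ).differentiableAt.hasFDerivAt.comp_hasDerivAt θ e1
      have e3 : ((0:ℝ), p.2) = p.2 • ((0:ℝ), (1:ℝ)) := by simp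
      rw [e3, map_smul, smul_eq_mul] at e2
      rw [hAp]
      exact e2
    have h4 : ContinuousOn (fun θ => p.2 * D (A θ p)) (uIcc (0:ℝ) 1) := by
      refine continuousOn_const.mul ?_
      intro θ hθ
      refine ContinuousAt.continuousWithinAt ?_
      have : ContinuousAt D (A θ p) := by
        rw [hAp]
        exact (((ContinuousLinearMap.apply ℝ ℝ ((0, 1) : ℝ × ℝ)).analyticAt _).comp (h2 θ hθ).fderiv).continuousAt
      exact ContinuousAt.comp (f := fun θ => A θ p) this (hA.clm_apply continuous_const).continuousAt
    have h5 := intervalIntegral.integral_eq_sub_of_hasDerivAt h3 h4.intervalIntegrable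
    rw [intervalIntegral.integral_const_mul] at h5
    simp only [one_mul, zero_mul] at h5
    linarith

lemma divS {F : ℝ × ℝ → ℝ} (hF : AnalyticAt ℝ F 0) :
    ∃ U : ℝ × ℝ → ℝ, AnalyticAt ℝ U 0 ∧ ∀ᶠ p in 𝓝 (0 : ℝ × ℝ), F p = F (0, p.2) + p.1 * U p := by
  have hs : AnalyticAt ℝ (fun p : ℝ × ℝ => (p.2, p.1)) 0 := analyticAt_snd.prod analyticAt_fst
  have hF' : AnalyticAt ℝ (fun p : ℝ × ℝ => F (p.2, p.1)) 0 := AnalyticAt.comp (g := F) (f := fun p : ℝ × ℝ => (p.2, p.1)) hF hs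
  obtain ⟨U, hU, h⟩ := divZ hF'
  refine ⟨fun p => U (p.2, p.1), AnalyticAt.comp (g := U) (f := fun p : ℝ × ℝ => (p.2, p.1)) hU hs, ?_⟩
  have ht : Tendsto (fun p : ℝ × ℝ => (p.2, p.1)) (𝓝 0) (𝓝 0) := hs.continuousAt
  filter_upwards [ht.eventually h] with p hp
  simpa using hp

/-- division by powers of `s` -/
lemma divPow (d : ℕ) : ∀ {g : ℝ × ℝ → ℝ}, AnalyticAt ℝ g 0 → (∃ C, ∀ᶠ p in 𝓝 (0 : ℝ × ℝ), |g p| ≤ C * |p.1| ^ d) →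
    ∃ F : ℝ × ℝ → ℝ, AnalyticAt ℝ F 0 ∧ ∀ᶠ p in 𝓝 (0 : ℝ × ℝ), g p = p.1 ^ d * F p := by
  induction d with
  | zero => exact fun {g} hg _ => ⟨g, hg, by simp⟩
  | succ d ih =>
    rintro g hg ⟨C, hC⟩
    obtain ⟨U, hU, h⟩ := divS hg
    have ht : Tendsto (fun p : ℝ × ℝ => ((0:ℝ), p.2)) (𝓝 0) (𝓝 0) := by
      have : Continuous (fun p : ℝ × ℝ => ((0:ℝ), p.2)) := by fun_prop
      exact this.tendsto 0
    have h0 : ∀ᶠ p in 𝓝 (0 : ℝ × ℝ), g p = p.1 * U p := by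
      filter_upwards [h, ht.eventually hC] with p hp h2
      have : g (0, p.2) = 0 := by
        rw [← abs_nonpos_iff]; simpa using h2
      rw [hp, this, zero_add]
    have h1 : ∀ᶠ p in 𝓝 (0 : ℝ × ℝ), p.1 ≠ 0 → |U p| ≤ C * |p.1| ^ d := by
      filter_upwards [h0, hC] with p h0 hC hp
      rw [h0, abs_mul, pow_succ', mul_left_comm] at hC
      exact le_of_mul_le_mul_left hC (abs_pos.mpr hp)
    have h2 : ∀ᶠ p in 𝓝 (0 : ℝ × ℝ), |U p| ≤ C * |p.1| ^ d := by
      filter_upwards [h1, eventually_eventually_nhds.mpr h1, hU.eventually_analyticAt] with p hp hpp hUp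
      by_cases hp0 : p.1 = 0
      · have hl : Tendsto (fun s : ℝ => (s, p.2)) (𝓝[≠] 0) (𝓝 p) := by
          have : Continuous (fun s : ℝ => (s, p.2)) := by fun_prop
          have := this.tendsto 0
          rw [show ((0:ℝ), p.2) = p from Prod.ext hp0.symm rfl] at this
          exact this.mono_left nhdsWithin_le_nhds
        have l1 : Tendsto (fun s : ℝ => |U (s, p.2)|) (𝓝[≠] 0) (𝓝 |U p|) := (hUp.continuousAt.tendsto.comp hl).abs
        have l2 : Tendsto (fun s : ℝ => C * |(s, p.2).1| ^ d) (𝓝[≠] 0) (𝓝 (C * |p.1| ^ d)) := by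
          have : Continuous (fun q : ℝ × ℝ => C * |q.1| ^ d) := by fun_prop
          exact (this.tendsto p).comp hl
        refine le_of_tendsto_of_tendsto l1 l2 ?_
        filter_upwards [hl.eventually hpp, self_mem_nhdsWithin] with s hs hs0
        exact hs hs0
      · exact hp hp0
    obtain ⟨F, hF, h3⟩ := ih hU ⟨C, h2⟩
    refine ⟨F, hF, ?_⟩
    filter_upwards [h0, h3] with p h0 h3
    rw [h0, h3, pow_succ']; ring

/-- order of vanishing of `F(0,·)` is `k` -/
def HasOrd (F : ℝ × ℝ → ℝ) (k : ℕ) : Prop :=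
  ∃ V : ℝ → ℝ, ContinuousAt V 0 ∧ V 0 ≠ 0 ∧ ∀ᶠ w in 𝓝[≠] (0:ℝ), F (0, w) = w ^ k * V w

lemma ord_limit {F : ℝ × ℝ → ℝ} (hF : ContinuousAt F 0) {W : ℝ → ℝ} (hW : ContinuousAt W 0)
    (h : ∀ᶠ w in 𝓝[≠] (0:ℝ), F (0, w) = W w) : F 0 = W 0 := by
  have hl : Tendsto (fun s : ℝ => ((0:ℝ), s)) (𝓝[≠] 0) (𝓝 0) := by
    have : Continuous (fun s : ℝ => ((0:ℝ), s)) := by fun_prop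
    exact (this.tendsto 0).mono_left nhdsWithin_le_nhds
  have l1 := hF.tendsto.comp hl
  have l2 : Tendsto W (𝓝[≠] 0) (𝓝 (W 0)) := hW.tendsto.mono_left nhdsWithin_le_nhds
  exact tendsto_nhds_unique (l1.congr' h) l2

lemma taylorZ (k : ℕ) : ∀ {F : ℝ × ℝ → ℝ}, AnalyticAt ℝ F 0 → HasOrd F k →
    ∃ (c : ℕ → ℝ → ℝ) (U : ℝ × ℝ → ℝ), (∀ j, AnalyticAt ℝ (c j) 0) ∧ (∀ j, c j 0 = 0) ∧ AnalyticAt ℝ U 0 ∧ U 0 ≠ 0 ∧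
      ∀ᶠ p in 𝓝 (0 : ℝ × ℝ), F p = ∑ j ∈ Finset.range k, c j p.1 * p.2 ^ j + p.2 ^ k * U p := by
  induction k with
  | zero =>
    rintro F hF ⟨V, hV, hV0, h⟩
    refine ⟨fun _ _ => 0, F, fun _ => analyticAt_const, fun _ => rfl, hF, ?_, by simp⟩
    rw [ord_limit hF.continuousAt hV (by simpa using h)]; exact hV0
  | succ k ih =>
    rintro F hF ⟨V, hV, hV0, h⟩
    obtain ⟨U, hU, hd⟩ := divZ hF
    have F0 : F 0 = 0 := by
      rw [ord_limit hF.continuousAt (W := fun w => w ^ (k+1) * V w) ((continuous_pow _).continuousAt.mul hV) h]; simp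
    have hl : Tendsto (fun s : ℝ => ((0:ℝ), s)) (𝓝[≠] 0) (𝓝 0) := by
      have : Continuous (fun s : ℝ => ((0:ℝ), s)) := by fun_prop
      exact (this.tendsto 0).mono_left nhdsWithin_le_nhds
    have hUo : HasOrd U k := by
      refine ⟨V, hV, hV0, ?_⟩
      filter_upwards [h, hl.eventually hd, self_mem_nhdsWithin] with w h1 h2 hw
      have : F (0, 0) = 0 := F0
      simp only [this, h1, zero_add] at h2
      rw [pow_succ', mul_assoc] at h2
      exact (mul_left_cancel₀ hw h2).symm
    obtain ⟨c, W, hc, hc0, hW, hW0, hexp⟩ := ih hU hUo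
    have hFs : AnalyticAt ℝ (fun s : ℝ => F (s, 0)) 0 :=
      AnalyticAt.comp (g := F) (f := fun s : ℝ => (s, (0:ℝ))) hF (analyticAt_id.prod analyticAt_const)
    refine ⟨fun j => if j = 0 then (fun s => F (s, 0)) else c (j-1), W, fun j => ?_, fun j => ?_, hW, hW0, ?_⟩
    · dsimp only; split_ifs
      · exact hFs
      · exact hc _
    · dsimp only; split_ifs
      · exact F0
      · exact hc0 _
    · filter_upwards [hd, hexp] with p h1 h2
      rw [h1, h2, Finset.sum_range_succ']
      simp only [Nat.add_eq_zero_iff, one_ne_zero, and_false, if_false, if_true, Nat.add_sub_cancel, pow_zero, mul_one]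
      rw [mul_add, Finset.mul_sum]
      have : ∀ j ∈ Finset.range k, p.2 * (c j p.1 * p.2 ^ j) = c j p.1 * p.2 ^ (j+1) := fun j _ => by ring
      rw [Finset.sum_congr rfl this]; ring

lemma meas_version {φ : ℝ → ℝ} (h : AnalyticAt ℝ φ 0) :
    ∃ φ' : ℝ → ℝ, Measurable φ' ∧ AnalyticAt ℝ φ' 0 ∧ φ' =ᶠ[𝓝 0] φ := by
  obtain ⟨ε, hε, hb⟩ := Metric.eventually_nhds_iff_ball.mp h.eventually_analyticAt
  have hc : ContinuousOn φ (ball 0 ε) := fun x hx => (hb x hx).continuousAt.continuousWithinAt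
  classical
  refine ⟨(ball 0 ε).piecewise φ 0, hc.measurable_piecewise continuousOn_const measurableSet_ball, ?_⟩
  have he : (ball 0 ε).piecewise φ 0 =ᶠ[𝓝 0] φ := by
    filter_upwards [ball_mem_nhds (0:ℝ) hε] with x hx
    simp [Set.piecewise, hx]
  exact ⟨h.congr he.symm, he⟩

lemma iterD_pow_mul {u : ℝ → ℝ} (hu : AnalyticAt ℝ u 0) (n : ℕ) :
    (∀ i < n, iteratedDeriv i (fun z => z ^ n * u z) 0 = 0) ∧
      (u 0 ≠ 0 → iteratedDeriv n (fun z => z ^ n * u z) 0 ≠ 0) := by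
  have ha : AnalyticAt ℝ (fun z => z ^ n * u z) 0 := (analyticAt_id.pow n).mul hu
  refine ⟨?_, fun h0 => ?_⟩
  · rw [← natCast_le_analyticOrderAt_iff_iteratedDeriv_eq_zero ha, natCast_le_analyticOrderAt ha]
    exact ⟨u, hu, by simp⟩
  · refine ((analyticOrderAt_eq_nat_iff_iteratedDeriv_eq_zero ha).mp ?_).2
    rw [ha.analyticOrderAt_eq_natCast]
    exact ⟨u, hu, h0, by simp⟩

lemma iterD_expand {g u : ℝ → ℝ} {c : ℕ → ℝ} {k : ℕ} (hu : AnalyticAt ℝ u 0)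
    (hg : ∀ᶠ z in 𝓝 (0:ℝ), g z = ∑ j ∈ Finset.range (k+1), c j * z ^ j + z ^ (k+1) * u z) :
    iteratedDeriv k g 0 = k.factorial * c k := by
  rw [Filter.EventuallyEq.iteratedDeriv_eq k hg]
  have ha : AnalyticAt ℝ (fun z => z ^ (k+1) * u z) 0 := (analyticAt_id.pow _).mul hu
  rw [iteratedDeriv_fun_add (ContDiff.contDiffAt (by fun_prop)) ha.contDiffAt,
    (iterD_pow_mul hu (k+1)).1 k (Nat.lt_succ_self k), add_zero,
    iteratedDeriv_fun_sum (fun i _ => ContDiff.contDiffAt (by fun_prop))]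
  simp only [iteratedDeriv_const_mul_field, iteratedDeriv_fun_pow_zero]
  rw [Finset.sum_eq_single k]
  · simp [mul_comm]
  · intro b _ hb; simp [hb.symm]
  · simp

def Dk (k : ℕ) (F : ℝ × ℝ → ℝ) (p : ℝ × ℝ) : ℝ := iteratedDeriv k (fun z => F (p.1, z)) p.2

lemma Dk_succ {k : ℕ} {F : ℝ × ℝ → ℝ} {p : ℝ × ℝ} (h : DifferentiableAt ℝ (Dk k F) p) :
    Dk (k+1) F p = fderiv ℝ (Dk k F) p (0, 1) := by
  have e1 : HasDerivAt (fun z : ℝ => (p.1, z)) (0, 1) p.2 :=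
    (hasDerivAt_const p.2 p.1).prodMk (hasDerivAt_id p.2)
  have e2 := HasFDerivAt.comp_hasDerivAt (f := fun z : ℝ => (p.1, z)) (x := p.2) (l := Dk k F) h.hasFDerivAt e1
  rw [← e2.deriv]
  unfold Dk
  rw [iteratedDeriv_succ]
  rfl

lemma Dk_analytic (k : ℕ) {F : ℝ × ℝ → ℝ} {q : ℝ × ℝ} (hF : AnalyticAt ℝ F q) : AnalyticAt ℝ (Dk k F) q := by
  induction k with
  | zero => exact hF.congr (Eventually.of_forall fun p => by simp [Dk])
  | succ k ih =>
    have h1 : AnalyticAt ℝ (fun p => fderiv ℝ (Dk k F) p (0, 1)) q :=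
      ((ContinuousLinearMap.apply ℝ ℝ ((0, 1) : ℝ × ℝ)).analyticAt _).comp ih.fderiv
    refine h1.congr ?_
    filter_upwards [ih.eventually_analyticAt] with p hp
    exact (Dk_succ hp.differentiableAt).symm

lemma implicit_an {G : ℝ × ℝ → ℝ} (hG : AnalyticAt ℝ G 0) (h0 : G 0 = 0) (h1 : fderiv ℝ G 0 (0, 1) ≠ 0) :
    ∃ φ : ℝ → ℝ, Measurable φ ∧ AnalyticAt ℝ φ 0 ∧ φ 0 = 0 ∧ ∀ᶠ s in 𝓝 (0:ℝ), G (s, φ s) = 0 := by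
  have cd : ContDiffAt ℝ (⊤ : WithTop ℕ∞) G ((0:ℝ),(0:ℝ)) := hG.contDiffAt
  have inv : (fderiv ℝ G ((0:ℝ),(0:ℝ)) ∘L .inr ℝ ℝ ℝ).IsInvertible := by
    refine ⟨ContinuousLinearEquiv.unitsEquivAut ℝ (Units.mk0 _ h1), ?_⟩
    ext
    simp
    rfl
  have hφ := cd.contDiffAt_implicitFunction (by simp) inv
  obtain ⟨φ', m, a, e⟩ := meas_version hφ.analyticAt
  refine ⟨φ', m, a, ?_, ?_⟩
  · rw [e.eq_of_nhds]; exact cd.implicitFunction_apply_self (by simp) inv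
  · filter_upwards [e, cd.eventually_apply_implicitFunction (by simp) inv] with s h2 h3
    rw [h2]
    exact h3.trans h0

lemma HasOrd_shift {F : ℝ × ℝ → ℝ} {k : ℕ} {φ : ℝ → ℝ} (h0 : φ 0 = 0) (h : HasOrd F k) :
    HasOrd (fun p => F (p.1, p.2 + φ p.1)) k := by
  simpa [HasOrd, h0] using h

lemma an_shift {F : ℝ × ℝ → ℝ} {φ : ℝ → ℝ} (hF : AnalyticAt ℝ F 0) (hφ : AnalyticAt ℝ φ 0) (h0 : φ 0 = 0) :
    AnalyticAt ℝ (fun p : ℝ × ℝ => F (p.1, p.2 + φ p.1)) 0 := by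
  refine AnalyticAt.fun_comp (g := F) (f := fun p : ℝ × ℝ => (p.1, p.2 + φ p.1)) ?_ ?_
  · have e : (((0 : ℝ × ℝ).1, (0 : ℝ × ℝ).2 + φ (0 : ℝ × ℝ).1) : ℝ × ℝ) = 0 := by simp [h0]
    rw [e]; exact hF
  · exact analyticAt_fst.prod (analyticAt_snd.add (AnalyticAt.fun_comp (g := φ) (f := fun p : ℝ × ℝ => p.1) (by simpa using hφ) analyticAt_fst))

lemma tsch {F : ℝ × ℝ → ℝ} {k : ℕ} (hF : AnalyticAt ℝ F 0) (ho : HasOrd F (k+1)) :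
    ∃ φ : ℝ → ℝ, Measurable φ ∧ AnalyticAt ℝ φ 0 ∧ φ 0 = 0 ∧
      ∀ (c : ℕ → ℝ → ℝ) (U : ℝ × ℝ → ℝ), AnalyticAt ℝ U 0 →
        (∀ᶠ p in 𝓝 (0 : ℝ × ℝ), F (p.1, p.2 + φ p.1) = ∑ j ∈ Finset.range (k+1), c j p.1 * p.2 ^ j + p.2 ^ (k+1) * U p) →
        ∀ᶠ s in 𝓝 (0:ℝ), c k s = 0 := by
  obtain ⟨c, U, hc, hc0, hU, hU0, hexp⟩ := taylorZ (k+1) hF ho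
  have hi : Continuous (fun z : ℝ => ((0:ℝ), z)) := by fun_prop
  have hexp0 : ∀ᶠ z in 𝓝 (0:ℝ), F (0, z) = z ^ (k+1) * U (0, z) := by
    filter_upwards [(hi.tendsto 0).eventually hexp] with z hz
    simpa [hc0] using hz
  have hU' : AnalyticAt ℝ (fun z : ℝ => U (0, z)) 0 :=
    AnalyticAt.fun_comp (g := U) (f := fun z : ℝ => ((0:ℝ), z)) hU (analyticAt_const.prod analyticAt_id)
  have hD := Dk_analytic k hF
  have D0 : Dk k F 0 = 0 := by
    show iteratedDeriv k (fun z => F (0, z)) 0 = 0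
    rw [Filter.EventuallyEq.iteratedDeriv_eq k hexp0]
    exact (iterD_pow_mul hU' (k+1)).1 k (Nat.lt_succ_self k)
  have D1 : fderiv ℝ (Dk k F) 0 (0, 1) ≠ 0 := by
    rw [← Dk_succ hD.differentiableAt]
    show iteratedDeriv (k+1) (fun z => F (0, z)) 0 ≠ 0
    rw [Filter.EventuallyEq.iteratedDeriv_eq (k+1) hexp0]
    exact (iterD_pow_mul hU' (k+1)).2 hU0
  obtain ⟨φ, m, a, p0, hφ⟩ := implicit_an hD D0 D1
  refine ⟨φ, m, a, p0, fun c U hU hexp => ?_⟩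
  have hj : Continuous (fun s : ℝ => (s, (0:ℝ))) := by fun_prop
  filter_upwards [hφ, (hj.tendsto 0).eventually (eventually_eventually_nhds.mpr hexp), (hj.tendsto 0).eventually hU.eventually_analyticAt] with s h1 h2 h3
  have hs : Continuous (fun z : ℝ => (s, z)) := by fun_prop
  have h4 := (hs.tendsto 0).eventually h2
  have h5 : AnalyticAt ℝ (fun z : ℝ => U (s, z)) 0 :=
    AnalyticAt.fun_comp (g := U) (f := fun z : ℝ => (s, z)) h3 (analyticAt_const.prod analyticAt_id)
  have h6 := iterD_expand (g := fun z => F (s, z + φ s)) (c := fun j => c j s) h5 h4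
  have h7 : iteratedDeriv k (fun z => F (s, z + φ s)) 0 = iteratedDeriv k (fun z => F (s, z)) (0 + φ s) := by
    have := iteratedDeriv_comp_add_const k (fun z => F (s, z)) (φ s)
    exact congrFun this 0
  rw [h7, zero_add] at h6
  have h8 : iteratedDeriv k (fun z => F (s, z)) (φ s) = 0 := h1
  rw [h8] at h6
  have := (mul_eq_zero.mp h6.symm).resolve_left (by exact_mod_cast Nat.factorial_ne_zero k)
  exact this

lemma prod_logder {n : ℕ} {γ : Fin n → ℝ} {g : Fin n → ℝ → ℝ} {θ C : ℝ} (hC : 0 ≤ C)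
    (h : ∀ i, g i θ ≠ 0 ∧ ∃ D, HasDerivAt (g i) D θ ∧ |D| ≤ C * |g i θ|) :
    0 < ∏ i, |g i θ| ^ γ i ∧ ∃ D, HasDerivAt (fun θ => ∏ i, |g i θ| ^ γ i) D θ ∧
      |D| ≤ (C * ∑ i, |γ i|) * ∏ i, |g i θ| ^ γ i := by
  choose h0 D hD hDb using h
  have hev : ∀ᶠ x in 𝓝 θ, ∀ i, g i x ≠ 0 :=
    eventually_all.mpr fun i => (hD i).continuousAt.eventually_ne (h0 i)
  have hform : ∀ x, (∀ i, g i x ≠ 0) → ∏ i, |g i x| ^ γ i = exp (∑ i, log (g i x) * γ i) := by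
    intro x hx
    rw [exp_sum]
    exact Finset.prod_congr rfl fun i _ => by rw [rpow_def_of_pos (abs_pos.mpr (hx i)), log_abs]
  have hd : HasDerivAt (fun x => exp (∑ i, log (g i x) * γ i))
      (exp (∑ i, log (g i θ) * γ i) * ∑ i, D i / g i θ * γ i) θ :=
    (HasDerivAt.fun_sum fun i _ => ((hD i).log (h0 i)).mul_const (γ i)).exp
  have hpos : 0 < ∏ i, |g i θ| ^ γ i := Finset.prod_pos fun i _ => rpow_pos_of_pos (abs_pos.mpr (h0 i)) _
  refine ⟨hpos, _, hd.congr_of_eventuallyEq (hev.mono fun x hx => hform x hx), ?_⟩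
  rw [← hform θ h0, abs_mul, abs_of_pos hpos, mul_comm]
  refine mul_le_mul_of_nonneg_right ?_ hpos.le
  rw [Finset.mul_sum]
  refine (Finset.abs_sum_le_sum_abs _ _).trans (Finset.sum_le_sum fun i _ => ?_)
  rw [abs_mul, abs_div]
  refine mul_le_mul_of_nonneg_right ?_ (abs_nonneg _)
  rw [div_le_iff₀ (abs_pos.mpr (h0 i))]
  exact hDb i

/-- basic data for a nonvanishing analytic function near `0` -/
lemma unit_bounds {E : Type*} [NormedAddCommGroup E] [NormedSpace ℝ E] {Hh : E → ℝ} (hH : AnalyticAt ℝ Hh 0) (h0 : Hh 0 ≠ 0) :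
    ∃ ρ > 0, ∃ C > 0, ∀ x : E, ‖x‖ < ρ → Hh x ≠ 0 ∧ DifferentiableAt ℝ Hh x ∧ ∀ v, |fderiv ℝ Hh x v| ≤ C * |Hh x| * ‖v‖ := by
  have e1 := hH.eventually_analyticAt
  have e2 : ∀ᶠ x in 𝓝 (0:E), |Hh 0| / 2 < |Hh x| :=
    hH.continuousAt.abs.eventually_const_lt (half_lt_self (abs_pos.mpr h0))
  have e3 : ∀ᶠ x in 𝓝 (0:E), ‖fderiv ℝ Hh x‖ < ‖fderiv ℝ Hh 0‖ + 1 :=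
    hH.fderiv.continuousAt.norm.eventually_lt_const (by simp)
  obtain ⟨ρ, hρ, hb⟩ := Metric.eventually_nhds_iff.mp (e1.and (e2.and e3))
  have hp : 0 < |Hh 0| := abs_pos.mpr h0
  refine ⟨ρ, hρ, (‖fderiv ℝ Hh 0‖ + 1) / (|Hh 0| / 2), by positivity, fun x hx => ?_⟩
  obtain ⟨a, b, c⟩ := hb (by rwa [dist_zero_right])
  refine ⟨fun h => ?_, a.differentiableAt, fun v => ?_⟩
  · rw [h, abs_zero] at b; linarith
  · refine ((fderiv ℝ Hh x).le_opNorm v).trans (mul_le_mul_of_nonneg_right ?_ (norm_nonneg _))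
    rw [div_mul_eq_mul_div, le_div_iff₀ (by positivity)]
    exact mul_le_mul c.le b.le (by positivity) (by positivity)

lemma exp_half_mul (a : ℕ) (θ : ℝ) : exp (((a:ℝ) + 1/2) * θ) = exp θ ^ a * exp (θ/2) := by
  rw [← exp_nat_mul, ← exp_add]; congr 1; ring

/-- logarithmic derivative along leaf curves -/
lemma leafF {f : ℝ × ℝ → ℝ} {N a p d k : ℕ} {ω : ℝ} {h : ℝ → ℝ} {Hh : ℝ × ℝ × ℝ → ℝ}
    (hω : 0 ≤ ω) (hH : AnalyticAt ℝ Hh 0) (h0 : Hh 0 ≠ 0)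
    (hf : ∀ᶠ q in 𝓝 (0 : ℝ × ℝ), 0 < q.1 → q.2 ≠ 0 →
      f (q.1 ^ N, h q.1 + q.1 ^ a * q.2) = q.1 ^ d * q.2 ^ k * Hh (q.1, q.2, ω * (q.1 ^ p / q.2))) :
    ∃ ρ > 0, ∃ C > 0, ∀ ρ' ≤ ρ, ∀ τ w θ : ℝ, (τ = 1 ∨ τ = -1) → 0 < w → exp θ < ρ' → w * exp (θ/2) < ρ' →
      ω * exp θ ^ p < ρ' * (w * exp (θ/2)) →
      f (Psi N (fun θ => h (exp θ)) ((a:ℝ) + 1/2) τ (θ, w)) ≠ 0 ∧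
      ∃ D, HasDerivAt (fun θ => f (Psi N (fun θ => h (exp θ)) ((a:ℝ) + 1/2) τ (θ, w))) D θ ∧
        |D| ≤ C * |f (Psi N (fun θ => h (exp θ)) ((a:ℝ) + 1/2) τ (θ, w))| := by
  obtain ⟨ρ1, hρ1, C, hC, hb⟩ := unit_bounds hH h0
  obtain ⟨ρ2, hρ2, hf2⟩ := Metric.eventually_nhds_iff.mp hf
  have key : ∀ τ w θ : ℝ, (τ = 1 ∨ τ = -1) → 0 < w → exp θ < ρ2 → w * exp (θ/2) < ρ2 →
      f (Psi N (fun θ => h (exp θ)) ((a:ℝ) + 1/2) τ (θ, w)) =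
        exp θ ^ d * (τ * w * exp (θ/2)) ^ k * Hh (exp θ, τ * w * exp (θ/2), ω * (exp θ ^ p / (τ * w * exp (θ/2)))) := by
    intro τ w θ hτ hw h1 h2
    have aτ : |τ| = 1 := by rcases hτ with h|h <;> simp [h]
    have hz : τ * w * exp (θ/2) ≠ 0 := by
      have : τ ≠ 0 := by rcases hτ with h|h <;> simp [h]
      positivity
    rw [← hf2 (y := (exp θ, τ * w * exp (θ/2))) ?_ (exp_pos θ) hz]
    · unfold Psi
      dsimp only
      rw [exp_half_mul, exp_nat_mul]
      congr 2; ring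
    · rw [dist_zero_right, Prod.norm_mk, norm_mul, norm_mul, norm_eq_abs τ, aτ, one_mul, norm_of_nonneg (exp_pos _).le, norm_of_nonneg hw.le,
        norm_of_nonneg (exp_pos _).le]
      exact max_lt h1 h2
  refine ⟨min ρ1 ρ2, lt_min hρ1 hρ2, (d + k/2 + C * (p + 1) * (ρ1+1)), by positivity, ?_⟩
  intro ρ' hρ' τ w θ hτ hw h1 h2 h3
  have aτ : |τ| = 1 := by rcases hτ with h|h <;> simp [h]
  have τ0 : τ ≠ 0 := by rcases hτ with h|h <;> simp [h]
  have l1 := hρ'.trans (min_le_left _ _)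
  have l2 := hρ'.trans (min_le_right _ _)
  have hz : ∀ θ, τ * w * exp (θ/2) ≠ 0 := fun θ => by positivity
  have hzn : |τ * w * exp (θ/2)| = w * exp (θ/2) := by
    rw [abs_mul, abs_mul, aτ, one_mul, abs_of_pos hw, abs_of_pos (exp_pos _)]
  have hT : |ω * (exp θ ^ p / (τ * w * exp (θ/2)))| < ρ' := by
    rw [abs_mul, abs_div, hzn, abs_of_nonneg hω, abs_of_pos (by positivity), ← mul_div_assoc, div_lt_iff₀ (by positivity)]
    exact h3
  have hev : ∀ᶠ x in 𝓝 θ, f (Psi N (fun θ => h (exp θ)) ((a:ℝ) + 1/2) τ (x, w)) =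
        exp x ^ d * (τ * w * exp (x/2)) ^ k * Hh (exp x, τ * w * exp (x/2), ω * (exp x ^ p / (τ * w * exp (x/2)))) := by
    have c1 : Continuous (fun x : ℝ => exp x) := continuous_exp
    have c2 : Continuous (fun x : ℝ => w * exp (x/2)) := by fun_prop
    filter_upwards [c1.continuousAt.eventually_lt_const (h1.trans_le l2), c2.continuousAt.eventually_lt_const (h2.trans_le l2)] with x hx1 hx2
    exact key τ w x hτ hw hx1 hx2
  have hx : ‖((exp θ, τ * w * exp (θ/2), ω * (exp θ ^ p / (τ * w * exp (θ/2)))) : ℝ × ℝ × ℝ)‖ < ρ' := by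
    rw [Prod.norm_mk, Prod.norm_mk, norm_eq_abs, norm_eq_abs, norm_eq_abs, hzn, abs_of_pos (exp_pos _)]
    exact max_lt h1 (max_lt h2 hT)
  obtain ⟨b1, b2, b3⟩ := hb _ (hx.trans_le l1)
  have hE : HasDerivAt (fun x : ℝ => exp (x/2)) (exp (θ/2) * (1/2)) θ := ((hasDerivAt_id θ).div_const 2).exp
  have hZ : HasDerivAt (fun x => τ * w * exp (x/2)) ((1/2) * (τ * w * exp (θ/2))) θ :=
    (hE.const_mul (τ * w)).congr_deriv (by ring)
  have hXp : ∀ m : ℕ, HasDerivAt (fun x => exp x ^ m) (m * exp θ ^ m) θ := by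
    intro m
    simp_rw [← exp_nat_mul]
    have := ((hasDerivAt_id θ).const_mul (m:ℝ)).exp
    exact this.congr_deriv (by simp; ring)
  have hZk : HasDerivAt (fun x => (τ * w * exp (x/2)) ^ k) ((k/2) * (τ * w * exp (θ/2)) ^ k) θ := by
    refine (hZ.pow k).congr_deriv ?_
    rcases Nat.eq_zero_or_pos k with rfl | hk
    · simp
    · obtain ⟨k, rfl⟩ : ∃ k', k = k' + 1 := ⟨k - 1, by omega⟩
      rw [Nat.add_sub_cancel, pow_succ]; ring
  have hTd : HasDerivAt (fun x => ω * (exp x ^ p / (τ * w * exp (x/2)))) (((p:ℝ) - 1/2) * (ω * (exp θ ^ p / (τ * w * exp (θ/2))))) θ := by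
    refine (((hXp p).div hZ (hz θ)).const_mul ω).congr_deriv ?_
    have := hz θ
    field_simp
  have hvec := (Real.hasDerivAt_exp θ).prodMk (hZ.prodMk hTd)
  have hHd := HasFDerivAt.comp_hasDerivAt (x := θ) (f := fun x => ((exp x, τ * w * exp (x/2), ω * (exp x ^ p / (τ * w * exp (x/2)))) : ℝ × ℝ × ℝ)) (l := Hh) b2.hasFDerivAt hvec
  have hall := ((hXp d).mul hZk).mul hHd
  have hbd := b3 (exp θ, (1/2) * (τ * w * exp (θ/2)), ((p:ℝ) - 1/2) * (ω * (exp θ ^ p / (τ * w * exp (θ/2)))))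
  have hvn : ‖((exp θ, (1/2) * (τ * w * exp (θ/2)), ((p:ℝ) - 1/2) * (ω * (exp θ ^ p / (τ * w * exp (θ/2))))) : ℝ × ℝ × ℝ)‖ ≤ (p+1) * (ρ1+1) := by
    have hp0 : (0:ℝ) ≤ p := Nat.cast_nonneg p
    have hpρ : 0 ≤ (p:ℝ) * ρ1 := by positivity
    rw [Prod.norm_mk, Prod.norm_mk, norm_eq_abs, norm_eq_abs, norm_eq_abs, abs_mul, hzn, abs_of_pos (exp_pos _)]
    refine max_le (by nlinarith) (max_le (by rw [abs_of_pos (by norm_num : (0:ℝ) < 1/2)]; nlinarith) ?_)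
    rw [abs_mul]
    refine mul_le_mul (abs_le.mpr ⟨by linarith, by linarith⟩) (by linarith) (abs_nonneg _) (by linarith)
  have hev0 := hev.self_of_nhds
  refine ⟨?_, _, hall.congr_of_eventuallyEq hev, ?_⟩
  · rw [hev0]
    exact mul_ne_zero (mul_ne_zero (by positivity) (pow_ne_zero _ (hz θ))) b1
  · rw [hev0]
    simp only [Function.comp, Pi.mul_apply] at *
    generalize Hh (exp θ, τ * w * exp (θ/2), ω * (exp θ ^ p / (τ * w * exp (θ/2)))) = X at *
    generalize (fderiv ℝ Hh (exp θ, τ * w * exp (θ/2), ω * (exp θ ^ p / (τ * w * exp (θ/2))))) (exp θ, (1/2) * (τ * w * exp (θ/2)), ((p:ℝ) - 1/2) * (ω * (exp θ ^ p / (τ * w * exp (θ/2))))) = Y at *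
    generalize (τ * w * exp (θ/2)) ^ k = Zk at *
    have e1 : (↑d * exp θ ^ d * Zk + exp θ ^ d * (↑k / 2 * Zk)) * X + exp θ ^ d * Zk * Y = (d + k/2) * (exp θ ^ d * Zk * X) + exp θ ^ d * Zk * Y := by ring
    rw [e1]
    refine (abs_add_le _ _).trans ?_
    rw [add_mul _ (C * (p + 1) * (ρ1 + 1))]
    refine add_le_add ?_ ?_
    · rw [abs_mul, abs_of_nonneg (by positivity : (0:ℝ) ≤ d + k/2)]
    · rw [abs_mul, abs_mul _ X]
      have : |Y| ≤ C * |X| * ((p+1) * (ρ1+1)) := hbd.trans (mul_le_mul_of_nonneg_left hvn (by positivity))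
      calc |exp θ ^ d * Zk| * |Y| ≤ |exp θ ^ d * Zk| * (C * |X| * ((p+1) * (ρ1+1))) := mul_le_mul_of_nonneg_left this (abs_nonneg _)
        _ = _ := by ring

/-- conditions on the curves `y = h(s) + τ s^(a+1/2) w` -/
def YC (N a : ℕ) (h : ℝ → ℝ) (τ : ℝ) : Prop :=
  ∃ H1 H2 : ℝ → ℝ, ∃ σ : ℝ, (σ = 1 ∨ σ = -1) ∧ ∃ C1 > (0:ℝ), ∃ c1 > (0:ℝ), ∃ ρ > (0:ℝ), ∀ θ w : ℝ,
    0 < w → exp θ < ρ → w * exp (θ/2) < ρ →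
    HasDerivAt (fun θ => h (exp θ)) (H1 θ) θ ∧ HasDerivAt H1 (H2 θ) θ ∧
    0 < σ * (h (exp θ) + τ * exp (((a:ℝ)+1/2) * θ) * w) ∧
    |H1 θ + τ * (((a:ℝ)+1/2) * exp (((a:ℝ)+1/2) * θ)) * w| ≤ C1 * (σ * (h (exp θ) + τ * exp (((a:ℝ)+1/2) * θ) * w)) ∧
    |H2 θ + τ * (((a:ℝ)+1/2) * (((a:ℝ)+1/2) * exp (((a:ℝ)+1/2) * θ))) * w| ≤
      C1 * (σ * (h (exp θ) + τ * exp (((a:ℝ)+1/2) * θ) * w)) ∧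
    c1 * (σ * (h (exp θ) + τ * exp (((a:ℝ)+1/2) * θ) * w)) ≤
      σ * ((H2 θ + τ * (((a:ℝ)+1/2) * (((a:ℝ)+1/2) * exp (((a:ℝ)+1/2) * θ))) * w)
        - N * (H1 θ + τ * (((a:ℝ)+1/2) * exp (((a:ℝ)+1/2) * θ)) * w)) ∧
    σ * (h (exp θ) + τ * exp (((a:ℝ)+1/2) * θ) * w) ≤ C1 * exp (N * θ) ∧
    0 ≤ σ * (H1 θ + τ * (((a:ℝ)+1/2) * exp (((a:ℝ)+1/2) * θ)) * w)

lemma YC_A {N a : ℕ} (hN : 0 < N) (hNa : N ≤ a) {τ : ℝ} (hτ : τ = 1 ∨ τ = -1) : YC N a (fun _ => 0) τ := by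
  have hN1 : (1:ℝ) ≤ N := by exact_mod_cast hN
  have hNa1 : (N:ℝ) ≤ a := by exact_mod_cast hNa
  have hτ2 : τ * τ = 1 := by rcases hτ with h|h <;> simp [h]
  have aτ : |τ| = 1 := by rcases hτ with h|h <;> simp [h]
  refine ⟨fun _ => 0, fun _ => 0, τ, hτ, ((a:ℝ)+1/2)^2, by positivity, 1/2, by norm_num, 1, one_pos, ?_⟩
  intro θ w hw h1 h2
  have hE : exp (((a:ℝ)+1/2) * θ) * w ≤ exp (N * θ) := by
    rw [exp_half_mul, exp_nat_mul]
    calc exp θ ^ a * exp (θ/2) * w = exp θ ^ a * (w * exp (θ/2)) := by ring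
      _ ≤ exp θ ^ a * 1 := mul_le_mul_of_nonneg_left h2.le (by positivity)
      _ ≤ exp θ ^ N := by rw [mul_one]; exact pow_le_pow_of_le_one (exp_pos _).le h1.le hNa
  have hE0 : 0 < exp (((a:ℝ)+1/2) * θ) * w := by positivity
  generalize exp (((a:ℝ)+1/2) * θ) = E at *

  have hX : (0:ℝ) < exp (N * θ) := exp_pos _
  generalize exp (N * θ) = X at *
  have e1 : ∀ x : ℝ, τ * (0 + τ * E * w) = E * w := fun x => by linear_combination (E * w) * hτ2
  have e2 : (3/2:ℝ) ≤ (a:ℝ)+1/2 := by linarith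
  have e3 : (N:ℝ) + 1/2 ≤ (a:ℝ)+1/2 := by linarith
  generalize (a:ℝ)+1/2 = e at *
  generalize hP : E * w = P at *
  have i1 : |0 + τ * (e * E) * w| = e * P := by
    rw [show 0 + τ * (e * E) * w = τ * (e * P) by rw [← hP]; ring, abs_mul, aτ, one_mul, abs_of_nonneg (by positivity)]
  have i2 : |0 + τ * (e * (e * E)) * w| = e^2 * P := by
    rw [show 0 + τ * (e * (e * E)) * w = τ * (e^2 * P) by rw [← hP]; ring, abs_mul, aτ, one_mul, abs_of_nonneg (by positivity)]
  have i3 : τ * ((0 + τ * (e * (e * E)) * w) - N * (0 + τ * (e * E) * w)) = (e * (e - N)) * P := by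
    rw [← hP]; linear_combination ((e * (e - N)) * (E * w)) * hτ2
  have i4 : τ * (0 + τ * (e * E) * w) = e * P := by
    rw [← hP]; linear_combination (e * (E * w)) * hτ2
  rw [e1 0, i1, i2, i3, i4]
  have he2 : e ≤ e^2 := by nlinarith
  refine ⟨hasDerivAt_const _ _, hasDerivAt_const _ _, hE0, mul_le_mul_of_nonneg_right he2 hE0.le, le_rfl,
    mul_le_mul_of_nonneg_right (by nlinarith) hE0.le, hE.trans (by nlinarith), by positivity⟩

/-- type B curves -/
def TB (N a : ℕ) (h : ℝ → ℝ) : Prop :=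
  ∃ m : ℕ, ∃ hh : ℝ → ℝ, N < m ∧ m ≤ a ∧ AnalyticAt ℝ hh 0 ∧ hh 0 ≠ 0 ∧ ∀ᶠ s in 𝓝 (0:ℝ), h s = s ^ m * hh s

lemma euler_pow {h hh : ℝ → ℝ} {m : ℕ} (hA : AnalyticAt ℝ hh 0) (hh0 : ∀ᶠ s in 𝓝 (0:ℝ), h s = s ^ m * hh s) :
    ∃ hh1, AnalyticAt ℝ hh1 0 ∧ hh1 0 = m * hh 0 ∧ (∀ᶠ s in 𝓝 (0:ℝ), s * deriv h s = s ^ m * hh1 s) ∧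
      ∀ᶠ s in 𝓝 (0:ℝ), HasDerivAt h (deriv h s) s := by
  have key : ∀ᶠ s in 𝓝 (0:ℝ), HasDerivAt h (m * s ^ (m-1) * hh s + s ^ m * deriv hh s) s := by
    filter_upwards [hh0.eventually_nhds, hA.eventually_analyticAt] with s h1 h2
    have := (hasDerivAt_pow m s).mul h2.differentiableAt.hasDerivAt
    exact this.congr_of_eventuallyEq h1
  refine ⟨fun s => m * hh s + s * deriv hh s, (analyticAt_const.mul hA).add (analyticAt_id.mul hA.deriv), by simp, ?_, ?_⟩
  · filter_upwards [key] with s hs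
    rw [hs.deriv]
    rcases Nat.eq_zero_or_pos m with rfl | hm
    · simp
    · obtain ⟨k, rfl⟩ : ∃ k, m = k + 1 := ⟨m - 1, by omega⟩
      rw [Nat.add_sub_cancel, pow_succ]; ring
  · filter_upwards [key] with s hs
    rwa [hs.deriv]

lemma YC_num {X Z l m N K y0 y1 y2 : ℝ} (hX : 0 < X) (hl : 0 < l) (hN0 : 0 ≤ N) (hN1 : N + 1 ≤ m)
    (hK : 8 * K ≤ l) (hKN : 8 * (K * (N + 1)) ≤ l) (hXZ : X ≤ Z)
    (h0 : -(2*K) ≤ y0 - l ∧ y0 - l ≤ 2*K) (h1 : -(2*K) ≤ y1 - m * l ∧ y1 - m * l ≤ 2*K)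
    (h2 : -(2*K) ≤ y2 - m^2 * l ∧ y2 - m^2 * l ≤ 2*K) :
    0 < X * y0 ∧ X * |y1| ≤ (2 * (m^2 + 1) + 3/2 * l) * (X * y0) ∧ X * |y2| ≤ (2 * (m^2 + 1) + 3/2 * l) * (X * y0) ∧
    1/2 * (X * y0) ≤ X * y2 - N * (X * y1) ∧ X * y0 ≤ (2 * (m^2 + 1) + 3/2 * l) * Z ∧ 0 ≤ X * y1 := by
  have hm : 1 ≤ m := by linarith
  have hml : l ≤ m * l := by nlinarith
  have hml2 : m * l ≤ m^2 * l := by nlinarith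
  have y0p : 3/4 * l ≤ y0 := by linarith
  have y0q : y0 ≤ 5/4 * l := by linarith
  have y1p : 0 ≤ y1 := by linarith
  have y2p : 0 ≤ y2 := by linarith
  have A : (m^2 + 1) * l ≤ (2 * (m^2 + 1) + 3/2 * l) * y0 := by
    have : 2 * (m^2 + 1) * (3/4 * l) ≤ 2 * (m^2 + 1) * y0 := mul_le_mul_of_nonneg_left y0p (by positivity)
    have : 0 ≤ l * y0 := mul_nonneg hl.le (by linarith)
    have : 0 ≤ m^2 * l := by positivity
    linarith
  have c : N * y1 ≤ N * (m * l) + 2 * (K * N) := by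
    have := mul_le_mul_of_nonneg_left (by linarith [h1.2] : y1 ≤ m * l + 2 * K) hN0
    linarith
  have c2 : (N + 1) * (m * l) ≤ m * (m * l) := mul_le_mul_of_nonneg_right hN1 (by positivity)
  refine ⟨mul_pos hX (by linarith), ?_, ?_, ?_, ?_, mul_nonneg hX.le y1p⟩
  · rw [abs_of_nonneg y1p, mul_left_comm]
    exact mul_le_mul_of_nonneg_left (by linarith) hX.le
  · rw [abs_of_nonneg y2p, mul_left_comm]
    exact mul_le_mul_of_nonneg_left (by linarith) hX.le
  · rw [mul_left_comm, mul_left_comm N, ← mul_sub]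
    exact mul_le_mul_of_nonneg_left (by linarith) hX.le
  · calc X * y0 ≤ Z * (3/2 * l) := mul_le_mul hXZ (by linarith) (by linarith) (by linarith)
      _ ≤ _ := by
        have : 0 ≤ (2 * (m^2 + 1)) * Z := mul_nonneg (by positivity) (by linarith)
        linarith

set_option maxHeartbeats 600000 in
lemma YC_B {N a : ℕ} {h : ℝ → ℝ} (hTB : TB N a h) {τ : ℝ} (hτ : τ = 1 ∨ τ = -1) : YC N a h τ := by
  obtain ⟨m, hh, hNm, hma, hA, hl, hh0⟩ := hTB
  obtain ⟨hh1, hA1, hl1, hh1e, hd1⟩ := euler_pow hA hh0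
  obtain ⟨hh2, hA2, hl2, hh2e, hd2⟩ := euler_pow (h := fun s => s * deriv h s) hA1 hh1e
  have aτ : |τ| = 1 := by rcases hτ with h|h <;> simp [h]
  obtain ⟨σ, hσ, hσl⟩ : ∃ σ : ℝ, (σ = 1 ∨ σ = -1) ∧ σ * hh 0 = |hh 0| := by
    rcases lt_or_gt_of_ne hl with h | h
    · exact ⟨-1, Or.inr rfl, by rw [abs_of_neg h]; ring⟩
    · exact ⟨1, Or.inl rfl, by rw [abs_of_pos h]; ring⟩
  have aσ : |σ| = 1 := by rcases hσ with h|h <;> simp [h]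
  have hl0 : 0 < |hh 0| := abs_pos.mpr hl
  set l := |hh 0| with hldef
  have hN1 : (N:ℝ) + 1 ≤ m := by exact_mod_cast hNm
  have hN0 : (0:ℝ) ≤ N := Nat.cast_nonneg _
  have hma1 : (m:ℝ) ≤ a := by exact_mod_cast hma
  set κ : ℝ := 1 / (8 * (N + 1)) with hκ
  have hκ0 : 0 < κ := by positivity
  have hκN : κ * (N + 1) = 1/8 := by rw [hκ]; field_simp
  have hκ8 : κ ≤ 1/8 := by nlinarith
  set e : ℝ := (a:ℝ) + 1/2 with he
  have he1 : 1 ≤ e := by linarith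
  have ev : ∀ᶠ s in 𝓝 (0:ℝ), |hh s - hh 0| < κ * l ∧ |hh1 s - hh1 0| < κ * l ∧ |hh2 s - hh2 0| < κ * l := by
    have g : ∀ F : ℝ → ℝ, AnalyticAt ℝ F 0 → ∀ᶠ s in 𝓝 (0:ℝ), |F s - F 0| < κ * l := by
      intro F hF
      have := Metric.tendsto_nhds.mp hF.continuousAt (κ * l) (by positivity)
      simpa [Real.dist_eq] using this
    exact (g _ hA).and ((g _ hA1).and (g _ hA2))
  obtain ⟨ρ, hρ, hall⟩ := Metric.eventually_nhds_iff.mp (ev.and (hh0.and (hh1e.and (hd1.and (hh2e.and hd2)))))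
  refine ⟨fun θ => exp θ * deriv h (exp θ), fun θ => exp θ * deriv (fun s => s * deriv h s) (exp θ), σ, hσ,
    2 * (m^2 + 1) + 3 / 2 * l, by positivity, 1/2, by norm_num, min ρ (min 1 (κ * l / e^2)), by positivity, ?_⟩
  intro θ w hw h1 h2
  have s0 := exp_pos θ
  have hs1 : exp θ < 1 := h1.trans_le ((min_le_right _ _).trans (min_le_left _ _))
  have hη : w * exp (θ/2) ≤ κ * l / e^2 := (h2.trans_le ((min_le_right _ _).trans (min_le_right _ _))).le
  obtain ⟨⟨b0, b1, b2⟩, c0, c1, d1, c2, d2⟩ := @hall (exp θ) (by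
    rw [dist_zero_right, norm_of_nonneg s0.le]; exact h1.trans_le (min_le_left _ _))
  have D1 : HasDerivAt (fun θ => h (exp θ)) (exp θ * deriv h (exp θ)) θ :=
    (HasDerivAt.comp θ d1 (Real.hasDerivAt_exp θ)).congr_deriv (by ring)
  have D2 : HasDerivAt (fun θ => exp θ * deriv h (exp θ)) (exp θ * deriv (fun s => s * deriv h s) (exp θ)) θ :=
    (HasDerivAt.comp θ d2 (Real.hasDerivAt_exp θ)).congr_deriv (by ring)
  refine ⟨D1, D2, ?_⟩
  dsimp only at c2 ⊢
  rw [c0, c1, c2, exp_half_mul, ← he]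
  have hη0 : 0 < w * exp (θ/2) := by positivity
  have hpow : exp θ ^ a = exp θ ^ m * exp θ ^ (a - m) := by rw [← pow_add]; congr 1; omega
  have hq1 : exp θ ^ (a - m) ≤ 1 := pow_le_one₀ s0.le hs1.le
  have hq0 : 0 < exp θ ^ (a - m) := by positivity
  have hXN : exp θ ^ m ≤ exp (N * θ) := by
    rw [exp_nat_mul]; exact pow_le_pow_of_le_one s0.le hs1.le hNm.le
  have hX0 : 0 < exp θ ^ m := by positivity
  rw [hpow]
  -- error term
  set ε : ℝ := σ * τ * (exp θ ^ (a - m) * (w * exp (θ/2))) with hε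
  have hεb : e^2 * |ε| ≤ κ * l := by
    rw [hε, abs_mul, abs_mul, aσ, aτ, abs_of_pos (by positivity), one_mul, one_mul]
    have : exp θ ^ (a - m) * (w * exp (θ/2)) ≤ κ * l / e^2 := (mul_le_of_le_one_left hη0.le hq1).trans hη
    calc e^2 * (exp θ ^ (a - m) * (w * exp (θ/2))) ≤ e^2 * (κ * l / e^2) := mul_le_mul_of_nonneg_left this (by positivity)
      _ = κ * l := by field_simp
  have hee : 1 ≤ e^2 := one_le_pow₀ he1
  have hee1 : e ≤ e^2 := by rw [pow_two]; exact le_mul_of_one_le_left (by linarith) he1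
  have hε0 : |ε| ≤ κ * l := (le_mul_of_one_le_left (abs_nonneg ε) hee).trans hεb
  have hε1 : e * |ε| ≤ κ * l := (mul_le_mul_of_nonneg_right hee1 (abs_nonneg ε)).trans hεb
  have g : ∀ x y : ℝ, |x - y| < κ * l → |σ * x - σ * y| < κ * l := by
    intro x y hxy; rw [← mul_sub, abs_mul, aσ, one_mul]; exact hxy
  have B0 := abs_lt.mp (g _ _ b0)
  have B1 := abs_lt.mp (g _ _ b1)
  have B2 := abs_lt.mp (g _ _ b2)
  rw [hl1, show σ * (m * hh 0) = m * (σ * hh 0) by ring, hσl] at B1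
  rw [hl2, hl1, show σ * (m * (m * hh 0)) = m^2 * (σ * hh 0) by ring, hσl] at B2
  rw [hσl] at B0
  have E0 := abs_le.mp hε0
  have E1 : |e * ε| ≤ κ * l := by rw [abs_mul, abs_of_pos (by linarith)]; exact hε1
  have E2 : |e^2 * ε| ≤ κ * l := by rw [abs_mul, abs_of_pos (by positivity)]; exact hεb
  replace E1 := abs_le.mp E1
  replace E2 := abs_le.mp E2
  have r0 : σ * (exp θ ^ m * hh (exp θ) + τ * (exp θ ^ m * exp θ ^ (a - m) * exp (θ/2)) * w) = exp θ ^ m * (σ * hh (exp θ) + ε) := by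
    rw [hε]; ring
  have r1 : σ * (exp θ ^ m * hh1 (exp θ) + τ * (e * (exp θ ^ m * exp θ ^ (a - m) * exp (θ/2))) * w) = exp θ ^ m * (σ * hh1 (exp θ) + e * ε) := by
    rw [hε]; ring
  have r2 : σ * (exp θ ^ m * hh2 (exp θ) + τ * (e * (e * (exp θ ^ m * exp θ ^ (a - m) * exp (θ/2)))) * w) = exp θ ^ m * (σ * hh2 (exp θ) + e^2 * ε) := by
    rw [hε]; ring
  have abσ : ∀ x : ℝ, |x| = |σ * x| := fun x => by rw [abs_mul, aσ, one_mul]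
  rw [abσ (_ + _), abσ (exp θ ^ m * hh2 (exp θ) + _), mul_sub, mul_left_comm σ (N:ℝ), r0, r1, r2, abs_mul, abs_mul, abs_of_pos hX0]
  have k1 : 8 * (κ * l) ≤ l := by
    have := mul_le_mul_of_nonneg_right hκ8 hl0.le
    linarith
  have k2 : 8 * (κ * l * (N + 1)) ≤ l := by
    rw [mul_right_comm, hκN]; linarith
  exact YC_num hX0 hl0 hN0 hN1 k1 k2 hXN ⟨by linarith only [B0.1, E0.1], by linarith only [B0.2, E0.2]⟩
    ⟨by linarith only [B1.1, E1.1], by linarith only [B1.2, E1.2]⟩ ⟨by linarith only [B2.1, E2.1], by linarith only [B2.2, E2.2]⟩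

def ss (N : ℕ) (x : ℝ) : ℝ := x ^ ((N:ℝ)⁻¹)
def zz (N a : ℕ) (h : ℝ → ℝ) (q : ℝ × ℝ) : ℝ := (q.2 - h (ss N q.1)) / ss N q.1 ^ a

lemma ss_meas (N : ℕ) : Measurable (ss N) := by unfold ss; fun_prop
lemma zz_meas (N a : ℕ) {h : ℝ → ℝ} (hh : Measurable h) : Measurable (zz N a h) :=
  (measurable_snd.sub (hh.comp ((ss_meas N).comp measurable_fst))).div (((ss_meas N).comp measurable_fst).pow_const a)

lemma ss_exp {N : ℕ} (hN : 0 < N) (θ : ℝ) : ss N (exp (N * θ)) = exp θ := by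
  have : (N:ℝ) ≠ 0 := by exact_mod_cast hN.ne'
  rw [ss, ← exp_mul]; congr 1; field_simp

lemma ss_pow {N : ℕ} (hN : 0 < N) {s : ℝ} (hs : 0 ≤ s) : ss N (s ^ N) = s := by
  rw [ss]; exact pow_rpow_inv_natCast hs hN.ne'

lemma ss_pos (N : ℕ) {x : ℝ} (hx : 0 < x) : 0 < ss N x := rpow_pos_of_pos hx _

lemma pow_ss {N : ℕ} (hN : 0 < N) {x : ℝ} (hx : 0 ≤ x) : ss N x ^ N = x := rpow_inv_natCast_pow hx hN.ne'

lemma zz_psi {N : ℕ} (hN : 0 < N) (a : ℕ) (h : ℝ → ℝ) (τ θ w : ℝ) :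
    zz N a h (Psi N (fun θ => h (exp θ)) ((a:ℝ)+1/2) τ (θ, w)) = τ * (w * exp (θ/2)) := by
  unfold zz Psi
  dsimp only
  rw [ss_exp hN, exp_half_mul]
  field_simp
  ring

lemma disk_exp {N : ℕ} (hN : 0 < N) {θ y s1 : ℝ} (hs : 0 < s1) (h : (exp (N*θ), y) ∈ disk2 (s1 ^ N)) : exp θ < s1 := by
  have h' : exp (N*θ) ^ 2 + y^2 < (s1^N)^2 := h
  have : exp (N*θ) ^ 2 < (s1^N)^2 := by nlinarith [sq_nonneg y]
  have h2 := lt_of_pow_lt_pow_left₀ 2 (by positivity) this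
  rw [exp_nat_mul] at h2
  exact lt_of_pow_lt_pow_left₀ N hs.le h2

lemma region1 {n : ℕ} {f : Fin n → ℝ × ℝ → ℝ} {γ : Fin n → ℝ} {rG : ℝ} (hrG : 0 < rG)
    (hG : IntegrableOn (fun p => ∏ i, |f i p| ^ γ i) (disk2 rG))
    {N a p : ℕ} (hN : 0 < N) (hp : 0 < p) {h ψ : ℝ → ℝ} (hhm : Measurable h) (hψm : Measurable ψ)
    (hψ : AnalyticAt ℝ ψ 0) (hψ0 : ψ 0 = 0) {ω : ℝ} (hω : 0 ≤ ω) {τ : ℝ} (hτ : τ = 1 ∨ τ = -1)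
    (hY : YC N a h τ)
    (hf : ∀ i, ∃ d k : ℕ, ∃ Hh : ℝ × ℝ × ℝ → ℝ, AnalyticAt ℝ Hh 0 ∧ Hh 0 ≠ 0 ∧
      ∀ᶠ q in 𝓝 (0 : ℝ × ℝ), 0 < q.1 → q.2 ≠ 0 →
      f i (q.1 ^ N, h q.1 + q.1 ^ a * q.2) = q.1 ^ d * q.2 ^ k * Hh (q.1, q.2, ω * (q.1 ^ p / q.2))) :
    ∃ ρ > 0, ∀ v, 0 < v → v < ρ → ∀ L, 0 ≤ L → ω ≤ ρ * L →
      EstS (fun p => ∏ i, |f i p| ^ γ i)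
        {q | 0 < q.1 ∧ L * ss N q.1 ^ p < τ * zz N a h q ∧ τ * (zz N a h q + ψ (ss N q.1)) < v} := by
  obtain ⟨H1, H2, σ, hσ, C1, hC1, c1, hc1, ρ0, hρ0, hYC⟩ := hY
  choose d k Hh hH hH0 hfi using hf
  choose ρi hρi Ci hCi hleaf using fun i => leafF hω (hH i) (hH0 i) (hfi i)
  have hτ2 : τ * τ = 1 := by rcases hτ with h|h <;> simp [h]
  have aτ : |τ| = 1 := by rcases hτ with h|h <;> simp [h]
  obtain ⟨ρs, hρs, hρs0, hρsi⟩ : ∃ ρs > 0, ρs ≤ ρ0 ∧ ∀ i, ρs ≤ ρi i := by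
    rcases isEmpty_or_nonempty (Fin n) with hn | hn
    · exact ⟨ρ0, hρ0, le_rfl, fun i => (hn.false i).elim⟩
    · obtain ⟨j, hj⟩ := Finite.exists_min ρi
      exact ⟨min ρ0 (ρi j), lt_min hρ0 (hρi j), min_le_left _ _, fun i => (min_le_right _ _).trans (hj i)⟩
  have hCs : ∀ i, Ci i ≤ ∑ j, Ci j := fun i => Finset.single_le_sum (fun j _ => (hCi j).le) (Finset.mem_univ i)
  have hCs0 : 0 ≤ ∑ j, Ci j := Finset.sum_nonneg fun j _ => (hCi j).le
  refine ⟨ρs / 2, by positivity, fun v hv0 hv L hL hωL => ?_⟩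
  -- smallness of s
  have ev : ∀ᶠ s in 𝓝 (0:ℝ), |ψ s| < v/8 ∧ |s * deriv ψ s| < v/8 ∧ DifferentiableAt ℝ ψ s := by
    have c0 : ContinuousAt (fun s => |ψ s|) 0 := hψ.continuousAt.abs
    have c1 : ContinuousAt (fun s => |s * deriv ψ s|) 0 := (continuousAt_id.mul hψ.deriv.continuousAt).abs
    have e0 := c0.eventually_lt_const (u := v/8) (by simp [hψ0]; linarith)
    have e1 := c1.eventually_lt_const (u := v/8) (by simp; linarith)
    exact e0.and (e1.and (hψ.eventually_analyticAt.mono fun s hs => hs.differentiableAt))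
  obtain ⟨s2, hs2, hψb⟩ := Metric.eventually_nhds_iff.mp ev
  set s1 := min s2 ρs with hs1
  have hs10 : 0 < s1 := lt_min hs2 hρs
  have hψb' : ∀ θ, exp θ < s1 → |ψ (exp θ)| < v/8 ∧ |exp θ * deriv ψ (exp θ)| < v/8 ∧ DifferentiableAt ℝ ψ (exp θ) := by
    intro θ hθ
    exact hψb (by rw [dist_zero_right, norm_of_nonneg (exp_pos _).le]; exact hθ.trans_le (min_le_left _ _))
  set R : Set (ℝ × ℝ) := {q | 0 < q.1 ∧ L * ss N q.1 ^ p < τ * zz N a h q ∧ τ * (zz N a h q + ψ (ss N q.1)) < v} with hR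
  have hRm : MeasurableSet R := by
    have m1 : Measurable fun q : ℝ × ℝ => ss N q.1 := (ss_meas N).comp measurable_fst
    have m2 := zz_meas N a hhm
    have q1 : MeasurableSet {q : ℝ × ℝ | 0 < q.1} := measurableSet_lt measurable_const measurable_fst
    have q2 : MeasurableSet {q : ℝ × ℝ | L * ss N q.1 ^ p < τ * zz N a h q} :=
      measurableSet_lt ((m1.pow_const p).const_mul L) (m2.const_mul τ)
    have q3 : MeasurableSet {q : ℝ × ℝ | τ * (zz N a h q + ψ (ss N q.1)) < v} :=
      measurableSet_lt ((m2.add (hψm.comp m1)).const_mul τ) measurable_const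
    exact q1.inter (q2.inter q3)
  -- membership
  have hmem : ∀ θ w, Psi N (fun θ => h (exp θ)) ((a:ℝ)+1/2) τ (θ, w) ∈ R ↔
      (L * exp θ ^ p < w * exp (θ/2) ∧ w * exp (θ/2) + τ * ψ (exp θ) < v) := by
    intro θ w
    rw [hR, mem_ofPred_eq, zz_psi hN]
    have e1 : (Psi N (fun θ => h (exp θ)) ((a:ℝ)+1/2) τ (θ, w)).1 = exp (N * θ) := rfl
    rw [e1, ss_exp hN, ← mul_assoc τ τ, hτ2, one_mul, mul_add, ← mul_assoc τ τ, hτ2, one_mul]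
    exact ⟨fun h => h.2, fun h => ⟨exp_pos _, h⟩⟩
  have hwpos : ∀ θ w, L * exp θ ^ p < w * exp (θ/2) → 0 < w := by
    intro θ w hlt
    have : 0 < w * exp (θ/2) := lt_of_le_of_lt (by positivity) hlt
    exact pos_of_mul_pos_left this (exp_pos _).le
  have hsmall : ∀ θ w, exp θ < s1 → w * exp (θ/2) + τ * ψ (exp θ) < v → w * exp (θ/2) < ρs := by
    intro θ w h1 h2
    have h3 := (hψb' θ h1).1
    have h4 : |τ * ψ (exp θ)| < v/8 := by rw [abs_mul, aτ, one_mul]; exact h3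
    have := (abs_lt.mp h4).1
    linarith
  refine leaf2D hrG hG hN (H := fun θ => h (exp θ)) (H1 := H1) (H2 := H2) (e := (a:ℝ)+1/2) (τ := τ) (σ := σ)
    (C1 := C1 + (∑ j, Ci j) * ∑ i, |γ i|) (c1 := c1) (r0 := s1 ^ N) (hhm.comp measurable_exp) hτ hσ ?_ hc1 (by positivity) hRm
    (fun q hq => hq.1) ?_ ?_
  · have : 0 ≤ (∑ j, Ci j) * ∑ i, |γ i| := mul_nonneg hCs0 (Finset.sum_nonneg fun i _ => abs_nonneg _)
    linarith
  · intro θ w hq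
    have hθ := disk_exp hN hs10 hq.1
    obtain ⟨m1, m2⟩ := (hmem θ w).mp hq.2
    have hw := hwpos θ w m1
    have h2 := hsmall θ w hθ m2
    have hθρ : exp θ < ρs := hθ.trans_le (min_le_right _ _)
    obtain ⟨y1, y2, y3, y4, y5, y6, y7, -⟩ := hYC θ w hw (hθρ.trans_le hρs0) (h2.trans_le hρs0)
    have hfl : ω * exp θ ^ p < ρs * (w * exp (θ/2)) := by
      have a1 : ω * exp θ ^ p ≤ (ρs/2 * L) * exp θ ^ p := mul_le_mul_of_nonneg_right hωL (by positivity)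
      have a2 : ρs/2 * (L * exp θ ^ p) < ρs/2 * (w * exp (θ/2)) := mul_lt_mul_of_pos_left m1 (by positivity)
      have a3 : 0 < ρs/2 * (w * exp (θ/2)) := by positivity
      linarith
    have hl := fun i => hleaf i ρs (hρsi i) τ w θ hτ hw hθρ h2 hfl
    obtain ⟨g0, D, gD, gb⟩ := prod_logder (γ := γ) (g := fun i θ => f i (Psi N (fun θ => h (exp θ)) ((a:ℝ)+1/2) τ (θ, w))) (θ := θ)
      hCs0 fun i => ⟨(hl i).1, by
        obtain ⟨D, d1, d2⟩ := (hl i).2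
        exact ⟨D, d1, d2.trans (mul_le_mul_of_nonneg_right (hCs i) (abs_nonneg _))⟩⟩
    have hX : 0 ≤ (∑ j, Ci j) * ∑ i, |γ i| := mul_nonneg hCs0 (Finset.sum_nonneg fun i _ => abs_nonneg _)
    refine ⟨y1, y2, g0, ⟨D, gD, gb.trans (mul_le_mul_of_nonneg_right (by linarith) g0.le)⟩, y3, y4.trans ?_, y5.trans ?_, y6, y7.trans ?_⟩
    · exact mul_le_mul_of_nonneg_right (by linarith) y3.le
    · exact mul_le_mul_of_nonneg_right (by linarith) y3.le
    · exact mul_le_mul_of_nonneg_right (by linarith) (exp_pos _).le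
  · intro r w hr hrr
    have hdisk : ∀ θ, Psi N (fun θ => h (exp θ)) ((a:ℝ)+1/2) τ (θ, w) ∈ disk2 r → exp θ < s1 := fun θ hθ =>
      disk_exp hN hs10 (disk2_mono hr hrr hθ)
    have key : ∀ x, Psi N (fun θ => h (exp θ)) ((a:ℝ)+1/2) τ (x, w) ∈ disk2 r ∩ R → ∀ b < x,
        Psi N (fun θ => h (exp θ)) ((a:ℝ)+1/2) τ (b, w) ∈ disk2 r ∩ R := by
      intro x hx b hb
      obtain ⟨m1, m2⟩ := (hmem x w).mp hx.2
      have hw := hwpos x w m1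
      have hxs := hdisk x hx.1
      have hxw := hsmall x w hxs m2
      have hys : ∀ y ≤ x, exp y < s1 := fun y hy => (exp_le_exp.mpr hy).trans_lt hxs
      have hyw : ∀ y ≤ x, w * exp (y/2) < ρs := fun y hy =>
        (mul_le_mul_of_nonneg_left (exp_le_exp.mpr (by linarith)) hw.le).trans_lt hxw
      refine ⟨?_, (hmem b w).mpr ⟨?_, ?_⟩⟩
      · -- disk
        have mono : MonotoneOn (fun θ => (h (exp θ) + τ * exp (((a:ℝ)+1/2) * θ) * w)^2) (Icc b x) := by
          have hd : ∀ θ ∈ Icc b x, HasDerivAt (fun θ => (h (exp θ) + τ * exp (((a:ℝ)+1/2) * θ) * w)^2)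
              (2 * ((σ * (h (exp θ) + τ * exp (((a:ℝ)+1/2) * θ) * w)) * (σ * (H1 θ + τ * (((a:ℝ)+1/2) * exp (((a:ℝ)+1/2) * θ)) * w)))) θ := by
            intro θ hθ
            obtain ⟨y1, -⟩ := hYC θ w hw ((hys θ hθ.2).trans_le ((min_le_right _ _).trans hρs0)) ((hyw θ hθ.2).trans_le hρs0)
            have dex : HasDerivAt (fun θ => exp (((a:ℝ)+1/2) * θ)) (exp (((a:ℝ)+1/2) * θ) * (((a:ℝ)+1/2) * 1)) θ :=
              ((hasDerivAt_id θ).const_mul ((a:ℝ)+1/2)).exp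
            refine ((y1.fun_add ((dex.const_mul τ).mul_const w)).fun_pow 2).congr_deriv ?_
            have hσ2 : σ * σ = 1 := by rcases hσ with h|h <;> simp [h]
            push_cast
            rw [show ∀ A B : ℝ, 2 * (σ * A * (σ * B)) = (σ * σ) * (2 * A * B) from fun A B => by ring, hσ2]
            ring
          refine monotoneOn_of_deriv_nonneg (convex_Icc _ _) (fun θ hθ => (hd θ hθ).continuousAt.continuousWithinAt)
            (fun θ hθ => (hd θ (interior_subset hθ)).differentiableAt.differentiableWithinAt) fun θ hθ => ?_
          replace hθ := interior_subset hθ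
          rw [(hd θ hθ).deriv]
          obtain ⟨-, -, y3, -, -, -, -, y8⟩ := hYC θ w hw ((hys θ hθ.2).trans_le ((min_le_right _ _).trans hρs0)) ((hyw θ hθ.2).trans_le hρs0)
          exact mul_nonneg zero_le_two (mul_nonneg y3.le y8)
        have h1 := mono (left_mem_Icc.mpr hb.le) (right_mem_Icc.mpr hb.le) hb.le
        have h2 : exp (N * b) ^ 2 ≤ exp (N * x) ^ 2 :=
          pow_le_pow_left₀ (exp_pos _).le (exp_le_exp.mpr (mul_le_mul_of_nonneg_left hb.le (Nat.cast_nonneg _))) 2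
        have h3 := hx.1
        exact lt_of_le_of_lt (add_le_add h2 h1) h3
      · have e1 : exp b ^ p = exp x ^ p * exp (-(p * (x - b))) := by
          rw [← exp_nat_mul, ← exp_nat_mul, ← exp_add]; congr 1; ring
        have e2 : exp (b/2) = exp (x/2) * exp (-((x-b)/2)) := by
          rw [← exp_add]; congr 1; ring
        have hp1 : (1:ℝ) ≤ p := by exact_mod_cast hp
        have e3 : exp (-(p * (x - b))) ≤ exp (-((x-b)/2)) := by
          apply exp_le_exp.mpr
          nlinarith
        rw [e1, e2, ← mul_assoc, ← mul_assoc]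
        exact (mul_le_mul_of_nonneg_left e3 (by positivity)).trans_lt (mul_lt_mul_of_pos_right m1 (exp_pos _))
      · rcases lt_or_ge (w * exp (b/2)) (v/2) with hlt | hge
        · have h3 := (hψb' b (hys b hb.le)).1
          have h4 : |τ * ψ (exp b)| < v/8 := by rw [abs_mul, aτ, one_mul]; exact h3
          have := (abs_lt.mp h4).2
          linarith
        · have hd : ∀ θ ∈ Icc b x, HasDerivAt (fun θ => w * exp (θ/2) + τ * ψ (exp θ))
              (w * exp (θ/2) / 2 + τ * (exp θ * deriv ψ (exp θ))) θ := by
            intro θ hθ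
            have d1 := (hψb' θ (hys θ hθ.2)).2.2.hasDerivAt
            have hE : HasDerivAt (fun x : ℝ => exp (x/2)) (exp (θ/2) * (1/2)) θ := ((hasDerivAt_id θ).div_const 2).exp
            exact ((hE.const_mul w).add ((HasDerivAt.comp θ d1 (Real.hasDerivAt_exp θ)).const_mul τ)).congr_deriv (by ring)
          have mono : MonotoneOn (fun θ => w * exp (θ/2) + τ * ψ (exp θ)) (Icc b x) := by
            refine monotoneOn_of_deriv_nonneg (convex_Icc _ _) (fun θ hθ => (hd θ hθ).continuousAt.continuousWithinAt)
              (fun θ hθ => (hd θ (interior_subset hθ)).differentiableAt.differentiableWithinAt) fun θ hθ => ?_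
            replace hθ := interior_subset hθ
            rw [(hd θ hθ).deriv]
            have h3 := (hψb' θ (hys θ hθ.2)).2.1
            have h4 : |τ * (exp θ * deriv ψ (exp θ))| < v/8 := by rw [abs_mul, aτ, one_mul]; exact h3
            have h5 := (abs_lt.mp h4).1
            have h6 : w * exp (b/2) ≤ w * exp (θ/2) := mul_le_mul_of_nonneg_left (exp_le_exp.mpr (by linarith [hθ.1])) hw.le
            linarith
          exact (mono (left_mem_Icc.mpr hb.le) (right_mem_Icc.mpr hb.le) hb.le).trans_lt m2
    rcases down_closed (S := {θ | Psi N (fun θ => h (exp θ)) ((a:ℝ)+1/2) τ (θ, w) ∈ disk2 r ∩ R})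
      ⟨log s1, fun θ hθ => ((lt_log_iff_exp_lt hs10).mpr (hdisk θ hθ.1)).le⟩ key with h | h
    · exact Or.inl h
    · exact Or.inr (Or.inl h)

lemma newton {n : ℕ} (k : Fin n → ℕ) {c : Fin n → ℕ → ℝ → ℝ} (hc : ∀ i j, AnalyticAt ℝ (c i j) 0) (hc0 : ∀ i j, c i j 0 = 0) :
    ∃ q p : ℕ, 0 < q ∧ 0 < p ∧ ∃ ch : Fin n → ℕ → ℝ → ℝ, (∀ i j, AnalyticAt ℝ (ch i j) 0) ∧
      (∀ i, ∀ j < k i, ∀ᶠ s in 𝓝 (0:ℝ), c i j (s ^ q) = s ^ (p * (k i - j)) * ch i j s) ∧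
      ((∃ i, ∃ j < k i, ch i j 0 ≠ 0) ∨ ∀ i j, ch i j = fun _ => 0) := by
  have h1 : ∀ x : Fin n × ℕ, ∃ (e : ℕ) (g : ℝ → ℝ), AnalyticAt ℝ g 0 ∧ (∀ᶠ s in 𝓝 (0:ℝ), c x.1 x.2 s = s ^ e * g s) ∧
      ((¬ ∀ᶠ s in 𝓝 (0:ℝ), c x.1 x.2 s = 0) → g 0 ≠ 0 ∧ 0 < e) ∧ ((∀ᶠ s in 𝓝 (0:ℝ), c x.1 x.2 s = 0) → g = fun _ => 0) := by
    intro x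
    by_cases hx : ∀ᶠ s in 𝓝 (0:ℝ), c x.1 x.2 s = 0
    · exact ⟨0, fun _ => 0, analyticAt_const, by simpa using hx, fun h => absurd hx h, fun _ => rfl⟩
    · obtain ⟨e, g, hg, hg0, hge⟩ := (hc x.1 x.2).exists_eventuallyEq_pow_smul_nonzero_iff.mpr hx
      refine ⟨e, g, hg, by simpa using hge, fun _ => ⟨hg0, Nat.pos_of_ne_zero ?_⟩, fun h => absurd h hx⟩
      rintro rfl
      have := hge.self_of_nhds
      rw [hc0] at this
      simp at this
      exact hg0 this.symm
  choose e g hg hge hne hz using h1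
  let T : Set (Fin n × ℕ) := {x | x.2 < k x.1 ∧ ¬ ∀ᶠ s in 𝓝 (0:ℝ), c x.1 x.2 s = 0}
  have hT : T.Finite := by
    refine ((Set.finite_univ (α := Fin n)).prod (Set.finite_Iio (∑ i, k i))).subset fun x hx => ⟨mem_univ _, ?_⟩
    exact lt_of_lt_of_le hx.1 (Finset.single_le_sum (fun _ _ => Nat.zero_le _) (Finset.mem_univ x.1))
  rcases T.eq_empty_or_nonempty with hTe | hTn
  · refine ⟨1, 1, one_pos, one_pos, fun _ _ _ => 0, fun _ _ => analyticAt_const, fun i j hj => ?_, Or.inr fun _ _ => rfl⟩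
    have : (i, j) ∉ T := by rw [hTe]; exact notMem_empty _
    have h2 : ∀ᶠ s in 𝓝 (0:ℝ), c i j s = 0 := by
      by_contra hcon
      exact this ⟨hj, hcon⟩
    simpa using h2
  · obtain ⟨x, hx, hmin⟩ := Set.exists_min_image T (fun x => (e x : ℝ) / ((k x.1 - x.2 : ℕ) : ℝ)) hT hTn
    have hq : 0 < k x.1 - x.2 := Nat.sub_pos_of_lt hx.1
    have hexp : ∀ y ∈ T, e x * (k y.1 - y.2) ≤ e y * (k x.1 - x.2) := by
      intro y hy
      have hy1 : 0 < k y.1 - y.2 := Nat.sub_pos_of_lt hy.1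
      have := hmin y hy
      rw [div_le_div_iff₀ (by exact_mod_cast hq) (by exact_mod_cast hy1)] at this
      exact_mod_cast this
    have hpow : ∀ m : ℕ, AnalyticAt ℝ (fun s : ℝ => s ^ m) 0 := fun m => analyticAt_id.pow m
    refine ⟨k x.1 - x.2, e x, hq, (hne x hx.2).2,
      fun i j s => s ^ (e (i,j) * (k x.1 - x.2) - e x * (k i - j)) * g (i,j) (s ^ (k x.1 - x.2)), ?_, ?_, Or.inl ⟨x.1, x.2, hx.1, ?_⟩⟩
    · intro i j
      refine (hpow _).mul (AnalyticAt.fun_comp (g := g (i,j)) ?_ (hpow _))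
      rw [zero_pow hq.ne']; exact hg _
    · intro i j hj
      have ht : Tendsto (fun s : ℝ => s ^ (k x.1 - x.2)) (𝓝 0) (𝓝 0) := by
        have := (hpow (k x.1 - x.2)).continuousAt.tendsto
        rwa [zero_pow hq.ne'] at this
      by_cases hij : (i, j) ∈ T
      · filter_upwards [ht.eventually (hge (i,j))] with s hs
        rw [hs, ← mul_assoc, ← pow_add, ← pow_mul, mul_comm (k x.1 - x.2)]
        congr 2
        have := hexp _ hij
        dsimp only at this
        omega
      · have h2 : ∀ᶠ s in 𝓝 (0:ℝ), c i j s = 0 := by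
          by_contra hcon
          exact hij ⟨hj, hcon⟩
        filter_upwards [ht.eventually h2] with s hs
        rw [hs, hz (i,j) h2]; simp
    · have : e (x.1, x.2) * (k x.1 - x.2) - e x * (k x.1 - x.2) = 0 := Nat.sub_self _
      show (0:ℝ) ^ (e (x.1, x.2) * (k x.1 - x.2) - e x * (k x.1 - x.2)) * g (x.1, x.2) (0 ^ (k x.1 - x.2)) ≠ 0
      rw [this, zero_pow hq.ne', pow_zero, one_mul]
      exact (hne x hx.2).1

structure Node {n : ℕ} (f : Fin n → ℝ × ℝ → ℝ) (N a : ℕ) (h : ℝ → ℝ) (k : Fin n → ℕ) (F : Fin n → ℝ × ℝ → ℝ) : Prop where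
  hN : 0 < N
  hNa : N ≤ a
  hm : Measurable h
  hF : ∀ i, AnalyticAt ℝ (F i) 0
  ord : ∀ i, HasOrd (F i) (k i)
  eq : ∀ i, ∃ d : ℕ, ∀ᶠ q in 𝓝 (0 : ℝ × ℝ), 0 < q.1 → f i (q.1 ^ N, h q.1 + q.1 ^ a * q.2) = q.1 ^ d * F i q

lemma tendsto_shift {φ : ℝ → ℝ} (hφ : ContinuousAt φ 0) (h0 : φ 0 = 0) :
    Tendsto (fun p : ℝ × ℝ => (p.1, p.2 + φ p.1)) (𝓝 0) (𝓝 0) := by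
  have c1 : ContinuousAt (fun p : ℝ × ℝ => φ p.1) 0 := ContinuousAt.comp (f := Prod.fst) (by exact hφ) continuousAt_fst
  have : ContinuousAt (fun p : ℝ × ℝ => (p.1, p.2 + φ p.1)) 0 := continuousAt_fst.prodMk (continuousAt_snd.add c1)
  have h := this.tendsto
  have h00 : ((0:ℝ×ℝ).1, (0:ℝ×ℝ).2 + φ (0:ℝ×ℝ).1) = (0:ℝ×ℝ) := by simp [h0]
  rwa [h00] at h

lemma node_shift {n : ℕ} {f : Fin n → ℝ × ℝ → ℝ} {N a : ℕ} {h : ℝ → ℝ} {k : Fin n → ℕ} {F : Fin n → ℝ × ℝ → ℝ}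
    (hn : Node f N a h k F) {φ : ℝ → ℝ} (hφm : Measurable φ) (hφ : AnalyticAt ℝ φ 0) (h0 : φ 0 = 0) :
    Node f N a (fun s => h s + s ^ a * φ s) k (fun i p => F i (p.1, p.2 + φ p.1)) where
  hN := hn.hN
  hNa := hn.hNa
  hm := hn.hm.add ((measurable_id.pow_const a).mul hφm)
  hF := fun i => an_shift (hn.hF i) hφ h0
  ord := fun i => HasOrd_shift h0 (hn.ord i)
  eq := fun i => by
    obtain ⟨d, hd⟩ := hn.eq i
    refine ⟨d, ?_⟩
    filter_upwards [(tendsto_shift hφ.continuousAt h0).eventually hd] with q hq hq1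
    rw [← hq hq1]
    congr 2; ring

/-- prepared node -/
structure Prep {n : ℕ} (f : Fin n → ℝ × ℝ → ℝ) (N a p : ℕ) (h : ℝ → ℝ) (k : Fin n → ℕ) (ch : Fin n → ℕ → ℝ → ℝ)
    (U : Fin n → ℝ × ℝ → ℝ) : Prop where
  hN : 0 < N
  hNa : N ≤ a
  hp : 0 < p
  hm : Measurable h
  hc : ∀ i j, AnalyticAt ℝ (ch i j) 0
  hU : ∀ i, AnalyticAt ℝ (U i) 0
  hU0 : ∀ i, U i 0 ≠ 0
  eq : ∀ i, ∃ d : ℕ, ∀ᶠ q in 𝓝 (0 : ℝ × ℝ), 0 < q.1 → f i (q.1 ^ N, h q.1 + q.1 ^ a * q.2) =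
    q.1 ^ d * (∑ j ∈ Finset.range (k i), q.1 ^ (p * (k i - j)) * ch i j q.1 * q.2 ^ j + q.2 ^ k i * U i q)

lemma node_prep {n : ℕ} {f : Fin n → ℝ × ℝ → ℝ} {N a q p : ℕ} {h : ℝ → ℝ} {k : Fin n → ℕ} {F : Fin n → ℝ × ℝ → ℝ}
    (hn : Node f N a h k F) (hq : 0 < q) (hp : 0 < p) {c : Fin n → ℕ → ℝ → ℝ} {U : Fin n → ℝ × ℝ → ℝ}
    (hU : ∀ i, AnalyticAt ℝ (U i) 0) (hU0 : ∀ i, U i 0 ≠ 0)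
    (hFe : ∀ i, ∀ᶠ p in 𝓝 (0 : ℝ × ℝ), F i p = ∑ j ∈ Finset.range (k i), c i j p.1 * p.2 ^ j + p.2 ^ k i * U i p)
    {ch : Fin n → ℕ → ℝ → ℝ} (hch : ∀ i j, AnalyticAt ℝ (ch i j) 0)
    (hcc : ∀ i, ∀ j < k i, ∀ᶠ s in 𝓝 (0:ℝ), c i j (s ^ q) = s ^ (p * (k i - j)) * ch i j s) :
    Prep f (N * q) (a * q) p (fun s => h (s ^ q)) k ch (fun i x => U i (x.1 ^ q, x.2)) := by
  have han : AnalyticAt ℝ (fun x : ℝ × ℝ => (x.1 ^ q, x.2)) 0 := (analyticAt_fst.pow q).prod analyticAt_snd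
  have h00 : ((0:ℝ×ℝ).1 ^ q, (0:ℝ×ℝ).2) = 0 := by simp [zero_pow hq.ne']
  have ht : Tendsto (fun x : ℝ × ℝ => (x.1 ^ q, x.2)) (𝓝 0) (𝓝 0) := by
    have := han.continuousAt.tendsto
    rwa [h00] at this
  refine ⟨Nat.mul_pos hn.hN hq, Nat.mul_le_mul_right q hn.hNa, hp, hn.hm.comp (measurable_id.pow_const q), hch, fun i => ?_, fun i => ?_, fun i => ?_⟩
  · exact AnalyticAt.fun_comp (g := U i) (by rw [h00]; exact hU i) han
  · show U i ((0:ℝ×ℝ).1 ^ q, (0:ℝ×ℝ).2) ≠ 0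
    rw [h00]; exact hU0 i
  · obtain ⟨d, hd⟩ := hn.eq i
    refine ⟨d * q, ?_⟩
    have hcc' : ∀ᶠ x in 𝓝 (0:ℝ×ℝ), ∀ j ∈ Finset.range (k i), c i j (x.1 ^ q) = x.1 ^ (p * (k i - j)) * ch i j x.1 := by
      rw [Filter.eventually_all_finset]
      intro j hj
      have hfst : Tendsto (Prod.fst : ℝ×ℝ→ℝ) (𝓝 0) (𝓝 0) := continuous_fst.tendsto _
      exact hfst.eventually (hcc i j (Finset.mem_range.mp hj))
    filter_upwards [ht.eventually hd, ht.eventually (hFe i), hcc'] with x h1 h2 h3 hx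
    have := h1 (pow_pos hx q)
    rw [mul_comm N, mul_comm a, mul_comm d, pow_mul, pow_mul, pow_mul, this, h2]
    congr 2
    exact Finset.sum_congr rfl fun j hj => by rw [h3 j hj]

lemma prep_region1 {n : ℕ} {f : Fin n → ℝ × ℝ → ℝ} {N a p : ℕ} {h : ℝ → ℝ} {k : Fin n → ℕ} {ch : Fin n → ℕ → ℝ → ℝ}
    {U : Fin n → ℝ × ℝ → ℝ} (hP : Prep f N a p h k ch U) {ω : ℝ} (hω : ω = 1 ∨ ω = 0 ∧ ∀ i j, ch i j = fun _ => 0) (i : Fin n) :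
    ∃ d k : ℕ, ∃ Hh : ℝ × ℝ × ℝ → ℝ, AnalyticAt ℝ Hh 0 ∧ Hh 0 ≠ 0 ∧
      ∀ᶠ q in 𝓝 (0 : ℝ × ℝ), 0 < q.1 → q.2 ≠ 0 →
      f i (q.1 ^ N, h q.1 + q.1 ^ a * q.2) = q.1 ^ d * q.2 ^ k * Hh (q.1, q.2, ω * (q.1 ^ p / q.2)) := by
  obtain ⟨d, hd⟩ := hP.eq i
  refine ⟨d, k i, fun x => ∑ j ∈ Finset.range (k i), ch i j x.1 * x.2.2 ^ (k i - j) + U i (x.1, x.2.1), ?_, ?_, ?_⟩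
  · have a1 : AnalyticAt ℝ (fun x : ℝ × ℝ × ℝ => x.1) 0 := analyticAt_fst
    have a2 : AnalyticAt ℝ (fun x : ℝ × ℝ × ℝ => x.2.1) 0 := AnalyticAt.fun_comp (g := Prod.fst) analyticAt_fst analyticAt_snd
    have a3 : AnalyticAt ℝ (fun x : ℝ × ℝ × ℝ => x.2.2) 0 := AnalyticAt.fun_comp (g := Prod.snd) analyticAt_snd analyticAt_snd
    refine AnalyticAt.add (Finset.analyticAt_fun_sum _ fun j _ => ?_) ?_
    · exact (AnalyticAt.fun_comp (g := ch i j) (f := fun x => x.1) (x := 0) (hP.hc i j) a1).mul (a3.pow _)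
    · exact AnalyticAt.fun_comp (g := U i) (f := fun x : ℝ × ℝ × ℝ => (x.1, x.2.1)) (x := 0) (hP.hU i) (a1.prod a2)
  · have : ∀ j ∈ Finset.range (k i), ch i j (0:ℝ×ℝ×ℝ).1 * (0:ℝ×ℝ×ℝ).2.2 ^ (k i - j) = 0 := by
      intro j hj
      have : k i - j ≠ 0 := by have := Finset.mem_range.mp hj; omega
      simp [zero_pow this]
    dsimp only
    rw [Finset.sum_eq_zero this, zero_add]
    exact hP.hU0 i
  · filter_upwards [hd] with x hx h1 h2
    rw [hx h1, mul_assoc]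
    congr 1
    rw [mul_add, Finset.mul_sum]
    congr 1
    refine Finset.sum_congr rfl fun j hj => ?_
    rcases hω with rfl | ⟨rfl, h0⟩
    · have hjk := Finset.mem_range.mp hj
      have e1 : x.2 ^ k i = x.2 ^ j * x.2 ^ (k i - j) := by rw [← pow_add]; congr 1; omega
      rw [one_mul, div_pow, e1, pow_mul]
      field_simp
    · simp [h0]

open Polynomial in
/-- blown-up polynomial -/
def blP (k : ℕ) (c : ℕ → ℝ) (u : ℝ) : ℝ[X] := ∑ j ∈ Finset.range k, C (c j) * X ^ j + C u * X ^ k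

open Polynomial in
lemma blP_coeff (k : ℕ) (c : ℕ → ℝ) (u : ℝ) (m : ℕ) : (blP k c u).coeff m = if m < k then c m else if m = k then u else 0 := by
  unfold blP
  simp only [coeff_add, finsetSum_coeff, coeff_C_mul, coeff_X_pow, mul_ite, mul_one, mul_zero, Finset.sum_ite_eq, Finset.mem_range]
  split_ifs <;> first | omega | simp

open Polynomial in
lemma blP_natDegree {k : ℕ} {c : ℕ → ℝ} {u : ℝ} (hu : u ≠ 0) : (blP k c u).natDegree = k := by
  refine natDegree_eq_of_le_of_coeff_ne_zero ?_ ?_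
  · rw [natDegree_le_iff_coeff_eq_zero]
    intro m hm
    rw [blP_coeff, if_neg (by omega), if_neg (by omega)]
  · rw [blP_coeff]; simpa using hu

lemma blP_ne {k : ℕ} {c : ℕ → ℝ} {u : ℝ} (hu : u ≠ 0) : blP k c u ≠ 0 := by
  intro h
  have := blP_coeff k c u k
  rw [h] at this
  simp at this
  exact hu this.symm

open Polynomial in
lemma blP_mult_le {k : ℕ} {c : ℕ → ℝ} {u : ℝ} (hu : u ≠ 0) (w : ℝ) : (blP k c u).rootMultiplicity w ≤ k := by
  have := natDegree_le_of_dvd (pow_rootMultiplicity_dvd (blP k c u) w) (blP_ne hu)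
  rwa [blP_natDegree hu, natDegree_pow, natDegree_X_sub_C, mul_one] at this

open Polynomial in
lemma blP_eq_of_mult {k : ℕ} {c : ℕ → ℝ} {u : ℝ} (hu : u ≠ 0) {w : ℝ} (h : (blP k c u).rootMultiplicity w = k) :
    blP k c u = C u * (X - C w) ^ k := by
  have hd : (X - C w) ^ k ∣ blP k c u := by
    have := pow_rootMultiplicity_dvd (blP k c u) w
    rwa [h] at this
  have hm : ((X - C w) ^ k : ℝ[X]).Monic := (monic_X_sub_C w).pow k
  have hdeg : ((X - C w) ^ k : ℝ[X]).natDegree = k := by rw [natDegree_pow, natDegree_X_sub_C, mul_one]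
  have := eq_leadingCoeff_mul_of_monic_of_dvd_of_natDegree_le hm hd (by rw [hdeg, blP_natDegree hu])
  rw [this]
  congr 2
  rw [leadingCoeff, blP_natDegree hu, blP_coeff]; simp

open Polynomial in
lemma blP_zero_root {k : ℕ} {c : ℕ → ℝ} {u : ℝ} (hu : u ≠ 0) (h : (blP k c u).rootMultiplicity 0 = k) :
    ∀ j < k, c j = 0 := by
  intro j hj
  have h1 := blP_eq_of_mult hu h
  have h2 := blP_coeff k c u j
  rw [h1, if_pos hj] at h2
  rw [← h2]
  simp [coeff_X_pow]
  intro h; omega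

open Polynomial in
lemma blP_tsch {k : ℕ} {c : ℕ → ℝ} {u w : ℝ} (hu : u ≠ 0) (hc : c k = 0) (h : (blP (k+1) c u).rootMultiplicity w = k+1) : w = 0 := by
  have h1 := blP_eq_of_mult hu h
  have h2 := blP_coeff (k+1) c u k
  rw [h1, if_pos (by omega), hc, coeff_C_mul, sub_eq_add_neg, ← C_neg, coeff_X_add_C_pow] at h2
  simp at h2
  rcases h2 with h2 | h2 | h2
  · exact absurd h2 hu
  · exact h2
  · have : (k:ℝ) + 1 ≠ 0 := by positivity
    exact absurd h2 this

open Polynomial in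
lemma blP_eval (k : ℕ) (c : ℕ → ℝ) (u w : ℝ) : (blP k c u).eval w = ∑ j ∈ Finset.range k, c j * w ^ j + u * w ^ k := by
  unfold blP
  simp [eval_finsetSum]

open Polynomial in
lemma prep_child {n : ℕ} {f : Fin n → ℝ × ℝ → ℝ} {N a p : ℕ} {h : ℝ → ℝ} {k : Fin n → ℕ} {ch : Fin n → ℕ → ℝ → ℝ}
    {U : Fin n → ℝ × ℝ → ℝ} (hP : Prep f N a p h k ch U) (w0 : ℝ) :
    ∃ F, Node f N (a + p) (fun s => h s + s ^ (a + p) * w0) (fun i => (blP (k i) (fun j => ch i j 0) (U i 0)).rootMultiplicity w0) F := by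
  refine ⟨fun i x => ∑ j ∈ Finset.range (k i), ch i j x.1 * (w0 + x.2) ^ j + (w0 + x.2) ^ k i * U i (x.1, x.1 ^ p * (w0 + x.2)), ?_⟩
  have a1 : AnalyticAt ℝ (fun x : ℝ × ℝ => x.1) 0 := analyticAt_fst
  have a2 : AnalyticAt ℝ (fun x : ℝ × ℝ => w0 + x.2) 0 := analyticAt_const.add analyticAt_snd
  have a3 : AnalyticAt ℝ (fun x : ℝ × ℝ => (x.1, x.1 ^ p * (w0 + x.2))) 0 := a1.prod ((a1.pow p).mul a2)
  have h00 : ((0:ℝ×ℝ).1, (0:ℝ×ℝ).1 ^ p * (w0 + (0:ℝ×ℝ).2)) = 0 := by simp [zero_pow hP.hp.ne']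
  have ht : Tendsto (fun x : ℝ × ℝ => (x.1, x.1 ^ p * (w0 + x.2))) (𝓝 0) (𝓝 0) := by
    have := a3.continuousAt.tendsto
    rwa [h00] at this
  refine ⟨hP.hN, hP.hNa.trans (Nat.le_add_right _ _), hP.hm.add ((measurable_id.pow_const _).mul_const _), fun i => ?_, fun i => ?_, fun i => ?_⟩
  · refine AnalyticAt.add (Finset.analyticAt_fun_sum _ fun j _ => ?_) ?_
    · exact (AnalyticAt.fun_comp (g := ch i j) (f := fun x => x.1) (x := 0) (hP.hc i j) a1).mul (a2.pow _)
    · exact (a2.pow _).mul (AnalyticAt.fun_comp (g := U i) (by rw [h00]; exact hP.hU i) a3)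
  · have hne := blP_ne (k := k i) (c := fun j => ch i j 0) (hP.hU0 i)
    set P := blP (k i) (fun j => ch i j 0) (U i 0) with hPd
    obtain ⟨Q, hQ, hQd⟩ := exists_eq_pow_rootMultiplicity_mul_and_not_dvd P hne w0
    refine ⟨fun w => Q.eval (w0 + w), ?_, ?_, ?_⟩
    · exact (Q.continuous.comp (continuous_const.add continuous_id)).continuousAt
    · show Q.eval (w0 + 0) ≠ 0
      rw [add_zero]
      intro hroot
      exact hQd (dvd_iff_isRoot.mpr hroot)
    · refine Eventually.of_forall fun w => ?_
      have e1 : P.eval (w0 + w) = w ^ P.rootMultiplicity w0 * Q.eval (w0 + w) := by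
        conv_lhs => rw [hQ]
        simp
      rw [← e1, hPd, blP_eval]
      simp only [zero_pow hP.hp.ne', zero_mul]
      rw [mul_comm (U i 0)]; rfl
  · obtain ⟨d, hd⟩ := hP.eq i
    refine ⟨d + p * k i, ?_⟩
    filter_upwards [ht.eventually hd] with x hx h1
    have := hx h1
    rw [show h x.1 + x.1 ^ (a + p) * w0 + x.1 ^ (a + p) * x.2 = h x.1 + x.1 ^ a * (x.1 ^ p * (w0 + x.2)) by rw [pow_add]; ring, this,
      pow_add, mul_assoc]
    congr 1
    rw [mul_add (x.1 ^ (p * k i)), Finset.mul_sum]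
    congr 1
    · refine Finset.sum_congr rfl fun j hj => ?_
      have hjk := Finset.mem_range.mp hj
      rw [mul_pow, ← pow_mul, show p * k i = p * (k i - j) + p * j by rw [← mul_add]; congr 1; omega, pow_add]
      ring
    · rw [mul_pow, ← pow_mul]; ring

def Reg (N a : ℕ) (h : ℝ → ℝ) (u v : ℝ) : Set (ℝ × ℝ) := {q | 0 < q.1 ∧ u < zz N a h q ∧ zz N a h q < v}

lemma Reg_meas (N a : ℕ) {h : ℝ → ℝ} (hh : Measurable h) (u v : ℝ) : MeasurableSet (Reg N a h u v) := by
  have q1 : MeasurableSet {q : ℝ × ℝ | 0 < q.1} := measurableSet_lt measurable_const measurable_fst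
  have q2 : MeasurableSet {q : ℝ × ℝ | u < zz N a h q} := measurableSet_lt measurable_const (zz_meas N a hh)
  have q3 : MeasurableSet {q : ℝ × ℝ | zz N a h q < v} := measurableSet_lt (zz_meas N a hh) measurable_const
  exact q1.inter (q2.inter q3)

lemma zz_shift (N a : ℕ) (h φ : ℝ → ℝ) {q : ℝ × ℝ} (hq : 0 < q.1) :
    zz N a (fun s => h s + s ^ a * φ s) q = zz N a h q - φ (ss N q.1) := by
  have := (pow_pos (ss_pos N hq) a).ne'
  unfold zz
  field_simp
  ring

lemma ss_mul {N q : ℕ} (hN : 0 < N) (hq : 0 < q) {x : ℝ} (hx : 0 < x) : ss (N * q) x ^ q = ss N x := by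
  have h1 : (ss (N*q) x ^ q) ^ N = x := by
    rw [← pow_mul, mul_comm q, pow_ss (Nat.mul_pos hN hq) hx.le]
  have h2 := ss_pow hN (pow_pos (ss_pos (N*q) hx) q).le
  rw [h1] at h2
  exact h2.symm

lemma zz_reparam {N q : ℕ} (a : ℕ) (hN : 0 < N) (hq : 0 < q) (h : ℝ → ℝ) {x : ℝ × ℝ} (hx : 0 < x.1) :
    zz (N * q) (a * q) (fun s => h (s ^ q)) x = zz N a h x := by
  unfold zz
  dsimp only
  rw [mul_comm a q, pow_mul, ss_mul hN hq hx]

lemma zz_child (N a p : ℕ) (h : ℝ → ℝ) {q : ℝ × ℝ} (hq : 0 < q.1) :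
    zz N a h q = zz N (a + p) h q * ss N q.1 ^ p := by
  have := (pow_pos (ss_pos N hq) a).ne'
  have := (pow_pos (ss_pos N hq) p).ne'
  unfold zz
  rw [pow_add]
  field_simp

lemma null_graph {g : ℝ → ℝ} (hg : Measurable g) : ∀ᵐ p : ℝ × ℝ, p.2 ≠ g p.1 := by
  have hm : MeasurableSet {p : ℝ × ℝ | p.2 ≠ g p.1} :=
    (measurableSet_eq_fun measurable_snd (hg.comp measurable_fst)).compl
  rw [Measure.volume_eq_prod]
  refine (Measure.ae_prod_iff_ae_ae hm).mpr (Eventually.of_forall fun x => ?_)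
  have : ∀ᵐ y : ℝ, y ≠ g x := by
    rw [ae_iff]; simp
  exact this

lemma null_zz (N a : ℕ) {h g : ℝ → ℝ} (hh : Measurable h) (hg : Measurable g) :
    ∀ᵐ q : ℝ × ℝ, 0 < q.1 → zz N a h q ≠ g q.1 := by
  have := null_graph (g := fun x => h (ss N x) + ss N x ^ a * g x)
    ((hh.comp (ss_meas N)).add (((ss_meas N).pow_const a).mul hg))
  filter_upwards [this] with q hq h0 h1
  apply hq
  have := (pow_pos (ss_pos N h0) a).ne'
  rw [← h1, zz]
  field_simp
  ring

lemma Reg_add {G : ℝ × ℝ → ℝ} (hG0 : ∀ p, 0 ≤ G p) {rG : ℝ} (hrG : 0 < rG) (hG : IntegrableOn G (disk2 rG))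
    (N a : ℕ) {h : ℝ → ℝ} (hh : Measurable h) (u v w : ℝ) (huv : u < v) (hvw : v < w)
    (h1 : EstS G (Reg N a h u v)) (h2 : EstS G (Reg N a h v w)) : EstS G (Reg N a h u w) := by
  refine EstS_congr' ?_ (EstS_union hG0 hrG hG ?_ (Reg_meas N a hh v w) h1 h2)
  · filter_upwards [null_zz N a hh (measurable_const (a := v))] with q hq
    constructor
    · rintro (h | h)
      · exact ⟨h.1, h.2.1, h.2.2.trans hvw⟩
      · exact ⟨h.1, huv.trans h.2.1, h.2.2⟩
    · rintro h
      rcases lt_or_gt_of_ne (hq h.1) with h3 | h3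
      · exact Or.inl ⟨h.1, h.2.1, h3⟩
      · exact Or.inr ⟨h.1, h3, h.2.2⟩
  · rw [Set.disjoint_left]
    intro q h h'
    exact lt_asymm h.2.2 h'.2.1

lemma small_disk {N : ℕ} (hN : 0 < N) {P : ℝ → Prop} (hP : ∀ᶠ s in 𝓝 (0:ℝ), P s) :
    ∃ ρ > 0, ∀ q ∈ disk2 ρ, 0 < q.1 → P (ss N q.1) := by
  obtain ⟨δ, hδ, h⟩ := Metric.eventually_nhds_iff.mp hP
  refine ⟨δ ^ N, pow_pos hδ N, fun q hq h0 => h ?_⟩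
  have h1 : q.1 ^ 2 + q.2 ^ 2 < (δ ^ N) ^ 2 := hq
  have h2 : q.1 ^ 2 < (δ ^ N) ^ 2 := by linarith [sq_nonneg q.2]
  have h3 := lt_of_pow_lt_pow_left₀ 2 (by positivity) h2
  rw [← pow_ss hN h0.le] at h3
  have h4 := lt_of_pow_lt_pow_left₀ N hδ.le h3
  rw [Real.dist_eq, sub_zero, abs_of_pos (ss_pos N h0)]
  exact h4

def RegT (N a p : ℕ) (h ψ : ℝ → ℝ) (τ L v : ℝ) : Set (ℝ × ℝ) :=
  {q | 0 < q.1 ∧ L * ss N q.1 ^ p < τ * zz N a h q ∧ τ * (zz N a h q + ψ (ss N q.1)) < v}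

lemma RegT_meas (N a p : ℕ) {h ψ : ℝ → ℝ} (hh : Measurable h) (hψ : Measurable ψ) (τ L v : ℝ) :
    MeasurableSet (RegT N a p h ψ τ L v) := by
  have q1 : MeasurableSet {q : ℝ × ℝ | 0 < q.1} := measurableSet_lt measurable_const measurable_fst
  have q2 : MeasurableSet {q : ℝ × ℝ | L * ss N q.1 ^ p < τ * zz N a h q} :=
    measurableSet_lt ((((ss_meas N).comp measurable_fst).pow_const p).const_mul L) ((zz_meas N a hh).const_mul τ)
  have q3 : MeasurableSet {q : ℝ × ℝ | τ * (zz N a h q + ψ (ss N q.1)) < v} :=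
    measurableSet_lt (((zz_meas N a hh).add (hψ.comp ((ss_meas N).comp measurable_fst))).const_mul τ) measurable_const
  exact q1.inter (q2.inter q3)

lemma mem_mid (N a p : ℕ) (h : ℝ → ℝ) (u v : ℝ) {q : ℝ × ℝ} (hq : 0 < q.1) :
    q ∈ Reg N (a + p) h u v ↔ u * ss N q.1 ^ p < zz N a h q ∧ zz N a h q < v * ss N q.1 ^ p := by
  have := pow_pos (ss_pos N hq) p
  rw [zz_child N a p h hq, mul_lt_mul_iff_left₀ this, mul_lt_mul_iff_left₀ this]
  exact ⟨fun h => h.2, fun h => ⟨hq, h⟩⟩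

lemma joinA {G : ℝ × ℝ → ℝ} (hG0 : ∀ p, 0 ≤ G p) {rG : ℝ} (hrG : 0 < rG) (hG : IntegrableOn G (disk2 rG))
    {N a p : ℕ} (hN : 0 < N) (hp : 0 < p) {h : ℝ → ℝ} (hh : Measurable h) {L v : ℝ} (hL : 0 ≤ L) (hv : 0 < v)
    (h1 : EstS G (RegT N a p h (fun _ => 0) 1 L v)) (h2 : EstS G (Reg N (a + p) h 0 L)) : EstS G (Reg N a h 0 v) := by
  have ev : ∀ᶠ s in 𝓝 (0:ℝ), L * s ^ p < v := by
    have : ContinuousAt (fun s : ℝ => L * s ^ p) 0 := by fun_prop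
    exact this.tendsto.eventually_lt_const (by simp [zero_pow hp.ne', hv])
  obtain ⟨ρ, hρ, hs⟩ := small_disk hN ev
  refine EstS_congr hρ ?_ (EstS_union hG0 hrG hG ?_ (Reg_meas N (a+p) hh 0 L) h1 h2)
  · filter_upwards [null_zz N a hh (g := fun x => L * ss N x ^ p) (((ss_meas N).pow_const p).const_mul L)] with q hq hd
    by_cases h0 : 0 < q.1
    · have hs1 := hs q hd h0
      have hq1 := hq h0
      have hsp := pow_pos (ss_pos N h0) p
      have hLs := mul_nonneg hL hsp.le
      rw [Set.mem_union, mem_mid N a p h 0 L h0]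
      simp only [RegT, Reg, Set.mem_ofPred_eq, one_mul, add_zero, zero_mul]
      constructor
      · rintro (h | h)
        · exact ⟨h0, lt_of_le_of_lt hLs h.2.1, h.2.2⟩
        · exact ⟨h0, h.1, h.2.trans hs1⟩
      · rintro h
        rcases lt_or_gt_of_ne hq1 with h3 | h3
        · exact Or.inr ⟨h.2.1, h3⟩
        · exact Or.inl ⟨h0, h3, h.2.2⟩
    · constructor
      · rintro (h | h)
        · exact absurd h.1 h0
        · exact absurd h.1 h0
      · intro h; exact absurd h.1 h0
  · rw [Set.disjoint_left]
    intro q h h'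
    have h4 := ((mem_mid N a p _ 0 L h.1).mp h').2
    have h5 := h.2.1
    rw [one_mul] at h5
    exact lt_asymm h4 h5

lemma joinB {G : ℝ × ℝ → ℝ} (hG0 : ∀ p, 0 ≤ G p) {rG : ℝ} (hrG : 0 < rG) (hG : IntegrableOn G (disk2 rG))
    {N a p : ℕ} (hN : 0 < N) (hp : 0 < p) {h ψ : ℝ → ℝ} (hh : Measurable h) (hψm : Measurable ψ) (hψ : ContinuousAt ψ 0)
    (hψ0 : ψ 0 = 0) {L v L' v' : ℝ} (hL : 0 ≤ L) (hv : 0 < v) (hL' : 0 ≤ L') (hv' : 0 < v')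
    (h1 : EstS G (RegT N a p h ψ 1 L v)) (h2 : EstS G (Reg N (a + p) h (-L') L)) (h3 : EstS G (RegT N a p h ψ (-1) L' v')) :
    EstS G {q | 0 < q.1 ∧ -v' < zz N a h q + ψ (ss N q.1) ∧ zz N a h q + ψ (ss N q.1) < v} := by
  have ev : ∀ᶠ s in 𝓝 (0:ℝ), L * s ^ p + |ψ s| < v ∧ L' * s ^ p + |ψ s| < v' := by
    have c1 : ContinuousAt (fun s : ℝ => L * s ^ p + |ψ s|) 0 := by fun_prop
    have c2 : ContinuousAt (fun s : ℝ => L' * s ^ p + |ψ s|) 0 := by fun_prop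
    exact (c1.tendsto.eventually_lt_const (by simp [zero_pow hp.ne', hv, hψ0])).and
      (c2.tendsto.eventually_lt_const (by simp [zero_pow hp.ne', hv', hψ0]))
  obtain ⟨ρ, hρ, hs⟩ := small_disk hN ev
  refine EstS_congr hρ ?_ (EstS_union hG0 hrG hG ?_ (Reg_meas N (a+p) hh (-L') L) 
    (EstS_union hG0 hrG hG ?_ (RegT_meas N a p hh hψm (-1) L' v') h1 h3) h2)
  · filter_upwards [null_zz N a hh (g := fun x => L * ss N x ^ p) (((ss_meas N).pow_const p).const_mul L),
      null_zz N a hh (g := fun x => -L' * ss N x ^ p) (((ss_meas N).pow_const p).const_mul (-L'))] with q hq hq' hd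
    by_cases h0 : 0 < q.1
    · obtain ⟨hs1, hs2⟩ := hs q hd h0
      have hq1 := hq h0
      have hq2 := hq' h0
      have hsp := pow_pos (ss_pos N h0) p
      have hLs := mul_nonneg hL hsp.le
      have hLs' := mul_nonneg hL' hsp.le
      have ha := neg_abs_le (ψ (ss N q.1))
      have hb := le_abs_self (ψ (ss N q.1))
      rw [Set.mem_union, mem_mid N a p h (-L') L h0]
      simp only [RegT, Set.mem_union, Set.mem_ofPred_eq, one_mul, neg_mul]
      rw [neg_mul] at hq2
      constructor
      · rintro ((h | h) | h)
        · exact ⟨h0, by linarith [h.2.1], h.2.2⟩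
        · exact ⟨h0, by linarith [h.2.2], by linarith [h.2.1]⟩
        · exact ⟨h0, by linarith [h.1], by linarith [h.2]⟩
      · rintro ⟨_, h3, h4⟩
        rcases lt_or_gt_of_ne hq1 with h5 | h5
        · rcases lt_or_gt_of_ne hq2 with h6 | h6
          · exact Or.inl (Or.inr ⟨h0, by linarith, by linarith⟩)
          · exact Or.inr ⟨h6, h5⟩
        · exact Or.inl (Or.inl ⟨h0, h5, h4⟩)
    · constructor
      · rintro ((h | h) | h)
        · exact absurd h.1 h0
        · exact absurd h.1 h0
        · exact absurd h.1 h0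
      · intro h; exact absurd h.1 h0
  · rw [Set.disjoint_left]
    rintro q (h | h) h'
    · have h4 := ((mem_mid N a p _ (-L') L h.1).mp h').2
      have h5 := h.2.1
      rw [one_mul] at h5
      exact lt_asymm h4 h5
    · have h4 := ((mem_mid N a p _ (-L') L h.1).mp h').1
      have h5 := h.2.1
      linarith
  · rw [Set.disjoint_left]
    intro q h h'
    have hsp := pow_pos (ss_pos N h.1) p
    have hLs := mul_nonneg hL hsp.le
    have hLs' := mul_nonneg hL' hsp.le
    linarith [h.2.1, h'.2.1]

lemma TB_shift {N a b : ℕ} {h φ : ℝ → ℝ} (hT : TB N a h) (hab : a ≤ b) (hφ : AnalyticAt ℝ φ 0) (h0 : φ 0 = 0 ∨ a < b) :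
    TB N b (fun s => h s + s ^ b * φ s) := by
  obtain ⟨m, hh, hm, hma, hA, hh0, he⟩ := hT
  refine ⟨m, fun s => hh s + s ^ (b - m) * φ s, hm, hma.trans hab, hA.add ((analyticAt_id.pow _).mul hφ), ?_, ?_⟩
  · have : (0:ℝ) ^ (b - m) * φ 0 = 0 := by
      rcases h0 with h0 | h0
      · rw [h0, mul_zero]
      · rw [zero_pow (by omega), zero_mul]
    show hh 0 + (0:ℝ) ^ (b - m) * φ 0 ≠ 0
    rw [this, add_zero]; exact hh0
  · filter_upwards [he] with s hs
    rw [hs, mul_add, ← mul_assoc, ← pow_add]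
    congr 3; omega

lemma TB_reparam {N a q : ℕ} {h : ℝ → ℝ} (hT : TB N a h) (hq : 0 < q) : TB (N * q) (a * q) (fun s => h (s ^ q)) := by
  obtain ⟨m, hh, hm, hma, hA, hh0, he⟩ := hT
  have hpow : AnalyticAt ℝ (fun s : ℝ => s ^ q) 0 := analyticAt_id.pow q
  have ht : Tendsto (fun s : ℝ => s ^ q) (𝓝 0) (𝓝 0) := by
    have := hpow.continuousAt.tendsto
    rwa [zero_pow hq.ne'] at this
  refine ⟨m * q, fun s => hh (s ^ q), Nat.mul_lt_mul_of_pos_right hm hq, Nat.mul_le_mul_right q hma,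
    AnalyticAt.fun_comp (g := hh) (by rw [zero_pow hq.ne']; exact hA) hpow, ?_, ?_⟩
  · show hh (0 ^ q) ≠ 0
    rw [zero_pow hq.ne']; exact hh0
  · filter_upwards [ht.eventually he] with s hs
    rw [hs, ← pow_mul, mul_comm q]

lemma Reg_shift (N a : ℕ) (h : ℝ → ℝ) (w u v : ℝ) :
    Reg N a (fun s => h s + s ^ a * w) u v = Reg N a h (w + u) (w + v) := by
  ext q
  by_cases hq : 0 < q.1
  · have := zz_shift N a h (fun _ => w) hq
    simp only [Reg, Set.mem_ofPred_eq]
    rw [this]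
    constructor <;> rintro ⟨_, h1, h2⟩ <;> exact ⟨hq, by linarith, by linarith⟩
  · exact ⟨fun h => absurd h.1 hq, fun h => absurd h.1 hq⟩

lemma step {n : ℕ} {f : Fin n → ℝ × ℝ → ℝ} {N a : ℕ} {h : ℝ → ℝ} {k : Fin n → ℕ} {F : Fin n → ℝ × ℝ → ℝ}
    (hn : Node f N a h k F) {φ : ℝ → ℝ} (hφm : Measurable φ) (hφ : AnalyticAt ℝ φ 0) (h0 : φ 0 = 0) :
    ∃ q p : ℕ, 0 < q ∧ ∃ (ch : Fin n → ℕ → ℝ → ℝ) (U : Fin n → ℝ × ℝ → ℝ), Prep f (N * q) (a * q) p (fun s => h (s ^ q) + (s ^ q) ^ a * φ (s ^ q)) k ch U ∧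
      ((∃ i, ∃ j < k i, ch i j 0 ≠ 0) ∨ ∀ i j, ch i j = fun _ => 0) ∧
      ∀ i0 k', k i0 = k' + 1 → (∀ (c : ℕ → ℝ → ℝ) (U : ℝ × ℝ → ℝ), AnalyticAt ℝ U 0 → (∀ᶠ p in 𝓝 (0 : ℝ × ℝ), F i0 (p.1, p.2 + φ p.1) =
        ∑ j ∈ Finset.range (k' + 1), c j p.1 * p.2 ^ j + p.2 ^ (k' + 1) * U p) → ∀ᶠ s in 𝓝 (0:ℝ), c k' s = 0) → ch i0 k' 0 = 0 := by
  have hn' := node_shift hn hφm hφ h0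
  choose c U hc hc0 hU hU0 hFe using fun i => taylorZ (k i) (hn'.hF i) (hn'.ord i)
  obtain ⟨q, p, hq, hp, ch, hch, hcc, halt⟩ := newton k hc hc0
  refine ⟨q, p, hq, ch, _, node_prep hn' hq hp hU hU0 hFe hch hcc, halt, fun i0 k' hk H => ?_⟩
  have h1 := H (c i0) (U i0) (hU i0) (by have := hFe i0; rw [hk] at this; exact this)
  have ht : Tendsto (fun s : ℝ => s ^ q) (𝓝 0) (𝓝 0) := by
    have : ContinuousAt (fun s : ℝ => s ^ q) 0 := by fun_prop
    have := this.tendsto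
    rwa [zero_pow hq.ne'] at this
  have h2 := hcc i0 k' (by omega)
  have h3 : ∀ᶠ s in 𝓝[≠] (0:ℝ), ch i0 k' s = 0 := by
    filter_upwards [(ht.eventually h1).filter_mono nhdsWithin_le_nhds, h2.filter_mono nhdsWithin_le_nhds, self_mem_nhdsWithin] with s a1 a2 a3
    rw [a1] at a2
    exact (mul_eq_zero.mp a2.symm).resolve_left (pow_ne_zero _ a3)
  have h4 : Tendsto (ch i0 k') (𝓝[≠] 0) (𝓝 (ch i0 k' 0)) := (hch i0 k').continuousAt.tendsto.mono_left nhdsWithin_le_nhds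
  exact tendsto_nhds_unique h4 (tendsto_const_nhds.congr' (h3.mono fun s hs => hs.symm))

lemma child_lt {n : ℕ} {f : Fin n → ℝ × ℝ → ℝ} {N a p : ℕ} {h : ℝ → ℝ} {k : Fin n → ℕ} {ch : Fin n → ℕ → ℝ → ℝ}
    {U : Fin n → ℝ × ℝ → ℝ} (hP : Prep f N a p h k ch U) (hne : ∃ i, ∃ j < k i, ch i j 0 ≠ 0) (w0 : ℝ)
    (H : w0 = 0 ∨ ∃ i0 k', k i0 = k' + 1 ∧ ch i0 k' 0 = 0) :
    ∑ i, (blP (k i) (fun j => ch i j 0) (U i 0)).rootMultiplicity w0 < ∑ i, k i := by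
  refine Finset.sum_lt_sum (fun i _ => blP_mult_le (hP.hU0 i) w0) ?_
  by_contra hcon
  push Not at hcon
  have heq : ∀ i, (blP (k i) (fun j => ch i j 0) (U i 0)).rootMultiplicity w0 = k i :=
    fun i => le_antisymm (blP_mult_le (hP.hU0 i) w0) (hcon i (Finset.mem_univ i))
  have hw : w0 = 0 := by
    rcases H with H | ⟨i0, k', hk, hc⟩
    · exact H
    · have := heq i0
      rw [hk] at this
      exact blP_tsch (hP.hU0 i0) hc this
  subst hw
  obtain ⟨i, j, hj, hij⟩ := hne
  exact hij (blP_zero_root (hP.hU0 i) (heq i) j hj)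

lemma Reg_empty (N a : ℕ) (h : ℝ → ℝ) : Reg N a h 0 0 = ∅ := by
  ext q
  simp only [Set.mem_empty_iff_false, iff_false]
  intro h
  exact lt_asymm h.2.1 h.2.2

lemma one_le_aux {ρ ρ' L : ℝ} (hρ : 0 < ρ) (h : ρ ≤ ρ') (hL : 1 / ρ ≤ L) : 1 ≤ ρ' * L := by
  have h1 : 0 < 1 / ρ := by positivity
  calc 1 = ρ * (1/ρ) := by field_simp
    _ ≤ ρ' * L := mul_le_mul h hL h1.le (hρ.le.trans h)

lemma claimB {n : ℕ} {f : Fin n → ℝ × ℝ → ℝ} {γ : Fin n → ℝ} {rG : ℝ} (hrG : 0 < rG)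
    (hG : IntegrableOn (fun p => ∏ i, |f i p| ^ γ i) (disk2 rG)) : ∀ (K N a : ℕ) (h : ℝ → ℝ) (k : Fin n → ℕ)
    (F : Fin n → ℝ × ℝ → ℝ), ∑ i, k i = K → Node f N a h k F → TB N a h →
    ∃ δ > 0, ∀ u ∈ Ioo (-δ) 0, ∀ v ∈ Ioo 0 δ, EstS (fun p => ∏ i, |f i p| ^ γ i) (Reg N a h u v) := by
  intro K
  induction K using Nat.strong_induction_on with
  | _ K IH =>
  intro N a h k F hK hn hT
  have hG0 : ∀ p, 0 ≤ ∏ i, |f i p| ^ γ i := fun p => Finset.prod_nonneg fun i _ => rpow_nonneg (abs_nonneg _) _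
  obtain ⟨φ, hφm, hφ, hφ0, hts⟩ : ∃ φ : ℝ → ℝ, Measurable φ ∧ AnalyticAt ℝ φ 0 ∧ φ 0 = 0 ∧ ((∀ i, k i = 0) ∨ ∃ i0 k', k i0 = k' + 1 ∧
      ∀ (c : ℕ → ℝ → ℝ) (U : ℝ × ℝ → ℝ), AnalyticAt ℝ U 0 → (∀ᶠ p in 𝓝 (0 : ℝ × ℝ), F i0 (p.1, p.2 + φ p.1) =
        ∑ j ∈ Finset.range (k' + 1), c j p.1 * p.2 ^ j + p.2 ^ (k' + 1) * U p) → ∀ᶠ s in 𝓝 (0:ℝ), c k' s = 0) := by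
    by_cases hk : ∀ i, k i = 0
    · exact ⟨fun _ => 0, measurable_const, analyticAt_const, rfl, Or.inl hk⟩
    · push Not at hk
      obtain ⟨i0, hi0⟩ := hk
      obtain ⟨k', hk'⟩ := Nat.exists_eq_succ_of_ne_zero hi0
      have ho := hn.ord i0
      rw [hk'] at ho
      obtain ⟨φ, h1, h2, h3, h4⟩ := tsch (hn.hF i0) ho
      exact ⟨φ, h1, h2, h3, Or.inr ⟨i0, k', hk', h4⟩⟩
  obtain ⟨q, p, hq, ch, U, hP, halt, hst⟩ := step hn hφm hφ hφ0
  have hT2 : TB (N * q) (a * q) (fun s => h (s ^ q) + (s ^ q) ^ a * φ (s ^ q)) :=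
    TB_reparam (TB_shift hT le_rfl hφ (Or.inl hφ0)) hq
  have hzz : ∀ x : ℝ × ℝ, 0 < x.1 → zz (N * q) (a * q) (fun s => h (s ^ q) + (s ^ q) ^ a * φ (s ^ q)) x
      + φ (ss (N * q) x.1 ^ q) = zz N a h x := by
    intro x hx
    have h1 := zz_reparam a hn.hN hq (fun s => h s + s ^ a * φ s) hx
    rw [zz_shift N a h φ hx] at h1
    rw [ss_mul hn.hN hq hx]
    linarith
  have hfin : ∀ u v, EstS (fun p => ∏ i, |f i p| ^ γ i) {x | 0 < x.1 ∧ - (-u) < zz (N * q) (a * q) (fun s => h (s ^ q) + (s ^ q) ^ a * φ (s ^ q)) x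
      + φ (ss (N * q) x.1 ^ q) ∧ zz (N * q) (a * q) (fun s => h (s ^ q) + (s ^ q) ^ a * φ (s ^ q)) x
      + φ (ss (N * q) x.1 ^ q) < v} → EstS (fun p => ∏ i, |f i p| ^ γ i) (Reg N a h u v) := by
    intro u v H
    refine EstS_congr' (Eventually.of_forall fun x => ?_) H
    simp only [Reg, Set.mem_ofPred_eq, neg_neg]
    constructor <;> rintro ⟨h1, h2, h3⟩
    · rw [hzz x h1] at h2 h3; exact ⟨h1, h2, h3⟩
    · rw [← hzz x h1] at h2 h3; exact ⟨h1, h2, h3⟩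
  have hpow : AnalyticAt ℝ (fun s : ℝ => s ^ q) 0 := analyticAt_id.pow q
  have hψ : AnalyticAt ℝ (fun s => φ (s ^ q)) 0 := AnalyticAt.fun_comp (g := φ) (by rw [zero_pow hq.ne']; exact hφ) hpow
  have hψ0 : (fun s => φ (s ^ q)) 0 = 0 := by simp only [zero_pow hq.ne', hφ0]
  have hψm : Measurable (fun s => φ (s ^ q)) := hφm.comp (measurable_id.pow_const q)
  generalize (fun s => h (s ^ q) + (s ^ q) ^ a * φ (s ^ q)) = h2 at *
  have hm2 := hP.hm
  rcases halt with hne | hall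
  · have hch : ∀ w0 : ℝ, ∃ δ > 0, ∀ u ∈ Ioo (w0 - δ) w0, ∀ v ∈ Ioo w0 (w0 + δ),
        EstS (fun p => ∏ i, |f i p| ^ γ i) (Reg (N*q) (a*q+p) h2 u v) := by
      intro w0
      obtain ⟨F', hF'⟩ := prep_child hP w0
      have hlt := child_lt hP hne w0 (Or.inr (by
        rcases hts with h0 | ⟨i0, k', hk', h4⟩
        · obtain ⟨i, j, hj, _⟩ := hne
          rw [h0 i] at hj; omega
        · exact ⟨i0, k', hk', hst i0 k' hk' h4⟩))
      obtain ⟨δ, hδ, H⟩ := IH _ (hK ▸ hlt) _ _ _ _ F' rfl hF'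
        (TB_shift (φ := fun _ => w0) hT2 (Nat.le_add_right _ _) analyticAt_const (Or.inr (Nat.lt_add_of_pos_right hP.hp)))
      refine ⟨δ, hδ, fun u hu v hv => ?_⟩
      have := H (u - w0) ⟨by linarith [hu.1], by linarith [hu.2]⟩ (v - w0) ⟨by linarith [hv.1], by linarith [hv.2]⟩
      rw [Reg_shift] at this
      simpa using this
    obtain ⟨ρ1, hρ1, H1⟩ := region1 hrG hG hP.hN hP.hp hm2 hψm hψ hψ0 zero_le_one (Or.inl rfl) (YC_B hT2 (Or.inl rfl))
      (prep_region1 hP (Or.inl rfl))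
    obtain ⟨ρ2, hρ2, H2⟩ := region1 hrG hG hP.hN hP.hp hm2 hψm hψ hψ0 zero_le_one (Or.inr rfl) (YC_B hT2 (Or.inr rfl))
      (prep_region1 hP (Or.inl rfl))
    have hρ : 0 < min ρ1 ρ2 := lt_min hρ1 hρ2
    have hL : 0 < 1 / min ρ1 ρ2 := by positivity
    obtain ⟨δ, hδ, Hb⟩ := hch (-(1 / min ρ1 ρ2))
    obtain ⟨β, hβ, Hβ⟩ := glue (P := fun u v => EstS (fun p => ∏ i, |f i p| ^ γ i) (Reg (N*q) (a*q+p) h2 u v))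
      (fun u v w h1 h3 => Reg_add hG0 hrG hG _ _ hm2 u v w h1 h3) (u0 := -(1 / min ρ1 ρ2) - δ/2) (a := -(1 / min ρ1 ρ2))
      (B := 1 / min ρ1 ρ2) (by linarith) (by linarith)
      ⟨δ, hδ, fun v hv => Hb _ ⟨by linarith, by linarith⟩ v hv⟩ (fun ζ _ => hch ζ)
    refine ⟨min ρ1 ρ2, hρ, fun u hu v hv => hfin u v ?_⟩
    have hmid := Hβ ((1 / min ρ1 ρ2 + β)/2) ⟨by linarith, by linarith⟩
    refine joinB hG0 hrG hG hP.hN hP.hp hm2 hψm hψ.continuousAt hψ0 (L := (1 / min ρ1 ρ2 + β)/2) (L' := 1 / min ρ1 ρ2 + δ/2)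
      (by linarith) hv.1 (by linarith) (by linarith [hu.2])
      (H1 v hv.1 (hv.2.trans_le (min_le_left _ _)) _ (by linarith) (one_le_aux hρ (min_le_left _ _) (by linarith))) ?_
      (H2 (-u) (by linarith [hu.2]) (lt_of_lt_of_le (by linarith [hu.1]) (min_le_right ρ1 ρ2)) _ (by linarith) (one_le_aux hρ (min_le_right _ _) (by linarith)))
    convert hmid using 2
    ring
  · obtain ⟨ρ1, hρ1, H1⟩ := region1 hrG hG hP.hN hP.hp hm2 hψm hψ hψ0 le_rfl (Or.inl rfl) (YC_B hT2 (Or.inl rfl))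
      (prep_region1 hP (Or.inr ⟨rfl, hall⟩))
    obtain ⟨ρ2, hρ2, H2⟩ := region1 hrG hG hP.hN hP.hp hm2 hψm hψ hψ0 le_rfl (Or.inr rfl) (YC_B hT2 (Or.inr rfl))
      (prep_region1 hP (Or.inr ⟨rfl, hall⟩))
    refine ⟨min ρ1 ρ2, lt_min hρ1 hρ2, fun u hu v hv => hfin u v ?_⟩
    refine joinB hG0 hrG hG hP.hN hP.hp hm2 hψm hψ.continuousAt hψ0 (L := 0) (L' := 0) le_rfl hv.1 le_rfl (by linarith [hu.2])
      (H1 v hv.1 (hv.2.trans_le (min_le_left _ _)) 0 le_rfl (by simp)) ?_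
      (H2 (-u) (by linarith [hu.2]) (lt_of_lt_of_le (by linarith [hu.1]) (min_le_right ρ1 ρ2)) 0 le_rfl (by simp))
    rw [neg_zero, Reg_empty]
    exact EstS_empty _

lemma Node_congr {n : ℕ} {f : Fin n → ℝ × ℝ → ℝ} {N a : ℕ} {h h' : ℝ → ℝ} {k : Fin n → ℕ} {F : Fin n → ℝ × ℝ → ℝ}
    (hn : Node f N a h k F) (e : h = h') : Node f N a h' k F := e ▸ hn

lemma claimA {n : ℕ} {f : Fin n → ℝ × ℝ → ℝ} {γ : Fin n → ℝ} {rG : ℝ} (hrG : 0 < rG)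
    (hG : IntegrableOn (fun p => ∏ i, |f i p| ^ γ i) (disk2 rG)) : ∀ (K N a : ℕ) (k : Fin n → ℕ)
    (F : Fin n → ℝ × ℝ → ℝ), ∑ i, k i = K → Node f N a (fun _ => 0) k F →
    ∃ δ > 0, ∀ v ∈ Ioo 0 δ, EstS (fun p => ∏ i, |f i p| ^ γ i) (Reg N a (fun _ => 0) 0 v) := by
  intro K
  induction K using Nat.strong_induction_on with
  | _ K IH =>
  intro N a k F hK hn
  have hG0 : ∀ p, 0 ≤ ∏ i, |f i p| ^ γ i := fun p => Finset.prod_nonneg fun i _ => rpow_nonneg (abs_nonneg _) _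
  obtain ⟨q, p, hq, ch, U, hP, halt, -⟩ := step hn (measurable_const (a := (0:ℝ))) analyticAt_const rfl
  simp only [mul_zero, add_zero] at hP
  have hfin : ∀ v, EstS (fun p => ∏ i, |f i p| ^ γ i) (Reg (N * q) (a * q) (fun _ => 0) 0 v) →
      EstS (fun p => ∏ i, |f i p| ^ γ i) (Reg N a (fun _ => 0) 0 v) := by
    intro v H
    refine EstS_congr' (Eventually.of_forall fun x => ?_) H
    simp only [Reg, Set.mem_ofPred_eq]
    constructor <;> rintro ⟨h1, h2, h3⟩
    · have := zz_reparam a hn.hN hq (fun _ => 0) h1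
      rw [this] at h2 h3; exact ⟨h1, h2, h3⟩
    · have := zz_reparam a hn.hN hq (fun _ => 0) h1
      rw [← this] at h2 h3; exact ⟨h1, h2, h3⟩
  rcases halt with hne | hall
  · have hbase : ∃ δ > 0, ∀ v ∈ Ioo (0:ℝ) (0 + δ), EstS (fun p => ∏ i, |f i p| ^ γ i) (Reg (N*q) (a*q+p) (fun _ => 0) 0 v) := by
      obtain ⟨F', hF'⟩ := prep_child hP 0
      have hlt := child_lt hP hne 0 (Or.inl rfl)
      obtain ⟨δ, hδ, H⟩ := IH _ (hK ▸ hlt) _ _ _ F' rfl (Node_congr hF' (by funext s; ring))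
      exact ⟨δ, hδ, by simpa using H⟩
    have hch : ∀ w0 : ℝ, w0 ≠ 0 → ∃ δ > 0, ∀ u ∈ Ioo (w0 - δ) w0, ∀ v ∈ Ioo w0 (w0 + δ),
        EstS (fun p => ∏ i, |f i p| ^ γ i) (Reg (N*q) (a*q+p) (fun _ => 0) u v) := by
      intro w0 hw0
      obtain ⟨F', hF'⟩ := prep_child hP w0
      obtain ⟨δ, hδ, H⟩ := claimB hrG hG _ _ _ _ _ F' rfl hF'
        ⟨a * q + p, fun _ => w0, lt_of_le_of_lt hP.hNa (Nat.lt_add_of_pos_right hP.hp), le_rfl, analyticAt_const, hw0,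
          Eventually.of_forall fun s => by ring⟩
      refine ⟨δ, hδ, fun u hu v hv => ?_⟩
      have := H (u - w0) ⟨by linarith [hu.1], by linarith [hu.2]⟩ (v - w0) ⟨by linarith [hv.1], by linarith [hv.2]⟩
      rw [Reg_shift] at this
      simpa using this
    obtain ⟨ρ1, hρ1, H1⟩ := region1 hrG hG hP.hN hP.hp hP.hm (measurable_const (a := (0:ℝ))) analyticAt_const rfl zero_le_one (Or.inl rfl) (YC_A hP.hN hP.hNa (Or.inl rfl))
      (prep_region1 hP (Or.inl rfl))
    have hL : 0 < 1 / ρ1 := by positivity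
    obtain ⟨β, hβ, Hβ⟩ := glue (P := fun u v => EstS (fun p => ∏ i, |f i p| ^ γ i) (Reg (N*q) (a*q+p) (fun _ => 0) u v))
      (fun u v w h1 h3 => Reg_add hG0 hrG hG _ _ hP.hm u v w h1 h3) (u0 := 0) (a := 0)
      (B := 1 / ρ1) le_rfl hL.le hbase (fun ζ hζ => hch ζ hζ.1.ne')
    refine ⟨ρ1, hρ1, fun v hv => hfin v ?_⟩
    have hmid := Hβ ((1 / ρ1 + β)/2) ⟨by linarith, by linarith⟩
    exact joinA hG0 hrG hG hP.hN hP.hp hP.hm (L := (1 / ρ1 + β)/2) (by linarith) hv.1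
      (H1 v hv.1 hv.2 _ (by linarith) (one_le_aux hρ1 le_rfl (by linarith))) hmid
  · obtain ⟨ρ1, hρ1, H1⟩ := region1 hrG hG hP.hN hP.hp hP.hm (measurable_const (a := (0:ℝ))) analyticAt_const rfl le_rfl (Or.inl rfl) (YC_A hP.hN hP.hNa (Or.inl rfl))
      (prep_region1 hP (Or.inr ⟨rfl, hall⟩))
    refine ⟨ρ1, hρ1, fun v hv => hfin v ?_⟩
    refine joinA hG0 hrG hG hP.hN hP.hp hP.hm (L := 0) le_rfl hv.1
      (H1 v hv.1 hv.2 0 le_rfl (by simp)) ?_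
    rw [Reg_empty]
    exact EstS_empty _

structure LP (f : ℝ × ℝ → ℝ) (d : ℕ) (P : ℝ × ℝ → ℝ) : Prop where
  an : AnalyticAt ℝ f 0
  P_an : ∀ x, AnalyticAt ℝ P x
  hom : ∀ (c : ℝ) x, P (c • x) = c ^ d * P x
  rem : ∃ C, ∀ᶠ x in 𝓝 (0 : ℝ × ℝ), |f x - P x| ≤ C * ‖x‖ ^ (d + 1)

lemma lp_of {f : ℝ × ℝ → ℝ} (hf : AnalyticAt ℝ f 0) :
    ∃ P, LP f (vanishingOrder f) P ∧ ∀ x, lowestPart f x ≠ 0 → P x ≠ 0 := by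
  obtain ⟨p, hp⟩ := hf
  obtain ⟨r, hr⟩ := hp
  have hfac := fun (y : ℝ × ℝ) n => hr.factorial_smul y n
  set d := vanishingOrder f with hd
  have hlow : ∀ k < d, ∀ y : ℝ × ℝ, p k (fun _ => y) = 0 := by
    intro k hk y
    have h1 : iteratedFDeriv ℝ k f 0 = 0 := by
      have := Nat.notMem_of_lt_sInf hk
      simpa using this
    have h2 := hfac y k
    rw [h1] at h2
    have h3 : (k.factorial : ℝ) ≠ 0 := by exact_mod_cast k.factorial_ne_zero
    rw [nsmul_eq_mul] at h2
    simpa [h3] using h2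
  refine ⟨fun x => p d (fun _ => x), ⟨⟨p, r, hr⟩, ?_, ?_, ?_⟩, ?_⟩
  · intro x
    have h1 : AnalyticAt ℝ (fun x : ℝ × ℝ => (fun _ : Fin d => x)) x :=
      AnalyticAt.pi fun _ => analyticAt_id
    exact AnalyticAt.fun_comp (g := fun v => p d v) (p d).analyticAt h1
  · intro c x
    have := (p d).map_smul_univ (fun _ => c) (fun _ => x)
    simpa using this
  · have h1 := HasFPowerSeriesAt.isBigO_sub_partialSum_pow ⟨r, hr⟩ (d + 1)
    obtain ⟨C, hC⟩ := h1.bound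
    refine ⟨C, hC.mono fun x hx => ?_⟩
    have h2 : p.partialSum (d + 1) x = p d (fun _ => x) := by
      rw [FormalMultilinearSeries.partialSum, Finset.sum_range_succ, Finset.sum_eq_zero, zero_add]
      intro k hk
      exact hlow k (Finset.mem_range.mp hk) x
    rw [h2] at hx
    simpa using hx
  · intro x hx h0
    apply hx
    have := hfac x d
    dsimp only at h0
    rw [h0] at this
    rw [lowestPart, ← hd, ← this]
    simp

lemma lp_comp {f P : ℝ × ℝ → ℝ} {d : ℕ} (h : LP f d P) (T : (ℝ × ℝ) ≃L[ℝ] (ℝ × ℝ)) :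
    LP (fun p => f (T p)) d (fun p => P (T p)) := by
  have hT : ∀ x, AnalyticAt ℝ (fun p => T p) x := fun x => (T : (ℝ × ℝ) →L[ℝ] (ℝ × ℝ)).analyticAt x
  refine ⟨AnalyticAt.fun_comp (g := f) (by simpa using h.an) (hT 0), fun x => AnalyticAt.fun_comp (g := P) (h.P_an _) (hT x),
    fun c x => by rw [map_smul]; exact h.hom c _, ?_⟩
  obtain ⟨C, hC⟩ := h.rem
  have ht : Tendsto (fun p => T p) (𝓝 0) (𝓝 0) := by
    have := T.continuous.tendsto 0
    simpa using this
  refine ⟨|C| * ‖(T : (ℝ × ℝ) →L[ℝ] (ℝ × ℝ))‖ ^ (d + 1), (ht.eventually hC).mono fun x hx => hx.trans ?_⟩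
  rw [mul_assoc, ← mul_pow]
  have := (T : (ℝ × ℝ) →L[ℝ] (ℝ × ℝ)).le_opNorm x
  have h2 : ‖T x‖ ≤ ‖(T : (ℝ × ℝ) →L[ℝ] (ℝ × ℝ))‖ * ‖x‖ := this
  gcongr
  exact le_abs_self C

lemma lp_blow {f P : ℝ × ℝ → ℝ} {d : ℕ} (h : LP f d P) (z0 : ℝ) :
    ∃ F : ℝ × ℝ → ℝ, AnalyticAt ℝ F 0 ∧ (∀ᶠ q in 𝓝 (0 : ℝ × ℝ), f (q.1, q.1 * (z0 + q.2)) = q.1 ^ d * F q) ∧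
      ∀ z, F (0, z) = P (1, z0 + z) := by
  have hm : AnalyticAt ℝ (fun q : ℝ × ℝ => (q.1, q.1 * (z0 + q.2))) 0 :=
    analyticAt_fst.prod (analyticAt_fst.mul (analyticAt_const.add analyticAt_snd))
  have hm0 : (((0:ℝ × ℝ).1, (0:ℝ × ℝ).1 * (z0 + (0:ℝ × ℝ).2)) : ℝ × ℝ) = 0 := by simp
  have hfm : AnalyticAt ℝ (fun q : ℝ × ℝ => f (q.1, q.1 * (z0 + q.2))) 0 := by
    refine AnalyticAt.fun_comp (g := f) (f := fun q : ℝ × ℝ => (q.1, q.1 * (z0 + q.2))) (x := 0) ?_ hm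
    rw [hm0]; exact h.an
  have hPm : AnalyticAt ℝ (fun q : ℝ × ℝ => P (q.1, q.1 * (z0 + q.2))) 0 :=
    AnalyticAt.fun_comp (g := P) (f := fun q : ℝ × ℝ => (q.1, q.1 * (z0 + q.2))) (x := 0) (h.P_an _) hm
  obtain ⟨C, hC⟩ := h.rem
  have ht : Tendsto (fun q : ℝ × ℝ => (q.1, q.1 * (z0 + q.2))) (𝓝 0) (𝓝 0) := by
    have := hm.continuousAt.tendsto
    rwa [hm0] at this
  have hb : ∀ᶠ q : ℝ × ℝ in 𝓝 0, |q.2| < 1 := by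
    have c : ContinuousAt (fun q : ℝ × ℝ => |q.2|) 0 := by fun_prop
    exact c.tendsto.eventually_lt_const (by simp)
  obtain ⟨F1, hF1, hF1e⟩ := divPow (d + 1) (hfm.sub hPm) ⟨|C| * (|z0| + 2) ^ (d + 1), by
    filter_upwards [ht.eventually hC, hb] with q hq hq2
    refine hq.trans ?_
    rw [mul_assoc, ← mul_pow]
    have h2 : ‖(q.1, q.1 * (z0 + q.2))‖ ≤ (|z0| + 2) * |q.1| := by
      rw [Prod.norm_def]
      refine max_le ?_ ?_
      · simp only [Real.norm_eq_abs]
        have := mul_nonneg (abs_nonneg z0) (abs_nonneg q.1)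
        nlinarith [abs_nonneg q.1]
      · simp only [Real.norm_eq_abs]
        rw [abs_mul, mul_comm]
        have := abs_add_le z0 q.2
        exact mul_le_mul_of_nonneg_right (by linarith) (abs_nonneg _)
    gcongr
    exact le_abs_self C⟩
  refine ⟨fun q => P (1, z0 + q.2) + q.1 * F1 q, ?_, ?_, fun z => by simp⟩
  · exact (AnalyticAt.fun_comp (g := P) (f := fun q : ℝ × ℝ => ((1:ℝ), z0 + q.2)) (x := 0) (h.P_an _)
      (analyticAt_const.prod (analyticAt_const.add analyticAt_snd))).add (analyticAt_fst.mul hF1)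
  · filter_upwards [hF1e] with q hq
    have h1 : P (q.1, q.1 * (z0 + q.2)) = q.1 ^ d * P (1, z0 + q.2) := by
      rw [← h.hom]; simp
    simp only [Pi.sub_apply] at hq
    rw [h1] at hq
    rw [pow_succ] at hq
    linear_combination hq

lemma lp_ord {f P : ℝ × ℝ → ℝ} {d : ℕ} (h : LP f d P) {z : ℝ} (hz : P (1, z) ≠ 0) {F : ℝ × ℝ → ℝ}
    (hF : ∀ z, F (0, z) = P (1, 0 + z)) : ∃ k, HasOrd F k := by
  have ha : AnalyticOnNhd ℝ (fun w : ℝ => P (1, w)) univ := fun w _ =>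
    AnalyticAt.fun_comp (g := P) (f := fun w : ℝ => ((1:ℝ), w)) (x := w) (h.P_an _) (analyticAt_const.prod analyticAt_id)
  have hne : ¬ ∀ᶠ w in 𝓝 (0:ℝ), P (1, w) = 0 := by
    intro hcon
    exact hz (ha.eqOn_zero_of_preconnected_of_eventuallyEq_zero isPreconnected_univ (mem_univ 0) hcon (mem_univ z))
  obtain ⟨k, V, hV, hV0, hVe⟩ := (ha 0 (mem_univ _)).exists_eventuallyEq_pow_smul_nonzero_iff.mpr hne
  refine ⟨k, V, hV.continuousAt, hV0, ?_⟩
  have : ∀ᶠ w in 𝓝 (0:ℝ), F (0, w) = w ^ k * V w := by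
    filter_upwards [hVe] with w hw
    rw [hF, zero_add, hw]; simp
  exact this.filter_mono nhdsWithin_le_nhds

lemma near0 {n : ℕ} {f : Fin n → ℝ × ℝ → ℝ} {γ : Fin n → ℝ} {rG : ℝ} (hrG : 0 < rG)
    (hG : IntegrableOn (fun p => ∏ i, |f i p| ^ γ i) (disk2 rG)) {d : Fin n → ℕ} {P : Fin n → ℝ × ℝ → ℝ}
    (hP : ∀ i, LP (f i) (d i) (P i)) {z : ℝ} (hz : ∀ i, P i (1, z) ≠ 0) :
    ∃ δ > 0, ∀ v ∈ Ioo 0 δ, EstS (fun p => ∏ i, |f i p| ^ γ i) {q | 0 < q.1 ∧ q.2 / q.1 ∈ Ioo 0 v} := by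
  choose F hF hFe hF0 using fun i => lp_blow (hP i) 0
  choose k hk using fun i => lp_ord (hP i) (hz i) (hF0 i)
  have hN : Node f 1 1 (fun _ => 0) k F := by
    refine ⟨one_pos, le_rfl, measurable_const, hF, hk, fun i => ⟨d i, ?_⟩⟩
    filter_upwards [hFe i] with q hq _
    rw [← hq]; simp
  obtain ⟨δ, hδ, h⟩ := claimA hrG hG _ _ _ _ _ rfl hN
  refine ⟨δ, hδ, fun v hv => ?_⟩
  have : {q : ℝ × ℝ | 0 < q.1 ∧ q.2 / q.1 ∈ Ioo 0 v} = Reg 1 1 (fun _ => 0) 0 v := by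
    ext q
    simp [Reg, zz, ss]
  rw [this]
  exact h v hv

lemma PsiH (θ w : ℝ) : Psi 1 (fun _ => 0) 2 1 (θ, w) = (exp θ, exp θ * (w * exp θ)) := by
  have : exp (2 * θ) = exp θ * exp θ := by rw [two_mul, exp_add]
  simp only [Psi, Nat.cast_one, one_mul, zero_add, this]
  rw [mul_comm w, mul_assoc]

lemma homDer {f F : ℝ × ℝ → ℝ} {d : ℕ} {ζ ρ C : ℝ} (hζ : 0 < ζ) (hC : 0 ≤ C)
    (h : ∀ x : ℝ × ℝ, ‖x‖ < ρ → F x ≠ 0 ∧ DifferentiableAt ℝ F x ∧ (∀ v, |fderiv ℝ F x v| ≤ C * |F x| * ‖v‖) ∧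
      f (x.1, x.1 * (ζ + x.2)) = x.1 ^ d * F x) {θ w : ℝ} (h1 : exp θ < ρ) (h2 : |w * exp θ - ζ| < ρ) :
    f (Psi 1 (fun _ => 0) 2 1 (θ, w)) ≠ 0 ∧ ∃ D, HasDerivAt (fun θ => f (Psi 1 (fun _ => 0) 2 1 (θ, w))) D θ ∧
      |D| ≤ (d + C * (ρ + ζ)) * |f (Psi 1 (fun _ => 0) 2 1 (θ, w))| := by
  simp only [PsiH]
  have hx : ‖(exp θ, w * exp θ - ζ)‖ < ρ := by
    rw [Prod.norm_def]
    refine max_lt ?_ h2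
    simpa using h1
  have hcont : ContinuousAt (fun θ : ℝ => ‖(exp θ, w * exp θ - ζ)‖) θ := by fun_prop
  have hev : ∀ᶠ θ' in 𝓝 θ, f (exp θ', exp θ' * (w * exp θ')) = exp θ' ^ d * F (exp θ', w * exp θ' - ζ) := by
    filter_upwards [hcont.tendsto.eventually_lt_const hx] with θ' h'
    have := (h _ h').2.2.2
    simpa using this
  obtain ⟨hF0, hFd, hFb, -⟩ := h _ hx
  have hval := hev.self_of_nhds
  have hc : HasDerivAt (fun θ : ℝ => (exp θ, w * exp θ - ζ)) (exp θ, w * exp θ) θ :=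
    (Real.hasDerivAt_exp θ).prodMk (((Real.hasDerivAt_exp θ).const_mul w).sub_const ζ)
  have hFc : HasDerivAt (fun θ : ℝ => F (exp θ, w * exp θ - ζ)) (fderiv ℝ F (exp θ, w * exp θ - ζ) (exp θ, w * exp θ)) θ :=
    HasFDerivAt.comp_hasDerivAt (f := fun θ : ℝ => (exp θ, w * exp θ - ζ)) θ hFd.hasFDerivAt hc
  have hp : HasDerivAt (fun θ : ℝ => exp θ ^ d) (d * exp θ ^ d) θ := by
    have h3 : HasDerivAt (fun θ : ℝ => exp (d * θ)) (exp (d * θ) * (d * 1)) θ := ((hasDerivAt_id θ).const_mul (d:ℝ)).exp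
    have h4 : (fun θ : ℝ => exp (d * θ)) = fun θ => exp θ ^ d := by
      funext x; rw [mul_comm, Real.exp_mul, Real.rpow_natCast]
    rw [h4] at h3
    have h5 := congrFun h4 θ
    rw [h5] at h3
    convert h3 using 1; ring
  rw [hval]
  refine ⟨mul_ne_zero (pow_ne_zero _ (exp_pos _).ne') hF0, _, (hp.mul hFc).congr_of_eventuallyEq hev, ?_⟩
  set v := fderiv ℝ F (exp θ, w * exp θ - ζ) (exp θ, w * exp θ) with hv
  have hv1 : |v| ≤ C * |F (exp θ, w * exp θ - ζ)| * (ρ + ζ) := by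
    refine (hFb _).trans (mul_le_mul_of_nonneg_left ?_ (by positivity))
    rw [Prod.norm_def]
    refine max_le ?_ ?_
    · simp; linarith
    · simp only [Real.norm_eq_abs]
      have := abs_add_le (w * exp θ - ζ) ζ
      rw [sub_add_cancel, abs_of_pos hζ] at this
      linarith
  set Fx := F (exp θ, w * exp θ - ζ)
  have he : 0 < exp θ ^ d := by positivity
  calc |d * exp θ ^ d * Fx + exp θ ^ d * v| ≤ |d * exp θ ^ d * Fx| + |exp θ ^ d * v| := abs_add_le _ _
    _ = d * exp θ ^ d * |Fx| + exp θ ^ d * |v| := by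
        rw [abs_mul, abs_mul, abs_mul, abs_of_pos he, Nat.abs_cast]
    _ ≤ d * exp θ ^ d * |Fx| + exp θ ^ d * (C * |Fx| * (ρ + ζ)) := by gcongr
    _ = _ := by rw [abs_mul, abs_of_pos he]; ring

lemma sliceH {r z1 z2 C1 : ℝ} (hr : 0 < r) (hz1 : 0 < z1) (hz : z1 < z2) (hC1 : 1 ≤ C1 * (log z2 - log z1)) (hC0 : 0 < C1) (w : ℝ) :
    {θ | Psi 1 (fun _ => 0) 2 1 (θ, w) ∈ disk2 r ∩ {q | 0 < q.1 ∧ q.2 / q.1 ∈ Ioo z1 z2}} = ∅ ∨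
      (∃ p q, p < q ∧ {θ | Psi 1 (fun _ => 0) 2 1 (θ, w) ∈ disk2 r ∩ {q | 0 < q.1 ∧ q.2 / q.1 ∈ Ioo z1 z2}} = Ioo p q ∧
        (1 ≤ C1 * (q - p) ∨ (Psi 1 (fun _ => 0) 2 1 (q, w) ∉ disk2 r ∧ ContinuousAt (fun _ : ℝ => (0:ℝ)) q))) := by
  simp only [PsiH]
  have hmem : ∀ θ : ℝ, (exp θ, exp θ * (w * exp θ)) ∈ disk2 r ∩ {q : ℝ × ℝ | 0 < q.1 ∧ q.2 / q.1 ∈ Ioo z1 z2} ↔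
      (exp θ, exp θ * (w * exp θ)) ∈ disk2 r ∧ z1 < w * exp θ ∧ w * exp θ < z2 := by
    intro θ
    have he := exp_pos θ
    simp only [mem_inter_iff, mem_ofPred_eq, mem_Ioo, he, true_and]
    rw [mul_div_cancel_left₀ _ he.ne']
  simp only [hmem]
  rcases le_or_gt w 0 with hw | hw
  · left
    ext θ
    simp only [mem_ofPred_eq, mem_empty_iff_false, iff_false]
    rintro ⟨-, h1, -⟩
    have := mul_nonpos_of_nonpos_of_nonneg hw (exp_pos θ).le
    linarith
  · set D : Set ℝ := {θ | w * exp θ < z2 ∧ exp θ ^ 2 + (exp θ * (w * exp θ)) ^ 2 < r ^ 2} with hD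
    have hDo : IsOpen D := by
      have o1 : IsOpen {θ : ℝ | w * exp θ < z2} := isOpen_lt (by fun_prop) (by fun_prop)
      have o2 : IsOpen {θ : ℝ | exp θ ^ 2 + (exp θ * (w * exp θ)) ^ 2 < r ^ 2} := isOpen_lt (by fun_prop) (by fun_prop)
      exact o1.inter o2
    have hb : BddAbove D := ⟨log (z2 / w), fun θ hθ => by
      rw [Real.le_log_iff_exp_le (by have := hz1.trans hz; positivity), le_div_iff₀ hw, mul_comm]; exact hθ.1.le⟩
    have hdc : ∀ a ∈ D, ∀ b < a, b ∈ D := by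
      intro a ha b hab
      have he : exp b < exp a := exp_lt_exp.mpr hab
      have hbp := exp_pos b
      refine ⟨lt_of_le_of_lt (by gcongr) ha.1, lt_of_le_of_lt (by gcongr) ha.2⟩
    have hp : ∀ θ, z1 < w * exp θ ↔ log (z1 / w) < θ := by
      intro θ
      rw [Real.log_lt_iff_lt_exp (by positivity), div_lt_iff₀ hw, mul_comm]
    rcases down_closed hb hdc with h | ⟨q, hq1, hq2⟩
    · left
      ext θ
      simp only [mem_ofPred_eq, mem_empty_iff_false, iff_false]
      rintro ⟨h0, h1, h2⟩
      have : θ ∈ D := ⟨h2, h0⟩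
      rw [h] at this
      exact this
    · have hqD : q ∉ D := by
        intro hq
        obtain ⟨b, hb1, hb2⟩ := (mem_nhdsGE_iff_exists_Ico_subset (a := q)).mp (mem_nhdsWithin_of_mem_nhds (hDo.mem_nhds hq))
        have hb1' : q < b := hb1
        have : (q + b) / 2 ∈ D := hb2 ⟨by linarith, by linarith⟩
        have := hq2 this
        simp only [mem_Iic] at this
        linarith
      have hSeq : {θ : ℝ | (exp θ, exp θ * (w * exp θ)) ∈ disk2 r ∧ z1 < w * exp θ ∧ w * exp θ < z2} = Ioo (log (z1 / w)) q := by
        ext θ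
        simp only [mem_ofPred_eq, mem_Ioo]
        constructor
        · rintro ⟨h0, h1, h2⟩
          have hθ : θ ∈ D := ⟨h2, h0⟩
          exact ⟨(hp θ).mp h1, lt_of_le_of_ne (hq2 hθ) fun h => hqD (h ▸ hθ)⟩
        · rintro ⟨h1, h2⟩
          have := hq1 h2
          exact ⟨this.2, (hp θ).mpr h1, this.1⟩
      rw [hSeq]
      rcases le_or_gt q (log (z1 / w)) with hqp | hqp
      · left; exact Ioo_eq_empty (not_lt.mpr hqp)
      · refine Or.inr ⟨_, q, hqp, rfl, ?_⟩
        by_cases hdisk : (exp q, exp q * (w * exp q)) ∈ disk2 r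
        · left
          have h1 : z2 ≤ w * exp q := by
            by_contra hcon
            exact hqD ⟨not_le.mp hcon, hdisk⟩
          have hz2 := hz1.trans hz
          have h2 : log (z2 / w) ≤ q := by
            rw [Real.log_le_iff_le_exp (by positivity), div_le_iff₀ hw, mul_comm]; exact h1
          rw [Real.log_div hz2.ne' hw.ne'] at h2
          rw [Real.log_div hz1.ne' hw.ne']
          refine hC1.trans (mul_le_mul_of_nonneg_left (by linarith) hC0.le)
        · exact Or.inr ⟨hdisk, continuousAt_const⟩

lemma sect_meas (a b : ℝ) : MeasurableSet {q : ℝ × ℝ | 0 < q.1 ∧ q.2 / q.1 ∈ Ioo a b} := by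
  have q1 : MeasurableSet {q : ℝ × ℝ | 0 < q.1} := measurableSet_lt measurable_const measurable_fst
  have q2 : MeasurableSet {q : ℝ × ℝ | q.2 / q.1 ∈ Ioo a b} := (measurable_snd.div measurable_fst) measurableSet_Ioo
  exact q1.inter q2

lemma leafHom {n : ℕ} {f : Fin n → ℝ × ℝ → ℝ} {γ : Fin n → ℝ} {rG : ℝ} (hrG : 0 < rG)
    (hG : IntegrableOn (fun p => ∏ i, |f i p| ^ γ i) (disk2 rG)) {d : Fin n → ℕ} {P : Fin n → ℝ × ℝ → ℝ}
    (hP : ∀ i, LP (f i) (d i) (P i)) {ζ : ℝ} (hζ : 0 < ζ) (hz : ∀ i, P i (1, ζ) ≠ 0) :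
    ∃ δ > 0, ∀ z1 z2, ζ - δ ≤ z1 → z1 < z2 → z2 ≤ ζ + δ →
      EstS (fun p => ∏ i, |f i p| ^ γ i) {q | 0 < q.1 ∧ q.2 / q.1 ∈ Ioo z1 z2} := by
  choose F hF hFe hF0 using fun i => lp_blow (hP i) ζ
  have hu : ∀ i, ∃ C > 0, ∀ᶠ x : ℝ × ℝ in 𝓝 0, F i x ≠ 0 ∧ DifferentiableAt ℝ (F i) x ∧ ∀ v, |fderiv ℝ (F i) x v| ≤ C * |F i x| * ‖v‖ := by
    intro i
    obtain ⟨ρ, hρ, C, hC, h⟩ := unit_bounds (hF i) (by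
      have := hF0 i 0
      rw [add_zero] at this
      change F i (0, 0) ≠ 0
      rw [this]; exact hz i)
    exact ⟨C, hC, Metric.eventually_nhds_iff.mpr ⟨ρ, hρ, fun x hx => h x (by simpa using hx)⟩⟩
  choose C hC hCe using hu
  obtain ⟨ρ, hρ, hall⟩ := Metric.eventually_nhds_iff.mp ((eventually_all.mpr hCe).and (eventually_all.mpr hFe))
  simp only [dist_zero_right] at hall
  set CC := ∑ i, ((d i : ℝ) + C i * (ρ + ζ)) with hCC
  have hCCi : ∀ i, (d i : ℝ) + C i * (ρ + ζ) ≤ CC := fun i =>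
    Finset.single_le_sum (f := fun i => (d i : ℝ) + C i * (ρ + ζ)) (fun j _ => by have := hC j; positivity) (Finset.mem_univ i)
  have hCC0 : 0 ≤ CC := Finset.sum_nonneg (fun j _ => by have := hC j; positivity)
  refine ⟨min (ρ / 2) (ζ / 2), by positivity, fun z1 z2 h1 h12 h2 => ?_⟩
  have m1 := min_le_left (ρ / 2) (ζ / 2)
  have m2 := min_le_right (ρ / 2) (ζ / 2)
  have hz1 : 0 < z1 := by linarith
  have hlog : 0 < log z2 - log z1 := sub_pos.mpr (Real.log_lt_log hz1 h12)
  set C1 := 4 + 2 * ζ + CC * ∑ i, |γ i| + 1 / (log z2 - log z1) with hC1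
  have e1 : 0 ≤ CC * ∑ i, |γ i| := mul_nonneg hCC0 (Finset.sum_nonneg fun _ _ => abs_nonneg _)
  have e2 : 0 < 1 / (log z2 - log z1) := by positivity
  have hC10 : 0 < C1 := by linarith
  refine leaf2D hrG hG (N := 1) one_pos (H := fun _ => 0) (H1 := fun _ => 0) (H2 := fun _ => 0) measurable_const
    (e := 2) (τ := 1) (σ := 1) (C1 := C1) (c1 := 1) (r0 := ρ) (Or.inl rfl) (Or.inl rfl) hC10 one_pos hρ (sect_meas z1 z2)
    (fun p hp => hp.1) ?_ ?_
  · intro θ w hp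
    have hp' := hp
    rw [PsiH] at hp'
    obtain ⟨hd, -, hs1, hs2⟩ := hp'
    have he := exp_pos θ
    rw [mul_div_cancel_left₀ _ he.ne'] at hs1 hs2
    have hsr : exp θ < ρ := by
      have : exp θ ^ 2 + (exp θ * (w * exp θ)) ^ 2 < ρ ^ 2 := hd
      exact lt_of_pow_lt_pow_left₀ 2 hρ.le (by nlinarith [sq_nonneg (exp θ * (w * exp θ))])
    have hsz : |w * exp θ - ζ| < ρ := by rw [abs_lt]; constructor <;> linarith
    have hder := fun i => homDer (f := f i) (F := F i) (d := d i) (ρ := ρ) hζ (hC i).le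
      (fun x hx => ⟨((hall hx).1 i).1, ((hall hx).1 i).2.1, ((hall hx).1 i).2.2, (hall hx).2 i⟩) hsr hsz
    obtain ⟨p1, D, hD, hDb⟩ := prod_logder (γ := γ) (g := fun i θ => f i (Psi 1 (fun _ => 0) 2 1 (θ, w))) (θ := θ) hCC0 (fun i => by
      obtain ⟨a, D, b, c⟩ := hder i
      exact ⟨a, D, b, c.trans (mul_le_mul_of_nonneg_right (hCCi i) (abs_nonneg _))⟩)
    have hY : (0:ℝ) + 1 * exp (2 * θ) * w = exp θ * (w * exp θ) := by
      have := congrArg Prod.snd (PsiH θ w)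
      exact this
    have hw : 0 < w * exp θ := by linarith
    have hYp : 0 < exp θ * (w * exp θ) := mul_pos he hw
    have hE : exp (2 * θ) * w = exp θ * (w * exp θ) := by linarith
    refine ⟨hasDerivAt_const _ _, hasDerivAt_const _ _, p1, ⟨D, hD, hDb.trans ?_⟩, ?_, ?_, ?_, ?_, ?_⟩
    · exact mul_le_mul_of_nonneg_right (by linarith) p1.le
    · rw [hY]; linarith
    · rw [hY, show (0:ℝ) + 1 * (2 * exp (2 * θ)) * w = 2 * (exp θ * (w * exp θ)) by rw [← hE]; ring, abs_of_pos (by linarith), one_mul]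
      exact mul_le_mul_of_nonneg_right (by linarith) hYp.le
    · rw [hY, show (0:ℝ) + 1 * (2 * (2 * exp (2 * θ))) * w = 4 * (exp θ * (w * exp θ)) by rw [← hE]; ring, abs_of_pos (by linarith), one_mul]
      exact mul_le_mul_of_nonneg_right (by linarith) hYp.le
    · rw [hY, show (0:ℝ) + 1 * (2 * (2 * exp (2 * θ))) * w = 4 * (exp θ * (w * exp θ)) by rw [← hE]; ring,
        show (0:ℝ) + 1 * (2 * exp (2 * θ)) * w = 2 * (exp θ * (w * exp θ)) by rw [← hE]; ring, Nat.cast_one]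
      linarith
    · rw [hY, Nat.cast_one, one_mul, one_mul, mul_comm (exp θ)]
      exact mul_le_mul_of_nonneg_right (by linarith) he.le
  · intro r w hr hr0
    have h3 : 1 ≤ C1 * (log z2 - log z1) := by
      have : 1 = 1 / (log z2 - log z1) * (log z2 - log z1) := by field_simp
      calc (1:ℝ) = 1 / (log z2 - log z1) * (log z2 - log z1) := this
        _ ≤ C1 * (log z2 - log z1) := mul_le_mul_of_nonneg_right (by linarith) hlog.le
    rcases sliceH hr hz1 h12 h3 hC10 w with h | h
    · exact Or.inl h
    · exact Or.inr (Or.inr h)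

def Sec (J : Set ℝ) : Set (ℝ × ℝ) := {q | 0 < q.1 ∧ q.2 / q.1 ∈ J}

lemma Sec_meas {J : Set ℝ} (hJ : MeasurableSet J) : MeasurableSet (Sec J) := by
  have q1 : MeasurableSet {q : ℝ × ℝ | 0 < q.1} := measurableSet_lt measurable_const measurable_fst
  have q2 : MeasurableSet {q : ℝ × ℝ | q.2 / q.1 ∈ J} := (measurable_snd.div measurable_fst) hJ
  exact q1.inter q2

lemma Sec_null (c : ℝ) : ∀ᵐ q : ℝ × ℝ, 0 < q.1 → q.2 / q.1 ≠ c := by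
  filter_upwards [null_graph (g := fun x => c * x) (by fun_prop)] with q hq h0 h
  rw [div_eq_iff h0.ne'] at h
  exact hq h

lemma Sec_congr {G : ℝ × ℝ → ℝ} {J J' : Set ℝ} (a b : ℝ) (h : ∀ x, x ≠ a → x ≠ b → (x ∈ J ↔ x ∈ J'))
    (hJ : EstS G (Sec J)) : EstS G (Sec J') := by
  refine EstS_congr' ?_ hJ
  filter_upwards [Sec_null a, Sec_null b] with q h1 h2
  constructor
  · exact fun hq => ⟨hq.1, (h _ (h1 hq.1) (h2 hq.1)).mp hq.2⟩
  · exact fun hq => ⟨hq.1, (h _ (h1 hq.1) (h2 hq.1)).mpr hq.2⟩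

lemma Sec_union {G : ℝ × ℝ → ℝ} (hG0 : ∀ p, 0 ≤ G p) {rG : ℝ} (hrG : 0 < rG) (hG : IntegrableOn G (disk2 rG)) {J J' : Set ℝ}
    (hm : MeasurableSet J') (hd : Disjoint J J') (h : EstS G (Sec J)) (h' : EstS G (Sec J')) : EstS G (Sec (J ∪ J')) := by
  have : Sec (J ∪ J') = Sec J ∪ Sec J' := by
    ext q; simp only [Sec, mem_ofPred_eq, mem_union]; tauto
  rw [this]
  refine EstS_union hG0 hrG hG ?_ (Sec_meas hm) h h'
  rw [Set.disjoint_left] at hd ⊢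
  exact fun q h1 h2 => hd h1.2 h2.2

lemma Sec_empty (G : ℝ × ℝ → ℝ) {J : Set ℝ} (h : J = ∅) : EstS G (Sec J) := by
  have : Sec J = ∅ := by ext q; simp [Sec, h]
  rw [this]; exact EstS_empty G

lemma Sec_ord {G : ℝ × ℝ → ℝ} {J : Set ℝ} [hJ : J.OrdConnected] {lo hi : ℝ} (hsub : J ⊆ Icc lo hi)
    (h : ∀ z1 z2, lo ≤ z1 → z1 < z2 → z2 ≤ hi → EstS G (Sec (Ioo z1 z2))) : EstS G (Sec J) := by
  rcases J.eq_empty_or_nonempty with he | hne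
  · exact Sec_empty G he
  · have hb : BddBelow J := ⟨lo, fun x hx => (hsub hx).1⟩
    have ha : BddAbove J := ⟨hi, fun x hx => (hsub hx).2⟩
    have key : ∀ x, x ≠ sInf J → x ≠ sSup J → (x ∈ Ioo (sInf J) (sSup J) ↔ x ∈ J) := by
      intro x h1 h2
      constructor
      · rintro ⟨h3, h4⟩
        obtain ⟨y, hy, hy'⟩ := exists_lt_of_csInf_lt hne h3
        obtain ⟨z, hz, hz'⟩ := exists_lt_of_lt_csSup hne h4
        exact hJ.out hy hz ⟨hy'.le, hz'.le⟩
      · intro hx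
        exact ⟨lt_of_le_of_ne (csInf_le hb hx) (Ne.symm h1), lt_of_le_of_ne (le_csSup ha hx) h2⟩
    refine Sec_congr (sInf J) (sSup J) key ?_
    rcases lt_or_ge (sInf J) (sSup J) with hlt | hge
    · exact h _ _ (le_csInf hne fun x hx => (hsub hx).1) hlt (csSup_le hne fun x hx => (hsub hx).2)
    · exact Sec_empty G (Ioo_eq_empty (not_lt.mpr hge))

lemma int_sym {G : ℝ × ℝ → ℝ} {rG : ℝ} (hG : IntegrableOn G (disk2 rG)) {T : (ℝ × ℝ) ≃L[ℝ] (ℝ × ℝ)} (hT : SymT T) :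
    IntegrableOn (fun p => G (T p)) (disk2 rG) := by
  have hd : T ⁻¹' (disk2 rG) = disk2 rG := by
    ext p; simp only [mem_preimage, disk2, mem_ofPred_eq, hT.nrm p]
  have h1 := (hT.mp.integrableOn_comp_preimage T.toHomeomorph.measurableEmbedding (f := G) (s := disk2 rG)).mpr hG
  rw [hd] at h1
  exact h1

lemma nearInf {n : ℕ} {f : Fin n → ℝ × ℝ → ℝ} {γ : Fin n → ℝ} {rG : ℝ} (hrG : 0 < rG)
    (hG : IntegrableOn (fun p => ∏ i, |f i p| ^ γ i) (disk2 rG)) {d : Fin n → ℕ} {P : Fin n → ℝ × ℝ → ℝ}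
    (hP : ∀ i, LP (f i) (d i) (P i)) {z : ℝ} (hz0 : 0 < z) (hz : ∀ i, P i (1, z) ≠ 0) :
    ∃ M > 0, ∀ v > M, EstS (fun p => ∏ i, |f i p| ^ γ i) (Sec (Ioi v)) := by
  obtain ⟨T, hT, hTp⟩ := sym_swap
  obtain ⟨δ, hδ, h⟩ := near0 (f := fun i p => f i (T p)) (γ := γ) hrG (int_sym hG hT) (fun i => lp_comp (hP i) T) (z := z⁻¹) (by
    intro i
    have h1 : T (1, z⁻¹) = z⁻¹ • (1, z) := by rw [hTp]; simp [hz0.ne']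
    rw [h1, (hP i).hom]
    exact mul_ne_zero (pow_ne_zero _ (inv_ne_zero hz0.ne')) (hz i))
  refine ⟨δ⁻¹, by positivity, fun v hv => EstS_sym hT ?_⟩
  have hv0 : 0 < v := lt_trans (by positivity) hv
  have h2 := h v⁻¹ ⟨by positivity, inv_lt_of_inv_lt₀ hδ hv⟩
  convert h2 using 1
  ext q
  simp only [Sec, mem_preimage, hTp, mem_ofPred_eq, mem_Ioo, mem_Ioi]
  constructor
  · rintro ⟨h3, h4⟩
    have h5 : 0 < q.1 := by
      have : 0 < q.1 / q.2 := hv0.trans h4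
      exact (div_pos_iff_of_pos_right h3).mp this
    refine ⟨h5, by positivity, ?_⟩
    rw [← inv_div]
    exact inv_strictAnti₀ hv0 h4
  · rintro ⟨h3, h4, h5⟩
    refine ⟨(div_pos_iff_of_pos_right h3).mp h4, ?_⟩
    rw [← inv_div]
    exact (lt_inv_comm₀ hv0 h4).mpr h5

lemma sector {n : ℕ} {f : Fin n → ℝ × ℝ → ℝ} {γ : Fin n → ℝ} {rG : ℝ} (hrG : 0 < rG)
    (hG : IntegrableOn (fun p => ∏ i, |f i p| ^ γ i) (disk2 rG)) {d : Fin n → ℕ} {P : Fin n → ℝ × ℝ → ℝ}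
    (hP : ∀ i, LP (f i) (d i) (P i)) {I : Set ℝ} [hI : I.OrdConnected] (hz : ∀ z > 0, z ∈ closure I → ∀ i, P i (1, z) ≠ 0) :
    EstS (fun p => ∏ i, |f i p| ^ γ i) (Sec (I ∩ Ioi 0)) := by
  have hG0 : ∀ p, 0 ≤ ∏ i, |f i p| ^ γ i := fun p => Finset.prod_nonneg fun i _ => Real.rpow_nonneg (abs_nonneg _) _
  rcases (I ∩ Ioi 0).eq_empty_or_nonempty with he | ⟨m, hmI, hm0⟩
  · exact Sec_empty _ he
  have hm0' : 0 < m := hm0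
  have hm := hz m hm0 (subset_closure hmI)
  have hbase : ∃ δ > 0, ∀ v ∈ Ioo (0:ℝ) (0 + δ), EstS (fun p => ∏ i, |f i p| ^ γ i) (Sec (I ∩ Ioo 0 v)) := by
    by_cases hc : ∃ ε > 0, I ∩ Ioo 0 ε = ∅
    · obtain ⟨ε, hε, hce⟩ := hc
      refine ⟨ε, hε, fun v hv => Sec_empty _ (subset_empty_iff.mp ?_)⟩
      rw [← hce]
      exact inter_subset_inter_right _ (Ioo_subset_Ioo_right (by linarith [hv.2]))
    · push Not at hc
      obtain ⟨δ, hδ, h⟩ := near0 hrG hG hP hm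
      refine ⟨min δ m, lt_min hδ hm0, fun v hv => ?_⟩
      rw [zero_add] at hv
      have : I ∩ Ioo 0 v = Ioo 0 v := by
        refine inter_eq_right.mpr fun x hx => ?_
        obtain ⟨y, hy, hy'⟩ := hc x hx.1
        exact hI.out hy hmI ⟨hy'.2.le, (hx.2.trans (hv.2.trans_le (min_le_right _ _))).le⟩
      rw [this]
      exact h v ⟨hv.1, hv.2.trans_le (min_le_left _ _)⟩
  have htail : ∃ M > 0, ∀ v > M, EstS (fun p => ∏ i, |f i p| ^ γ i) (Sec (I ∩ Ioi v)) := by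
    by_cases hb : BddAbove I
    · obtain ⟨b, hb⟩ := hb
      refine ⟨max b 1, by positivity, fun v hv => Sec_empty _ (subset_empty_iff.mp fun x hx => ?_)⟩
      have h1 := hb hx.1
      have h2 : v < x := hx.2
      have := le_max_left b 1
      linarith
    · obtain ⟨M, hM, h⟩ := nearInf hrG hG hP hm0' hm
      refine ⟨max M m, by positivity, fun v hv => ?_⟩
      have : I ∩ Ioi v = Ioi v := by
        refine inter_eq_right.mpr fun x hx => ?_
        rw [not_bddAbove_iff] at hb
        obtain ⟨y, hy, hxy⟩ := hb x
        have h2 : v < x := hx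
        have := le_max_right M m
        exact hI.out hmI hy ⟨by linarith, hxy.le⟩
      rw [this]
      exact h v (lt_of_le_of_lt (le_max_left _ _) hv)
  obtain ⟨M, hM, htail⟩ := htail
  obtain ⟨β, hβ, hmain⟩ := glue (P := fun u v => EstS (fun p => ∏ i, |f i p| ^ γ i) (Sec (I ∩ Ioo u v))) (u0 := 0) (a := 0) (B := M)
    (by
      intro u v w huv hvw h1 h2
      have h3 := Sec_union hG0 hrG hG (hI.measurableSet.inter measurableSet_Ioo) (by
        rw [Set.disjoint_left]
        exact fun x hx hx' => absurd (hx.2.2.trans hx'.2.1) (lt_irrefl _)) h1 h2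
      refine Sec_congr v v (fun x hx _ => ?_) h3
      simp only [mem_union, mem_inter_iff, mem_Ioo]
      constructor
      · rintro (⟨a, b, c⟩ | ⟨a, b, c⟩)
        · exact ⟨a, b, c.trans hvw⟩
        · exact ⟨a, huv.trans b, c⟩
      · rintro ⟨a, b, c⟩
        rcases lt_or_gt_of_ne hx with h | h
        · exact Or.inl ⟨a, b, h⟩
        · exact Or.inr ⟨a, h, c⟩) le_rfl hM.le hbase (by
      intro ζ hζ
      by_cases hc : ζ ∈ closure I
      · obtain ⟨δ, hδ, h⟩ := leafHom hrG hG hP hζ.1 (hz ζ hζ.1 hc)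
        refine ⟨δ, hδ, fun u hu v hv => ?_⟩
        refine Sec_ord (lo := ζ - δ) (hi := ζ + δ) (fun x hx => ⟨?_, ?_⟩) h
        · linarith [hx.2.1, hu.1]
        · linarith [hx.2.2, hv.2]
      · rw [Metric.mem_closure_iff] at hc
        push Not at hc
        obtain ⟨δ, hδ, h⟩ := hc
        refine ⟨δ, hδ, fun u hu v hv => Sec_empty _ (subset_empty_iff.mp fun x hx => ?_)⟩
        have h1 := h x hx.1
        rw [Real.dist_eq] at h1
        have : |ζ - x| < δ := by
          rw [abs_lt]
          constructor
          · linarith [hx.2.2, hv.2]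
          · linarith [hx.2.1, hu.1]
        linarith)
  have hv : (M + β) / 2 ∈ Ioo M β := ⟨by linarith, by linarith⟩
  have h1 := hmain _ hv
  have h2 := htail _ hv.1
  set v := (M + β) / 2
  have h3 := Sec_union hG0 hrG hG (hI.measurableSet.inter measurableSet_Ioi) (by
        rw [Set.disjoint_left]
        exact fun x hx hx' => absurd (lt_trans hx.2.2 hx'.2) (lt_irrefl _)) h1 h2
  refine Sec_congr v v (fun x hx _ => ?_) h3
  have hv0 : 0 < v := hM.trans hv.1
  simp only [mem_union, mem_inter_iff, mem_Ioo, mem_Ioi]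
  constructor
  · rintro (⟨a, b, c⟩ | ⟨a, b⟩)
    · exact ⟨a, b⟩
    · exact ⟨a, hv0.trans b⟩
  · rintro ⟨a, b⟩
    rcases lt_or_gt_of_ne hx with h | h
    · exact Or.inl ⟨a, b, h⟩
    · exact Or.inr ⟨a, h⟩

def Quad (V : Set (ℝ × ℝ)) (σ τ : ℝ) : Set (ℝ × ℝ) := {q | 0 < σ * q.1 ∧ 0 < τ * q.2 ∧ q ∈ V}

lemma Quad_meas {V : Set (ℝ × ℝ)} (hV : MeasurableSet V) (σ τ : ℝ) : MeasurableSet (Quad V σ τ) := by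
  have q1 : MeasurableSet {q : ℝ × ℝ | 0 < σ * q.1} := measurableSet_lt measurable_const (measurable_fst.const_mul σ)
  have q2 : MeasurableSet {q : ℝ × ℝ | 0 < τ * q.2} := measurableSet_lt measurable_const (measurable_snd.const_mul τ)
  exact q1.inter (q2.inter hV)

lemma quadEst {n : ℕ} {f : Fin n → ℝ × ℝ → ℝ} {γ : Fin n → ℝ} {rG : ℝ} (hrG : 0 < rG)
    (hG : IntegrableOn (fun p => ∏ i, |f i p| ^ γ i) (disk2 rG)) {d : Fin n → ℕ} {P : Fin n → ℝ × ℝ → ℝ}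
    (hP : ∀ i, LP (f i) (d i) (P i)) {V : Set (ℝ × ℝ)} (hc : Convex ℝ V) (hs : ∀ c > (0:ℝ), ∀ p, c • p ∈ V ↔ p ∈ V)
    (hz : ∀ i, ∀ q ∈ closure V, q.1 ≠ 0 → q.2 ≠ 0 → P i q ≠ 0) {σ τ : ℝ} (hσ : σ = 1 ∨ σ = -1) (hτ : τ = 1 ∨ τ = -1) :
    EstS (fun p => ∏ i, |f i p| ^ γ i) (Quad V σ τ) := by
  obtain ⟨T, hT, hTp⟩ := sym_refl hσ hτ
  have hσ2 : σ * σ = 1 := by rcases hσ with rfl | rfl <;> norm_num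
  have hτ2 : τ * τ = 1 := by rcases hτ with rfl | rfl <;> norm_num
  have hσ0 : σ ≠ 0 := by rcases hσ with rfl | rfl <;> norm_num
  have hτ0 : τ ≠ 0 := by rcases hτ with rfl | rfl <;> norm_num
  set I : Set ℝ := {z | (σ, τ * z) ∈ V} with hI
  have hIc : Convex ℝ I := by
    intro x hx y hy a b ha hb hab
    have := hc hx hy ha hb hab
    have h1 : a • (σ, τ * x) + b • (σ, τ * y) = (σ, τ * (a • x + b • y)) := by
      ext
      · simp only [Prod.smul_mk, Prod.mk_add_mk, smul_eq_mul]; rw [← add_mul, hab, one_mul]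
      · simp only [Prod.smul_mk, Prod.mk_add_mk, smul_eq_mul]; ring
    rw [h1] at this
    exact this
  haveI : I.OrdConnected := hIc.ordConnected
  refine EstS_sym hT ?_
  have h := sector (f := fun i p => f i (T p)) (γ := γ) hrG (int_sym hG hT) (fun i => lp_comp (hP i) T) (I := I) (by
    intro z hz0 hzI i
    have h1 : (σ, τ * z) ∈ closure V :=
      map_mem_closure (f := fun z : ℝ => (σ, τ * z)) (by fun_prop) hzI (fun x hx => hx)
    have h2 := hz i _ h1 hσ0 (mul_ne_zero hτ0 hz0.ne')
    rw [hTp]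
    simpa using h2)
  convert h using 1
  ext q
  simp only [Quad, Sec, hI, mem_preimage, hTp, mem_ofPred_eq, mem_inter_iff, mem_Ioi]
  rw [← mul_assoc, ← mul_assoc, hσ2, hτ2, one_mul, one_mul]
  have key : 0 < q.1 → ((σ * q.1, τ * q.2) ∈ V ↔ (σ, τ * (q.2 / q.1)) ∈ V) := by
    intro h0
    rw [← hs q.1 h0 (σ, τ * (q.2 / q.1))]
    have : (σ * q.1, τ * q.2) = q.1 • (σ, τ * (q.2 / q.1)) := by
      ext
      · simp [mul_comm]
      · simp; field_simp
    rw [this]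
  constructor
  · rintro ⟨h0, h1, h2⟩
    exact ⟨h0, (key h0).mp h2, by positivity⟩
  · rintro ⟨h0, h1, h2⟩
    exact ⟨h0, (div_pos_iff_of_pos_right h0).mp h2, (key h0).mpr h1⟩

lemma coneEst {n : ℕ} {f : Fin n → ℝ × ℝ → ℝ} {γ : Fin n → ℝ} {rG : ℝ} (hrG : 0 < rG)
    (hG : IntegrableOn (fun p => ∏ i, |f i p| ^ γ i) (disk2 rG)) {d : Fin n → ℕ} {P : Fin n → ℝ × ℝ → ℝ}
    (hP : ∀ i, LP (f i) (d i) (P i)) {V : Set (ℝ × ℝ)} (hVm : MeasurableSet V) (hc : Convex ℝ V)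
    (hs : ∀ c > (0:ℝ), ∀ p, c • p ∈ V ↔ p ∈ V)
    (hz : ∀ i, ∀ q ∈ closure V, q.1 ≠ 0 → q.2 ≠ 0 → P i q ≠ 0) :
    EstS (fun p => ∏ i, |f i p| ^ γ i) V := by
  have hG0 : ∀ p, 0 ≤ ∏ i, |f i p| ^ γ i := fun p => Finset.prod_nonneg fun i _ => Real.rpow_nonneg (abs_nonneg _) _
  have E := fun {σ τ : ℝ} => quadEst (σ := σ) (τ := τ) hrG hG hP hc hs hz
  have i1 : (1:ℝ) = 1 ∨ (1:ℝ) = -1 := Or.inl rfl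
  have i2 : (-1:ℝ) = 1 ∨ (-1:ℝ) = -1 := Or.inr rfl
  have dj : ∀ τ, Disjoint (Quad V 1 τ) (Quad V (-1) τ) := fun τ => by
    rw [Set.disjoint_left]
    intro q h1 h2
    have a := h1.1
    have b := h2.1
    linarith
  have e1 := EstS_union hG0 hrG hG (dj 1) (Quad_meas hVm _ _) (E i1 i1) (E i2 i1)
  have e2 := EstS_union hG0 hrG hG (dj (-1)) (Quad_meas hVm _ _) (E i1 i2) (E i2 i2)
  have e3 := EstS_union hG0 hrG hG (by
    rw [Set.disjoint_left]
    rintro q h1 h2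
    have a : 0 < 1 * q.2 := by rcases h1 with h | h <;> exact h.2.1
    have b : 0 < -1 * q.2 := by rcases h2 with h | h <;> exact h.2.1
    linarith) ((Quad_meas hVm _ _).union (Quad_meas hVm _ _)) e1 e2
  refine EstS_congr' ?_ e3
  have n1 : ∀ᵐ q : ℝ × ℝ, q.1 ≠ 0 := by
    have h0 : ∀ᵐ x : ℝ, x ≠ 0 := by rw [ae_iff]; simp
    exact (Measure.quasiMeasurePreserving_fst (μ := (volume : Measure ℝ)) (ν := (volume : Measure ℝ))).ae h0
  filter_upwards [n1, null_graph (g := fun _ => 0) measurable_const] with q h1 h2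
  constructor
  · rintro ((h | h) | (h | h)) <;> exact h.2.2
  · intro hq
    rcases lt_or_gt_of_ne h1 with a | a <;> rcases lt_or_gt_of_ne h2 with b | b
    · exact Or.inr (Or.inr ⟨by linarith, by linarith, hq⟩)
    · exact Or.inl (Or.inr ⟨by linarith, by linarith, hq⟩)
    · exact Or.inr (Or.inl ⟨by linarith, by linarith, hq⟩)
    · exact Or.inl (Or.inl ⟨by linarith, by linarith, hq⟩)

def HP (a b : ℝ) : Set (ℝ × ℝ) := {q | 0 < a * q.1 + b * q.2}

lemma HP_meas (a b : ℝ) : MeasurableSet (HP a b) :=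
  measurableSet_lt measurable_const ((measurable_fst.const_mul a).add (measurable_snd.const_mul b))

lemma HP_conv (a b : ℝ) : Convex ℝ (HP a b) := by
  intro x hx y hy s t hs ht hst
  have hx' : 0 < a * x.1 + b * x.2 := hx
  have hy' : 0 < a * y.1 + b * y.2 := hy
  show 0 < a * (s * x.1 + t * y.1) + b * (s * x.2 + t * y.2)
  have h : a * (s * x.1 + t * y.1) + b * (s * x.2 + t * y.2) = s * (a * x.1 + b * x.2) + t * (a * y.1 + b * y.2) := by ring
  rw [h]
  rcases hs.eq_or_lt with h0 | h0
  · rw [← h0] at hst ⊢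
    have : t = 1 := by linarith
    rw [this]; linarith
  · have := mul_pos h0 hx'
    have := mul_nonneg ht hy'.le
    linarith

lemma HP_cone (a b : ℝ) (c : ℝ) (hc : 0 < c) (p : ℝ × ℝ) : c • p ∈ HP a b ↔ p ∈ HP a b := by
  show 0 < a * (c * p.1) + b * (c * p.2) ↔ 0 < a * p.1 + b * p.2
  have : a * (c * p.1) + b * (c * p.2) = c * (a * p.1 + b * p.2) := by ring
  rw [this, mul_pos_iff_of_pos_left hc]

/-- **Corollary 3.4.** Suppose `E` is a disk centered at the origin, `g = χ_E ∏|fᵢ|^{γᵢ}`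
is of the standard form, not every `fᵢ(0,0)` is nonzero, and `V` is one of the four wedges
formed by the lines `y = p₁x`, `y = p₂x` on whose closure (minus the axes) no
lowest-degree part `Fᵢ` vanishes. Then for `α` supported in a sufficiently small disk `B`
with the bounds (1.2)-(1.3),
`|∫_{B∩V} α ∏|fᵢ|^{γᵢ} e^{i(tx+uy)}| ≤ C ∫_{B∩V} (1+|tx|+|uy|)^{−1/2} ∏|fᵢ|^{γᵢ}`;
and if no `Fᵢ` vanishes on all of `(ℝ∖{0})²`, the same bound holds over all of `B`. -/
theorem corollary_wedge_estimate {n : ℕ} (f : Fin n → ℝ × ℝ → ℝ) (γ : Fin n → ℝ)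
    (r₀ : ℝ) (hr₀ : 0 < r₀) (hsf : StandardForm n f γ (disk2 r₀))
    (hz : ∃ i, f i 0 = 0)
    (p₁ p₂ : ℝ) (hp : p₁ ≠ p₂) (V : Set (ℝ × ℝ))
    (hV : V = {q : ℝ × ℝ | p₁ * q.1 < q.2 ∧ p₂ * q.1 < q.2} ∨
          V = {q : ℝ × ℝ | q.2 < p₁ * q.1 ∧ q.2 < p₂ * q.1} ∨
          V = {q : ℝ × ℝ | p₁ * q.1 < q.2 ∧ q.2 < p₂ * q.1} ∨
          V = {q : ℝ × ℝ | p₂ * q.1 < q.2 ∧ q.2 < p₁ * q.1})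
    (hF : ∀ i : Fin n, ∀ q ∈ closure V, q.1 ≠ 0 → q.2 ≠ 0 → lowestPart (f i) q ≠ 0) :
    ∃ rB > (0:ℝ), ∀ A > (0:ℝ), ∃ C > (0:ℝ), ∀ α : ℝ × ℝ → ℝ,
      AlphaBound α A → tsupport α ⊆ disk2 rB → ∀ t u : ℝ,
        (‖oscInt (fun p => α p * ∏ i, |f i p| ^ (γ i)) (disk2 rB ∩ V) t u‖ ≤
          C * ∫ p in disk2 rB ∩ V,
            (1 + |t * p.1| + |u * p.2|) ^ (-(1/2 : ℝ)) * ∏ i, |f i p| ^ (γ i)) ∧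
        ((∀ i : Fin n, ∀ q : ℝ × ℝ, q.1 ≠ 0 → q.2 ≠ 0 → lowestPart (f i) q ≠ 0) →
          ‖oscInt (fun p => α p * ∏ i, |f i p| ^ (γ i)) (disk2 rB) t u‖ ≤
            C * ∫ p in disk2 rB,
              (1 + |t * p.1| + |u * p.2|) ^ (-(1/2 : ℝ)) * ∏ i, |f i p| ^ (γ i)) := by
  have hVf : ∃ a b a' b' : ℝ, V = HP a b ∩ HP a' b' := by
    rcases hV with rfl | rfl | rfl | rfl
    · refine ⟨-p₁, 1, -p₂, 1, ?_⟩
      ext q; simp only [HP, mem_inter_iff, mem_ofPred_eq]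
      constructor <;> rintro ⟨h1, h2⟩ <;> constructor <;> linarith
    · refine ⟨p₁, -1, p₂, -1, ?_⟩
      ext q; simp only [HP, mem_inter_iff, mem_ofPred_eq]
      constructor <;> rintro ⟨h1, h2⟩ <;> constructor <;> linarith
    · refine ⟨-p₁, 1, p₂, -1, ?_⟩
      ext q; simp only [HP, mem_inter_iff, mem_ofPred_eq]
      constructor <;> rintro ⟨h1, h2⟩ <;> constructor <;> linarith
    · refine ⟨-p₂, 1, p₁, -1, ?_⟩
      ext q; simp only [HP, mem_inter_iff, mem_ofPred_eq]
      constructor <;> rintro ⟨h1, h2⟩ <;> constructor <;> linarith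
  clear hV
  obtain ⟨a, b, a', b', hVe⟩ := hVf
  obtain ⟨U, hU, hUa⟩ := hsf.analytic
  choose P hP hPz using fun i => lp_of (hUa i 0 (mem_of_mem_nhds hU))
  obtain ⟨U', hU', hint⟩ := hsf.integ
  have hint2 : ∃ rG > 0, IntegrableOn (fun p => ∏ i, |f i p| ^ γ i) (disk2 rG) := by
    obtain ⟨ε, hε, hball⟩ := Metric.mem_nhds_iff.mp hU'
    refine ⟨min ε r₀, lt_min hε hr₀, ?_⟩
    have hm := lt_min hε hr₀
    have h1 : disk2 (min ε r₀) ⊆ U' := by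
      intro p hp
      apply hball
      have hp' : p.1 ^ 2 + p.2 ^ 2 < min ε r₀ ^ 2 := hp
      rw [mem_ball_zero_iff, Prod.norm_def]
      refine lt_of_lt_of_le (max_lt ?_ ?_) (min_le_left ε r₀)
      · rw [Real.norm_eq_abs]
        exact abs_lt_of_sq_lt_sq (by linarith [sq_nonneg p.2]) hm.le
      · rw [Real.norm_eq_abs]
        exact abs_lt_of_sq_lt_sq (by linarith [sq_nonneg p.1]) hm.le
    have h2 : disk2 (min ε r₀) ⊆ disk2 r₀ := disk2_mono hm (min_le_right _ _)
    refine (hint.mono_set h1).congr_fun (fun p hp => ?_) (disk2_open _).measurableSet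
    simp only [stdFun]
    rw [indicator_of_mem (h2 hp)]
  obtain ⟨rG, hrG, hG⟩ := hint2
  obtain ⟨r1, hr1, E1⟩ := coneEst hrG hG hP (V := V) (by rw [hVe]; exact (HP_meas _ _).inter (HP_meas _ _))
    (by rw [hVe]; exact (HP_conv _ _).inter (HP_conv _ _))
    (by rw [hVe]; exact fun c hc p => and_congr (HP_cone _ _ c hc p) (HP_cone _ _ c hc p))
    (fun i q hq h1 h2 => hPz i q (hF i q hq h1 h2))
  have hE2 : ∃ r2 > 0, (∀ i : Fin n, ∀ q : ℝ × ℝ, q.1 ≠ 0 → q.2 ≠ 0 → lowestPart (f i) q ≠ 0) → ∀ r, 0 < r → r ≤ r2 →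
      ∀ A > 0, ∃ C > 0, ∀ α, AlphaBound α A → tsupport α ⊆ disk2 r → ∀ t u,
        ‖∫ p in disk2 r ∩ univ, oscF (fun p => α p * ∏ i, |f i p| ^ γ i) t u p‖ ≤
          C * ∫ p in disk2 r ∩ univ, lamF (fun p => ∏ i, |f i p| ^ γ i) t u p := by
    by_cases hall : ∀ i : Fin n, ∀ q : ℝ × ℝ, q.1 ≠ 0 → q.2 ≠ 0 → lowestPart (f i) q ≠ 0
    · obtain ⟨r2, hr2, E2⟩ := coneEst hrG hG hP (V := univ) MeasurableSet.univ convex_univ (fun c hc p => by simp)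
        (fun i q hq h1 h2 => hPz i q (hall i q h1 h2))
      exact ⟨r2, hr2, fun _ => E2⟩
    · exact ⟨1, one_pos, fun h => absurd h hall⟩
  obtain ⟨r2, hr2, E2⟩ := hE2
  have hrm := lt_min hr1 hr2
  refine ⟨min r1 r2, hrm, fun A hA => ?_⟩
  obtain ⟨C, hC, h1⟩ := E1 _ hrm (min_le_left _ _) A hA
  have hlam : ∀ (S : Set (ℝ × ℝ)) (t u : ℝ), 0 ≤ ∫ p in S, (1 + |t * p.1| + |u * p.2|) ^ (-(1/2 : ℝ)) * ∏ i, |f i p| ^ (γ i) := by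
    intro S t u
    exact integral_nonneg fun p => mul_nonneg (Real.rpow_nonneg (by positivity) _)
      (Finset.prod_nonneg fun i _ => Real.rpow_nonneg (abs_nonneg _) _)
  by_cases hall : ∀ i : Fin n, ∀ q : ℝ × ℝ, q.1 ≠ 0 → q.2 ≠ 0 → lowestPart (f i) q ≠ 0
  · obtain ⟨C', hC', h2⟩ := E2 hall _ hrm (min_le_right _ _) A hA
    refine ⟨C + C', by positivity, fun α hα hs t u => ⟨?_, fun _ => ?_⟩⟩
    · exact (h1 α hα hs t u).trans (mul_le_mul_of_nonneg_right (by linarith) (hlam _ t u))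
    · have h3 := h2 α hα hs t u
      rw [inter_univ] at h3
      exact h3.trans (mul_le_mul_of_nonneg_right (by linarith) (hlam _ t u))
  · exact ⟨C, hC, fun α hα hs t u => ⟨h1 α hα hs t u, fun h => absurd h hall⟩⟩
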